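/- Suppose that for all sufficiently large T, every nontrivial zero ρ = β + iγ of the Riemann zeta function with T < γ ≤ 2T satisfies |β − 1/2| < 0.3185/(2 log T). Then, as T → ∞, the number of nontrivial zeros ρ = β + iγ of ζ with T < γ ≤ 2T and β = 1/2 (counted with multiplicity) is at least (0.66666908 + o(1)) · (T/(2π)) log T. -/

import Mathlib

open Filter Topology MeasureTheory Set

/-- The multiplicity of `ρ` as a zero of the Riemann zeta function:
the least `n` such that the `n`-th iterated derivative of `ζ` is nonzero at `ρ`. -/
noncomputable def zetaMult (ρ : ℂ) : ℕ :=
  sInf {n : ℕ | iteratedDeriv n riemannZeta ρ ≠ 0}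

/-- `ρ` is a nontrivial zero of the Riemann zeta function. -/
def IsNontrivialZero (ρ : ℂ) : Prop :=
  riemannZeta ρ = 0 ∧ 0 < ρ.re ∧ ρ.re < 1

/-- The set of nontrivial zeros `ρ = β + iγ` with `T < γ ≤ 2T`. -/
def zeroBand (T : ℝ) : Set ℂ :=
  {ρ | IsNontrivialZero ρ ∧ T < ρ.im ∧ ρ.im ≤ 2 * T}

/-- Number of nontrivial zeros with `T < γ ≤ 2T`, counted with multiplicity. -/
noncomputable def Ntot (T : ℝ) : ℝ :=
  ∑ᶠ ρ ∈ zeroBand T, (zetaMult ρ : ℝ)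

/-- Number of simple nontrivial zeros with `T < γ ≤ 2T`. -/
noncomputable def Nsimple (T : ℝ) : ℝ :=
  ∑ᶠ ρ ∈ {ρ ∈ zeroBand T | zetaMult ρ = 1}, (1 : ℝ)

/-- Number of nontrivial zeros with `T < γ ≤ 2T` on the critical line, with multiplicity. -/
noncomputable def Nline (T : ℝ) : ℝ :=
  ∑ᶠ ρ ∈ {ρ ∈ zeroBand T | ρ.re = 1/2}, (zetaMult ρ : ℝ)

/-- Number of simple critical-line nontrivial zeros with `T < γ ≤ 2T`. -/
noncomputable def NlineSimple (T : ℝ) : ℝ :=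
  ∑ᶠ ρ ∈ {ρ ∈ zeroBand T | ρ.re = 1/2 ∧ zetaMult ρ = 1}, (1 : ℝ)

noncomputable def xiE (s : ℂ) : ℂ := s * (s - 1) * completedRiemannZeta₀ s + 1

lemma xiE_differentiable : Differentiable ℂ xiE := by
  unfold xiE
  have := differentiable_completedZeta₀
  fun_prop

lemma xiE_one_sub (s : ℂ) : xiE (1 - s) = xiE s := by
  unfold xiE
  rw [completedRiemannZeta₀_one_sub]; ring

lemma xiE_eq {s : ℂ} (h0 : s ≠ 0) (h1 : s ≠ 1) :
    xiE s = s * (s - 1) * completedRiemannZeta s := by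
  unfold xiE
  rw [completedRiemannZeta_eq]
  have : (1 - s) ≠ 0 := sub_ne_zero.mpr (Ne.symm h1)
  field_simp
  ring

lemma xiE_eq_zeta {s : ℂ} (h0 : 0 < s.re) (h1 : s ≠ 1) :
    xiE s = s * (s - 1) * s.Gammaℝ * riemannZeta s := by
  have hs : s ≠ 0 := by rintro rfl; simp at h0
  rw [xiE_eq hs h1, riemannZeta_def_of_ne_zero hs]
  have := Complex.Gammaℝ_ne_zero_of_re_pos h0
  field_simp

lemma L0_strip : ∃ C : ℝ, 0 < C ∧ ∀ s : ℂ, 1/2 ≤ s.re → s.re ≤ 4 → ‖completedRiemannZeta₀ s‖ ≤ C := by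
  set P := HurwitzZeta.hurwitzEvenFEPair 0 with hP
  have hM : ∀ s : ℂ, MellinConvergent P.f_modif s := fun s =>
    (IsStrongFEPair.hasMellin (P.isStrongFEPair_toStrongFEPair) s).1
  have hI : ∀ r : ℝ, IntegrableOn (fun x : ℝ => x ^ (r - 1) * ‖P.f_modif x‖) (Ioi 0) := by
    intro r
    have : IntegrableOn (fun x : ℝ => ‖(x:ℂ) ^ ((r:ℂ) - 1) • P.f_modif x‖) (Ioi 0) := (hM r).norm
    refine this.congr_fun ?_ measurableSet_Ioi
    intro x hx
    simp only [norm_smul]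
    rw [Complex.norm_cpow_eq_rpow_re_of_pos hx]; simp
  set C1 := ∫ x in Ioi (0:ℝ), (x ^ ((1/4:ℝ) - 1) * ‖P.f_modif x‖ + x ^ ((2:ℝ) - 1) * ‖P.f_modif x‖) with hC1
  refine ⟨|C1| + 1, by positivity, fun s h1 h2 => ?_⟩
  have e : completedRiemannZeta₀ s = mellin P.f_modif (s/2) / 2 := rfl
  rw [e, norm_div]
  have : ‖mellin P.f_modif (s/2)‖ ≤ C1 := by
    unfold mellin
    refine norm_integral_le_of_norm_le ((hI _).add (hI _)) ?_
    refine (ae_restrict_iff' measurableSet_Ioi).mpr (Eventually.of_forall fun x hx => ?_)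
    rw [norm_smul, Complex.norm_cpow_eq_rpow_re_of_pos hx, ← add_mul]
    refine mul_le_mul_of_nonneg_right ?_ (norm_nonneg _)
    have hx' : (0:ℝ) < x := hx
    have hre : (s/2 - 1).re = s.re/2 - 1 := by simp
    rw [hre]
    rcases le_total x 1 with h | h
    · have := Real.rpow_le_rpow_of_exponent_ge hx' h (show (1/4:ℝ) - 1 ≤ s.re/2 - 1 by linarith)
      exact le_add_of_le_of_nonneg this (Real.rpow_nonneg hx'.le ((2:ℝ)-1))
    · have := Real.rpow_le_rpow_of_exponent_le h (show s.re/2 - 1 ≤ (2:ℝ) - 1 by linarith)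
      exact le_add_of_nonneg_of_le (Real.rpow_nonneg hx'.le ((1/4:ℝ)-1)) this
  have h3 := le_abs_self C1
  simp only [Complex.norm_ofNat]
  linarith [norm_nonneg (mellin P.f_modif (s/2))]

lemma zeta_norm_le_two {s : ℂ} (hs : 2 ≤ s.re) : ‖riemannZeta s‖ ≤ 2 := by
  have h1 : 1 < s.re := by linarith
  have hs2 : HasSum (fun n : ℕ => 1 / ((n:ℝ)) ^ 2) (Real.pi^2/6) := hasSum_zeta_two
  have hs3 := (hasSum_nat_add_iff' 1).mpr hs2
  simp at hs3
  rw [zeta_eq_tsum_one_div_nat_add_one_cpow h1]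
  refine (tsum_of_norm_bounded hs3 fun n => ?_).trans ?_
  · rw [norm_div, norm_one, ← Nat.cast_succ, Complex.norm_natCast_cpow_of_pos (Nat.succ_pos n), one_div]
    refine inv_anti₀ (by positivity) ?_
    rw [← Real.rpow_natCast]
    push_cast
    exact Real.rpow_le_rpow_of_exponent_le (by linarith [Nat.cast_nonneg (α := ℝ) n]) (by exact_mod_cast hs)
  · nlinarith [Real.pi_lt_d2, Real.pi_pos]

lemma Gamma_le_exp {x : ℝ} (hx : 2 ≤ x) : Real.Gamma x ≤ Real.exp (x ^ (3/2 : ℝ) * 4) := by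
  have hx0 : 0 < x := by linarith
  have h1 : Real.Gamma x ≤ Real.Gamma (⌊x⌋₊ + 1) := 
    Real.Gamma_strictMonoOn_Ici.monotoneOn hx (by simp; linarith [Nat.lt_floor_add_one x]) (Nat.lt_floor_add_one x).le
  rw [Real.Gamma_nat_eq_factorial] at h1
  have h2 : ((Nat.factorial ⌊x⌋₊ : ℕ) : ℝ) ≤ x ^ x := by
    calc ((Nat.factorial ⌊x⌋₊ : ℕ) : ℝ) ≤ ((⌊x⌋₊ ^ ⌊x⌋₊ : ℕ) : ℝ) := by exact_mod_cast Nat.factorial_le_pow _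
      _ ≤ x ^ (⌊x⌋₊ : ℕ) := by push_cast; exact pow_le_pow_left₀ (by positivity) (Nat.floor_le hx0.le) _
      _ = x ^ ((⌊x⌋₊ : ℕ) : ℝ) := (Real.rpow_natCast _ _).symm
      _ ≤ x ^ x := Real.rpow_le_rpow_of_exponent_le (by linarith) (Nat.floor_le hx0.le)
  refine h1.trans (h2.trans ?_)
  rw [Real.rpow_def_of_pos hx0]
  apply Real.exp_le_exp.mpr
  have h3 := Real.log_le_rpow_div hx0.le (show (0:ℝ) < 1/2 by norm_num)
  have h4 : x ^ (3/2:ℝ) = x * x ^ (1/2:ℝ) := by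
    rw [show (3/2:ℝ) = 1 + 1/2 by norm_num, Real.rpow_add hx0, Real.rpow_one]
  rw [h4]
  have h5 := Real.rpow_nonneg hx0.le (1/2:ℝ)
  have h6 : Real.log x ≤ 4 * x ^ (1/2:ℝ) := by linarith
  nlinarith

lemma norm_Gamma_le_re {s : ℂ} (hs : 0 < s.re) : ‖Complex.Gamma s‖ ≤ Real.Gamma s.re := by
  rw [Complex.Gamma_eq_integral hs, Real.Gamma_eq_integral hs, Complex.GammaIntegral]
  refine norm_integral_le_of_norm_le (Real.GammaIntegral_convergent hs) ?_
  refine (ae_restrict_iff' measurableSet_Ioi).mpr (Eventually.of_forall fun x hx => ?_)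
  rw [norm_mul, Complex.norm_cpow_eq_rpow_re_of_pos hx]
  simp [Complex.norm_exp]

lemma norm_Gammaℝ_le {s : ℂ} (hs : 4 ≤ s.re) : ‖s.Gammaℝ‖ ≤ Real.exp ((s.re/2) ^ (3/2 : ℝ) * 4) := by
  rw [Complex.Gammaℝ_def, norm_mul]
  have h1 : ‖(Real.pi : ℂ) ^ (-s/2)‖ ≤ 1 := by
    rw [Complex.norm_cpow_eq_rpow_re_of_pos Real.pi_pos]
    refine Real.rpow_le_one_of_one_le_of_nonpos (by linarith [Real.pi_gt_three]) ?_
    simp; linarith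
  have h2 : ‖Complex.Gamma (s/2)‖ ≤ Real.Gamma (s.re/2) := by
    have : 0 < (s/2).re := by simp; linarith
    have h := norm_Gamma_le_re this
    simpa using h
  have h3 := Gamma_le_exp (show 2 ≤ s.re/2 by linarith)
  calc _ ≤ 1 * Real.Gamma (s.re/2) := mul_le_mul h1 h2 (norm_nonneg _) zero_le_one
    _ ≤ _ := by linarith

lemma xiE_growth : ∃ C : ℝ, 0 < C ∧ ∀ s : ℂ, ‖xiE s‖ ≤ Real.exp (C * (1 + ‖s‖) ^ (3/2 : ℝ)) := by
  obtain ⟨C0, hC0, hL⟩ := L0_strip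
  have key : ∀ r : ℝ, 1 ≤ r → r ≤ r ^ (3/2 : ℝ) ∧ 1 + 2 * r^2 ≤ Real.exp (4 * r ^ (3/2:ℝ)) := by
    intro r hr
    have h1 : r ≤ r ^ (3/2 : ℝ) := Real.self_le_rpow_of_one_le hr (by norm_num)
    refine ⟨h1, ?_⟩
    have h2 : Real.exp (4*r) ≤ Real.exp (4 * r ^ (3/2:ℝ)) := Real.exp_le_exp.mpr (by linarith)
    have h3 := Real.add_one_le_exp (2*r)
    have h4 : Real.exp (4*r) = Real.exp (2*r) ^ 2 := by rw [← Real.exp_nat_mul]; ring_nf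
    nlinarith
  have half : ∀ s : ℂ, 1/2 ≤ s.re → ‖xiE s‖ ≤ Real.exp ((C0 + 8) * (1 + ‖s‖) ^ (3/2 : ℝ)) := by
    intro s hs
    set r := 1 + ‖s‖ with hr
    have hr1 : 1 ≤ r := by simp [hr]
    obtain ⟨k1, k2⟩ := key r hr1
    have hq : ‖s * (s-1)‖ ≤ r^2 := by
      rw [norm_mul]
      have : ‖s - 1‖ ≤ r := (norm_sub_le _ _).trans (by simp [hr, add_comm])
      nlinarith [norm_nonneg s, norm_nonneg (s-1)]
    rcases le_total s.re 4 with h | h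
    · have h1 := hL s hs h
      have : ‖xiE s‖ ≤ r^2 * C0 + 1 := by
        unfold xiE
        refine (norm_add_le _ _).trans ?_
        rw [norm_mul, norm_one]
        gcongr
      have e1 := Real.add_one_le_exp C0
      have e2 : Real.exp C0 ≤ Real.exp (C0 * r ^ (3/2:ℝ)) := Real.exp_le_exp.mpr (by nlinarith)
      have e3 : Real.exp ((C0+8) * r ^ (3/2:ℝ)) = Real.exp (C0 * r ^ (3/2:ℝ)) * Real.exp (4 * r ^ (3/2:ℝ)) * Real.exp (4 * r ^ (3/2:ℝ)) := by
        rw [← Real.exp_add, ← Real.exp_add]; ring_nf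
      have e4 : 1 ≤ Real.exp (4 * r ^ (3/2:ℝ)) := Real.one_le_exp (by positivity)
      rw [e3]
      have e5 : 1 + C0 ≤ Real.exp (C0 * r ^ (3/2:ℝ)) := by linarith
      calc ‖xiE s‖ ≤ (1 + C0) * (1 + 2 * r^2) * 1 := by nlinarith
        _ ≤ _ := by gcongr
    · have hs1 : s ≠ 1 := by rintro rfl; norm_num at h
      rw [xiE_eq_zeta (by linarith) hs1, norm_mul, norm_mul]
      have h1 := zeta_norm_le_two (show 2 ≤ s.re by linarith)
      have h2 := norm_Gammaℝ_le h
      have h3 : Real.exp ((s.re/2) ^ (3/2 : ℝ) * 4) ≤ Real.exp (4 * r ^ (3/2:ℝ)) := by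
        apply Real.exp_le_exp.mpr
        have : (s.re/2) ^ (3/2 : ℝ) ≤ r ^ (3/2:ℝ) := by
          apply Real.rpow_le_rpow (by linarith) _ (by norm_num)
          have := Complex.re_le_norm s
          linarith
        linarith
      have e4 : 1 ≤ Real.exp (C0 * r ^ (3/2:ℝ)) := Real.one_le_exp (by positivity)
      have e3 : Real.exp ((C0+8) * r ^ (3/2:ℝ)) = Real.exp (4 * r ^ (3/2:ℝ)) * Real.exp (4 * r ^ (3/2:ℝ)) * Real.exp (C0 * r ^ (3/2:ℝ)) := by
        rw [← Real.exp_add, ← Real.exp_add]; ring_nf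
      rw [e3]
      calc ‖s * (s-1)‖ * ‖s.Gammaℝ‖ * ‖riemannZeta s‖ ≤ r^2 * Real.exp (4 * r ^ (3/2:ℝ)) * 2 := by
            gcongr
            exact h2.trans h3
        _ = (2 * r^2) * Real.exp (4 * r ^ (3/2:ℝ)) * 1 := by ring
        _ ≤ _ := by gcongr; linarith
  refine ⟨(C0 + 8) * 2 ^ (3/2:ℝ), by positivity, fun s => ?_⟩
  have hm : ∀ s : ℂ, (1:ℝ) + ‖1 - s‖ ≤ 2 * (1 + ‖s‖) := fun s => by
    have := norm_sub_le 1 s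
    rw [norm_one] at this; linarith [norm_nonneg s]
  have h2 : (2 * (1 + ‖s‖)) ^ (3/2:ℝ) = 2 ^ (3/2:ℝ) * (1 + ‖s‖) ^ (3/2:ℝ) :=
    Real.mul_rpow (by norm_num) (by positivity)
  rw [mul_assoc, ← h2]
  rcases le_total (1/2) s.re with h | h
  · refine (half s h).trans (Real.exp_le_exp.mpr ?_)
    gcongr; linarith [norm_nonneg s]
  · rw [← xiE_one_sub]
    refine (half (1-s) (by simp; linarith)).trans (Real.exp_le_exp.mpr ?_)
    gcongr; exact hm s

lemma xiE_zero : xiE 0 = 1 := by simp [xiE]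
lemma xiE_one : xiE 1 = 1 := by simp [xiE]

lemma xiE_ne_zero_of_one_le {s : ℂ} (h : 1 ≤ s.re) : xiE s ≠ 0 := by
  by_cases h1 : s = 1
  · rw [h1, xiE_one]; exact one_ne_zero
  · have h0 : 0 < s.re := by linarith
    rw [xiE_eq_zeta h0 h1]
    have hs : s ≠ 0 := by rintro rfl; simp at h0
    exact mul_ne_zero (mul_ne_zero (mul_ne_zero hs (sub_ne_zero.mpr h1))
      (Complex.Gammaℝ_ne_zero_of_re_pos h0)) (riemannZeta_ne_zero_of_one_le_re h)

lemma xiE_zero_re {s : ℂ} (h : xiE s = 0) : 0 < s.re ∧ s.re < 1 := by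
  constructor
  · by_contra! h1
    have := xiE_ne_zero_of_one_le (s := 1 - s) (by simp; linarith)
    rw [xiE_one_sub] at this; exact this h
  · by_contra! h1
    exact xiE_ne_zero_of_one_le h1 h

lemma xiE_eq_zero_iff (s : ℂ) : xiE s = 0 ↔ IsNontrivialZero s := by
  constructor
  · intro h
    obtain ⟨h0, h1⟩ := xiE_zero_re h
    refine ⟨?_, h0, h1⟩
    have hs1 : s ≠ 1 := by rintro rfl; simp at h1
    have hs : s ≠ 0 := by rintro rfl; simp at h0
    rw [xiE_eq_zeta h0 hs1] at h
    simpa [hs, sub_ne_zero.mpr hs1, Complex.Gammaℝ_ne_zero_of_re_pos h0] using h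
  · rintro ⟨h, h0, h1⟩
    have hs1 : s ≠ 1 := by rintro rfl; simp at h1
    rw [xiE_eq_zeta h0 hs1, h, mul_zero]

lemma entire_order_ne_top {f : ℂ → ℂ} (hf : Differentiable ℂ f) (h0 : f 0 ≠ 0) (z : ℂ) :
    analyticOrderAt f z ≠ ⊤ := by
  intro h
  rw [analyticOrderAt_eq_top] at h
  have := AnalyticOnNhd.eq_of_eventuallyEq (f := f) (g := fun _ => 0)
    (fun x _ => hf.analyticAt x) (fun x _ => analyticAt_const) h
  exact h0 (by rw [this])

lemma entire_factor {f : ℂ → ℂ} (hf : Differentiable ℂ f) (h0 : f 0 ≠ 0) (S : Finset ℂ) :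
    ∃ h : ℂ → ℂ, Differentiable ℂ h ∧
      (∀ s, f s = (∏ ρ ∈ S, (s - ρ) ^ (analyticOrderNatAt f ρ)) * h s) ∧ ∀ ρ ∈ S, h ρ ≠ 0 := by
  classical
  induction S using Finset.induction_on with
  | empty => exact ⟨f, hf, by simp, by simp⟩
  | insert a S ha ih =>
    obtain ⟨h, hh, he, hn⟩ := ih
    set n := analyticOrderNatAt f a with hn'
    set P : ℂ → ℂ := fun s => ∏ ρ ∈ S, (s - ρ) ^ (analyticOrderNatAt f ρ) with hP
    have hPd : Differentiable ℂ P := by simp only [hP]; fun_prop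
    have hPa : P a ≠ 0 := by
      simp only [hP]
      refine Finset.prod_ne_zero_iff.mpr fun ρ hρ => pow_ne_zero _ (sub_ne_zero.mpr ?_)
      rintro rfl; exact ha hρ
    have hfP : f = P * h := funext he
    have hord : analyticOrderAt h a = n := by
      have h1 : analyticOrderAt f a = analyticOrderAt P a + analyticOrderAt h a := by
        conv_lhs => rw [hfP]
        exact analyticOrderAt_mul (hPd.analyticAt a) (hh.analyticAt a)
      rw [(hPd.analyticAt a).analyticOrderAt_eq_zero.mpr hPa, zero_add] at h1
      rw [← h1, hn', Nat.cast_analyticOrderNatAt (entire_order_ne_top hf h0 a)]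
    obtain ⟨g, hg, hga, hge⟩ := (hh.analyticAt a).analyticOrderAt_eq_natCast.mp hord
    let k : ℂ → ℂ := fun z => if z = a then g a else h z / (z - a) ^ n
    have hk1 : ∀ z, z ≠ a → k z = h z / (z - a) ^ n := fun z hz => if_neg hz
    have hka : k a = g a := if_pos rfl
    have hka' : k =ᶠ[𝓝 a] g := by
      filter_upwards [hge] with z hz
      by_cases hza : z = a
      · rw [hza, hka]
      · rw [hk1 z hza, hz, smul_eq_mul]
        have := pow_ne_zero n (sub_ne_zero.mpr hza)
        field_simp
    have hhk : ∀ z, h z = (z - a) ^ n * k z := by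
      intro z
      by_cases hza : z = a
      · rw [hza, hka]
        have := hge.self_of_nhds
        simpa using this
      · rw [hk1 z hza]
        have := pow_ne_zero n (sub_ne_zero.mpr hza)
        field_simp
    refine ⟨k, ?_, ?_, ?_⟩
    · intro z
      by_cases hza : z = a
      · rw [hza]; exact hg.differentiableAt.congr_of_eventuallyEq hka'
      · have : k =ᶠ[𝓝 z] fun z => h z / (z - a) ^ n := by
          filter_upwards [isOpen_ne.mem_nhds hza] with w hw using hk1 w hw
        refine DifferentiableAt.congr_of_eventuallyEq ?_ this
        refine (hh z).div (by fun_prop) (pow_ne_zero n (sub_ne_zero.mpr hza))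
    · intro s
      rw [he s, Finset.prod_insert ha, hhk s]; ring
    · intro ρ hρ
      rcases Finset.mem_insert.mp hρ with rfl | h1
      · rw [hka]; exact hga
      · have := hn ρ h1
        rw [hhk ρ] at this
        exact right_ne_zero_of_mul this

noncomputable def ordE (ρ : ℂ) : ℕ := analyticOrderNatAt xiE ρ

lemma xiE_zero_ne : xiE 0 ≠ 0 := by rw [xiE_zero]; exact one_ne_zero

lemma ordE_eq_zetaMult {ρ : ℂ} (h : xiE ρ = 0) : zetaMult ρ = ordE ρ := by
  obtain ⟨h0, h1⟩ := xiE_zero_re h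
  have hs1 : ρ ≠ 1 := by rintro rfl; simp at h1
  have hs : ρ ≠ 0 := by rintro rfl; simp at h0
  have hz : AnalyticAt ℂ riemannZeta ρ := by
    refine DifferentiableOn.analyticAt (s := {1}ᶜ) differentiableOn_riemannZeta
      (isOpen_compl_singleton.mem_nhds hs1)
  let F : ℂ → ℂ := fun s => s * (s - 1) * (s.Gammaℝ⁻¹)⁻¹
  have hF : AnalyticAt ℂ F ρ := by
    refine AnalyticAt.mul (by fun_prop) (AnalyticAt.inv (Complex.differentiable_Gammaℝ_inv.analyticAt ρ) ?_)
    exact inv_ne_zero (Complex.Gammaℝ_ne_zero_of_re_pos h0)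
  have hF0 : F ρ ≠ 0 := by
    simp only [F, inv_inv]
    exact mul_ne_zero (mul_ne_zero hs (sub_ne_zero.mpr hs1)) (Complex.Gammaℝ_ne_zero_of_re_pos h0)
  have heq : xiE =ᶠ[𝓝 ρ] F * riemannZeta := by
    have o1 : {s : ℂ | 0 < s.re} ∈ 𝓝 ρ := (isOpen_lt continuous_const Complex.continuous_re).mem_nhds h0
    filter_upwards [o1, isOpen_ne.mem_nhds hs1] with s hs0 hs1
    rw [xiE_eq_zeta hs0 hs1]; simp [F]
  have hord : analyticOrderAt riemannZeta ρ = ordE ρ := by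
    rw [ordE, Nat.cast_analyticOrderNatAt (entire_order_ne_top xiE_differentiable xiE_zero_ne ρ),
      analyticOrderAt_congr heq, analyticOrderAt_mul hF hz, hF.analyticOrderAt_eq_zero.mpr hF0, zero_add]
  have a1 := (natCast_le_analyticOrderAt_iff_iteratedDeriv_eq_zero (n := ordE ρ) hz).mp (by rw [hord])
  have a2 : iteratedDeriv (ordE ρ) riemannZeta ρ ≠ 0 := by
    intro hc
    have := (natCast_le_analyticOrderAt_iff_iteratedDeriv_eq_zero (n := ordE ρ + 1) hz).mpr (by
      intro i hi
      rcases Nat.lt_succ_iff_lt_or_eq.mp hi with h | h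
      · exact a1 i h
      · rw [h]; exact hc)
    rw [hord] at this
    have : ordE ρ + 1 ≤ ordE ρ := by exact_mod_cast this
    omega
  unfold zetaMult
  refine le_antisymm (Nat.sInf_le a2) (le_csInf ⟨_, a2⟩ fun b hb => ?_)
  by_contra! hlt
  exact hb (a1 b hlt)

lemma ordE_pos {ρ : ℂ} (h : xiE ρ = 0) : 1 ≤ ordE ρ := by
  rw [Nat.one_le_iff_ne_zero]
  intro h0
  have := (xiE_differentiable.analyticAt ρ).analyticOrderAt_eq_zero.mp (by
    rw [← Nat.cast_analyticOrderNatAt (entire_order_ne_top xiE_differentiable xiE_zero_ne ρ)]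
    unfold ordE at h0; simp [h0])
  exact this h

lemma ordE_eq_of {ρ : ℂ} {n : ℕ} {g : ℂ → ℂ} (hg : Differentiable ℂ g) (h0 : g ρ ≠ 0)
    (h : ∀ z, xiE z = (z - ρ) ^ n * g z) : ordE ρ = n := by
  have := (xiE_differentiable.analyticAt ρ).analyticOrderAt_eq_natCast.mpr
    ⟨g, hg.analyticAt ρ, h0, Eventually.of_forall fun z => by simpa using h z⟩
  simp [ordE, analyticOrderNatAt, this]

lemma ordE_factor (ρ : ℂ) : ∃ g : ℂ → ℂ, Differentiable ℂ g ∧ g ρ ≠ 0 ∧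
    ∀ z, xiE z = (z - ρ) ^ (ordE ρ) * g z := by
  obtain ⟨g, hg, h1, h2⟩ := entire_factor xiE_differentiable xiE_zero_ne {ρ}
  exact ⟨g, hg, h2 ρ (by simp), fun z => by simpa [ordE] using h1 z⟩

lemma ordE_one_sub (ρ : ℂ) : ordE (1 - ρ) = ordE ρ := by
  obtain ⟨g, hg, h1, h2⟩ := ordE_factor ρ
  refine ordE_eq_of (g := fun z => (-1) ^ (ordE ρ) * g (1 - z)) (by fun_prop) (by simpa using h1) fun z => ?_
  rw [← xiE_one_sub, h2, ← mul_assoc, ← mul_pow]; ring_nf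

lemma xiE_conj (s : ℂ) : xiE (starRingEnd ℂ s) = starRingEnd ℂ (xiE s) := by
  have key : ∀ s : ℂ, 2 < s.re → xiE (starRingEnd ℂ s) = starRingEnd ℂ (xiE s) := by
    intro s hs
    have h1 : s ≠ 1 := by rintro rfl; norm_num at hs
    have h1' : starRingEnd ℂ s ≠ 1 := by
      intro h; have := congrArg Complex.re h; simp at this; linarith
    rw [xiE_eq_zeta (by simp; linarith) h1', xiE_eq_zeta (by linarith) h1, riemannZeta_conj]
    simp only [map_mul, map_sub, map_one]
    congr 2
    rw [Complex.Gammaℝ_def, Complex.Gammaℝ_def, map_mul, ← Complex.Gamma_conj]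
    congr 1
    · have := Complex.cpow_conj (Real.pi : ℂ) (-s/2) (by
        rw [Complex.arg_ofReal_of_nonneg Real.pi_pos.le]; exact Real.pi_pos.ne)
      rw [Complex.conj_ofReal] at this
      rw [← this]; simp [Complex.conj_ofNat]
    · simp [Complex.conj_ofNat]
  have hd : Differentiable ℂ (fun s => starRingEnd ℂ (xiE (starRingEnd ℂ s))) := by
    intro z
    have := (xiE_differentiable (starRingEnd ℂ z)).conj_conj
    simpa [Function.comp_def] using this
  have := AnalyticOnNhd.eq_of_eventuallyEq (z₀ := (3:ℂ)) (f := fun s => starRingEnd ℂ (xiE (starRingEnd ℂ s)))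
    (g := xiE) (fun x _ => hd.analyticAt x) (fun x _ => xiE_differentiable.analyticAt x) (by
      have o1 : {s : ℂ | 2 < s.re} ∈ 𝓝 (3:ℂ) := (isOpen_lt continuous_const Complex.continuous_re).mem_nhds (by norm_num)
      filter_upwards [o1] with s hs
      rw [key s hs]; simp)
  have := congrFun this s
  rw [← this]; simp

lemma ordE_conj (ρ : ℂ) : ordE (starRingEnd ℂ ρ) = ordE ρ := by
  obtain ⟨g, hg, h1, h2⟩ := ordE_factor ρ
  refine ordE_eq_of (g := fun z => starRingEnd ℂ (g (starRingEnd ℂ z))) ?_ (by simpa using h1) fun z => ?_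
  · intro z
    have := (hg (starRingEnd ℂ z)).conj_conj
    simpa [Function.comp_def] using this
  · have := xiE_conj (starRingEnd ℂ z)
    rw [Complex.conj_conj] at this
    rw [this, h2]; simp

lemma zeros_finite (R : ℝ) : (Metric.closedBall (1/2:ℂ) R ∩ {s | xiE s = 0}).Finite := by
  refine ((isCompact_closedBall (1/2:ℂ) R).inter_riemannZetaZeros_finite).subset ?_
  rintro s ⟨h1, h2⟩
  exact ⟨h1, ((xiE_eq_zero_iff s).mp h2).1⟩

noncomputable def ZR (R : ℝ) : Finset ℂ := (zeros_finite R).toFinset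

lemma mem_ZR {R : ℝ} {s : ℂ} : s ∈ ZR R ↔ ‖s - 1/2‖ ≤ R ∧ xiE s = 0 := by
  simp [ZR, dist_eq_norm]

lemma ZR_one_sub {R : ℝ} {s : ℂ} : 1 - s ∈ ZR R ↔ s ∈ ZR R := by
  rw [mem_ZR, mem_ZR, xiE_one_sub, ← norm_neg]
  ring_nf

lemma exists_log_of_ne_zero {h : ℂ → ℂ} {r : ℝ} (hr : 0 < r) (hh : Differentiable ℂ h)
    (hn : ∀ z ∈ Metric.ball (0:ℂ) r, h z ≠ 0) :
    ∃ l : ℂ → ℂ, l 0 = 0 ∧ (∀ z ∈ Metric.ball (0:ℂ) r, HasDerivAt l (deriv h z / h z) z) ∧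
      ∀ z ∈ Metric.ball (0:ℂ) r, h z = h 0 * Complex.exp (l z) := by
  have hd : DifferentiableOn ℂ (fun z => deriv h z / h z) (Metric.ball 0 r) := by
    refine DifferentiableOn.div ?_ hh.differentiableOn hn
    exact (hh.differentiableOn (s := univ)).deriv isOpen_univ |>.mono (subset_univ _)
  obtain ⟨l, l0, hl⟩ := hd.isExactOn_ball.with_val_at 0 0
  refine ⟨l, l0, hl, ?_⟩
  have h1 : ∀ z ∈ Metric.ball (0:ℂ) r, HasDerivAt (fun z => h z * Complex.exp (-l z)) 0 z := by
    intro z hz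
    have a := (hh z).hasDerivAt.mul ((hl z hz).neg.cexp)
    refine a.congr_deriv ?_
    have := hn z hz
    simp only [Pi.neg_apply]
    field_simp
    ring
  intro z hz
  have := IsOpen.is_const_of_deriv_eq_zero (f := fun z => h z * Complex.exp (-l z)) Metric.isOpen_ball
    (convex_ball (0:ℂ) r).isPreconnected (fun z hz => (h1 z hz).differentiableAt.differentiableWithinAt)
    (fun z hz => (h1 z hz).deriv) hz (Metric.mem_ball_self hr)
  simp only [l0, neg_zero, Complex.exp_zero, mul_one] at this
  rw [← this, mul_assoc, ← Complex.exp_add]; simp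

lemma log_second_deriv {h : ℂ → ℂ} {R B : ℝ} (hR : 0 < R) (hB : 0 < B) (hh : Differentiable ℂ h)
    (hn : ∀ z ∈ Metric.ball (0:ℂ) R, h z ≠ 0)
    (hb : ∀ z ∈ Metric.ball (0:ℂ) R, ‖h z‖ ≤ ‖h 0‖ * Real.exp B) {s w : ℂ} (hs : ‖s‖ ≤ R/8) (hw : ‖w‖ ≤ R/8) :
    ‖deriv h s / h s - deriv h w / h w‖ ≤ 64 * B / R^2 * ‖s - w‖ := by
  obtain ⟨l, l0, hl, he⟩ := exists_log_of_ne_zero hR hh hn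
  have h00 : h 0 ≠ 0 := hn 0 (Metric.mem_ball_self hR)
  have hld : DifferentiableOn ℂ l (Metric.ball 0 R) := fun z hz => (hl z hz).differentiableAt.differentiableWithinAt
  have b1 : ∀ z, ‖z‖ ≤ R/2 → ‖l z‖ ≤ 2 * B := by
    intro z hz
    have := Complex.borelCaratheodory hB hld (fun z hz => by
      have h1 := hb z hz
      rw [he z hz, norm_mul, Complex.norm_exp] at h1
      have := le_of_mul_le_mul_left h1 (norm_pos_iff.mpr h00)
      exact Real.exp_le_exp.mp this) hR (z := z) (by simp; linarith)
    rw [l0, norm_zero, zero_mul, zero_div, add_zero] at this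
    refine this.trans ?_
    rw [div_le_iff₀ (by linarith)]
    nlinarith
  have b2 : ∀ z, ‖z‖ ≤ R/4 → ‖deriv l z‖ ≤ 2 * B / (R/4) := by
    intro z hz
    refine Complex.norm_deriv_le_of_forall_mem_sphere_norm_le (by positivity) ?_ ?_
    · refine DifferentiableOn.diffContOnCl (hld.mono ?_)
      refine Metric.closure_ball_subset_closedBall.trans fun w hw => ?_
      simp only [Metric.mem_closedBall, dist_eq_norm, Metric.mem_ball, sub_zero] at *
      have := norm_add_le (w - z) z
      rw [sub_add_cancel] at this; linarith
    · intro w hw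
      apply b1
      simp only [mem_sphere_iff_norm] at hw
      have := norm_add_le (w - z) z
      rw [sub_add_cancel] at this; linarith
  have hdd : DifferentiableOn ℂ (deriv l) (Metric.ball 0 R) := hld.deriv Metric.isOpen_ball
  have b3 : ∀ z, ‖z‖ ≤ R/8 → ‖deriv (deriv l) z‖ ≤ 2 * B / (R/4) / (R/8) := by
    intro z hz
    refine Complex.norm_deriv_le_of_forall_mem_sphere_norm_le (by positivity) ?_ ?_
    · refine DifferentiableOn.diffContOnCl (hdd.mono ?_)
      refine Metric.closure_ball_subset_closedBall.trans fun w hw => ?_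
      simp only [Metric.mem_closedBall, dist_eq_norm, Metric.mem_ball, sub_zero] at *
      have := norm_add_le (w - z) z
      rw [sub_add_cancel] at this; linarith
    · intro w hw
      apply b2
      simp only [mem_sphere_iff_norm] at hw
      have := norm_add_le (w - z) z
      rw [sub_add_cancel] at this; linarith
  have inB : ∀ z, ‖z‖ ≤ R/8 → z ∈ Metric.ball (0:ℂ) R := fun z hz => by simp; linarith
  have := (convex_closedBall (0:ℂ) (R/8)).norm_image_sub_le_of_norm_deriv_le (f := deriv l) (x := w) (y := s)
    (C := 2 * B / (R/4) / (R/8))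
    (fun z hz => (hdd z (inB z (by simpa using hz))).differentiableAt (Metric.isOpen_ball.mem_nhds (inB z (by simpa using hz))))
    (fun z hz => b3 z (by simpa using hz)) (by simpa using hw) (by simpa using hs)
  rw [(hl s (inB s hs)).deriv, (hl w (inB w hw)).deriv] at this
  convert this using 2
  field_simp
  norm_num

lemma xiE_logDeriv_one_sub (s : ℂ) : logDeriv xiE (1 - s) = - logDeriv xiE s := by
  have h1 : xiE = fun s => xiE (1 - s) := funext fun s => (xiE_one_sub s).symm
  have h2 : deriv xiE s = - deriv xiE (1 - s) := by
    conv_lhs => rw [h1]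
    rw [deriv_comp_const_sub]
  rw [logDeriv_apply, logDeriv_apply, xiE_one_sub, h2]; ring

lemma sum_ZR_antisymm (R : ℝ) (s : ℂ) : ∑ ρ ∈ ZR R, (ordE ρ : ℂ) / (1 - s - ρ) = - ∑ ρ ∈ ZR R, (ordE ρ : ℂ) / (s - ρ) := by
  rw [← Finset.sum_neg_distrib]
  refine Finset.sum_bij (fun ρ _ => 1 - ρ) (fun ρ h => ZR_one_sub.mpr h) (fun a _ b _ h => by simpa using h)
    (fun b h => ⟨1 - b, ZR_one_sub.mpr h, by ring⟩) (fun ρ _ => ?_)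
  rw [ordE_one_sub, ← div_neg]; ring_nf

lemma hadamard_bound : ∃ C : ℝ, 0 < C ∧ ∀ R : ℝ, 32 ≤ R → ∀ s : ℂ, ‖s‖ ≤ R/32 → xiE s ≠ 0 →
    ‖logDeriv xiE s - ∑ ρ ∈ ZR R, (ordE ρ : ℂ) / (s - ρ)‖ ≤ C * ‖s - (1 - s)‖ * R ^ (-(1/2) : ℝ) := by
  obtain ⟨C, hC, hg⟩ := xiE_growth
  refine ⟨128 * (C * 5 ^ (3/2 : ℝ)), by positivity, fun R hR s hs hE => ?_⟩
  obtain ⟨h, hd, hf, hn⟩ := entire_factor xiE_differentiable xiE_zero_ne (ZR R)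
  set P : ℂ → ℂ := fun s => ∏ ρ ∈ ZR R, (s - ρ) ^ (analyticOrderNatAt xiE ρ) with hP
  have hfP : xiE = fun s => P s * h s := funext hf
  have hR0 : 0 < R := by linarith
  set B := C * (5 * R) ^ (3/2 : ℝ) with hBdef
  have hB : 0 < B := by positivity
  have hnz : ∀ z, ‖z - 1/2‖ ≤ R → h z ≠ 0 := by
    intro z hz
    by_cases h0 : xiE z = 0
    · exact hn z (mem_ZR.mpr ⟨hz, h0⟩)
    · rw [hf] at h0; exact right_ne_zero_of_mul h0
  have hP0 : 0 < ‖P 0‖ := by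
    rw [norm_pos_iff]; have := xiE_zero_ne; rw [hf] at this; exact left_ne_zero_of_mul this
  have hbd : ∀ z, ‖z - 1/2‖ ≤ 4 * R → ‖h z‖ ≤ ‖h 0‖ * Real.exp B := by
    intro z hz
    refine Complex.norm_le_of_forall_mem_frontier_norm_le (U := Metric.ball (1/2:ℂ) (4*R)) Metric.isBounded_ball
      hd.diffContOnCl ?_ (by rw [closure_ball _ (by positivity)]; simpa [dist_eq_norm] using hz)
    intro w hw
    rw [frontier_ball _ (by positivity), mem_sphere_iff_norm] at hw
    have e1 : ‖P 0‖ ≤ ‖P w‖ := by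
      simp only [hP, norm_prod, norm_pow]
      refine Finset.prod_le_prod (fun _ _ => by positivity) fun ρ hρ => ?_
      have hρ1 := (mem_ZR.mp hρ).1
      refine pow_le_pow_left₀ (norm_nonneg _) ?_ _
      have t1 := norm_sub_le (ρ - 1/2) (-1/2:ℂ)
      have t2 := norm_add_le (w - ρ) (ρ - 1/2)
      rw [sub_add_sub_cancel, hw] at t2
      have t3 : ‖(0:ℂ) - ρ‖ = ‖(ρ - 1/2) - (-1/2)‖ := by rw [← norm_neg]; ring_nf
      have t4 : ‖(-1/2:ℂ)‖ = 1/2 := by norm_num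
      rw [t3]; linarith
    have e2 : ‖P w‖ * ‖h w‖ ≤ Real.exp B := by
      rw [← norm_mul, ← hf w]
      refine (hg w).trans (Real.exp_le_exp.mpr ?_)
      simp only [hBdef]
      have t2 := norm_add_le (w - 1/2) (1/2)
      rw [sub_add_cancel, hw] at t2
      have t4 : ‖(1/2:ℂ)‖ = 1/2 := by norm_num
      gcongr; linarith
    have e3 : ‖P 0‖ * ‖h 0‖ = 1 := by rw [← norm_mul, ← hf 0, xiE_zero, norm_one]
    have e4 : ‖P 0‖ * ‖h w‖ ≤ ‖P 0‖ * (‖h 0‖ * Real.exp B) := by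
      rw [← mul_assoc, e3, one_mul]
      exact (mul_le_mul_of_nonneg_right e1 (norm_nonneg _)).trans e2
    exact le_of_mul_le_mul_left e4 hP0
  have hballs : ∀ z ∈ Metric.ball (0:ℂ) (R/2), ‖z - 1/2‖ ≤ R := by
    intro z hz
    simp only [Metric.mem_ball, dist_zero_right] at hz
    have t1 := norm_sub_le z (1/2:ℂ)
    have t4 : ‖(1/2:ℂ)‖ = 1/2 := by norm_num
    linarith
  have hld : ∀ z, xiE z ≠ 0 → deriv h z / h z = logDeriv xiE z - ∑ ρ ∈ ZR R, (ordE ρ : ℂ) / (z - ρ) := by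
    intro z hz
    have hz' := hz
    rw [hf] at hz'
    have n1 := left_ne_zero_of_mul hz'
    have n2 := right_ne_zero_of_mul hz'
    have hPd : DifferentiableAt ℂ P z := by simp only [hP]; fun_prop
    have e1 : logDeriv P z = ∑ ρ ∈ ZR R, (ordE ρ : ℂ) / (z - ρ) := by
      simp only [hP]
      rw [logDeriv_prod]
      · refine Finset.sum_congr rfl fun ρ _ => ?_
        rw [logDeriv_fun_pow (by fun_prop)]
        simp [logDeriv_apply, ordE]; ring
      · exact fun ρ hρ => Finset.prod_ne_zero_iff.mp n1 ρ hρ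
      · intro ρ hρ; fun_prop
    rw [← e1, ← logDeriv_apply]
    conv_rhs => rw [hfP]
    rw [logDeriv_mul z n1 n2 hPd (hd z)]; ring
  have hs2 : ‖1 - s‖ ≤ R/2/8 := by
    have := norm_sub_le 1 s
    rw [norm_one] at this; linarith
  have main := log_second_deriv (R := R/2) (by positivity) hB hd (fun z hz => hnz z (hballs z hz))
    (fun z hz => hbd z ((hballs z hz).trans (by linarith))) (s := s) (w := 1 - s) (by linarith) hs2
  have hEs : xiE (1 - s) ≠ 0 := by rwa [xiE_one_sub]
  rw [hld s hE, hld _ hEs, xiE_logDeriv_one_sub, sum_ZR_antisymm] at main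
  set X := logDeriv xiE s - ∑ ρ ∈ ZR R, (ordE ρ : ℂ) / (s - ρ) with hX
  have e5 : ‖X - (-logDeriv xiE s - -∑ ρ ∈ ZR R, (ordE ρ : ℂ) / (s - ρ))‖ = 2 * ‖X‖ := by
    have : X - (-logDeriv xiE s - -∑ ρ ∈ ZR R, (ordE ρ : ℂ) / (s - ρ)) = 2 * X := by rw [hX]; ring
    rw [this, norm_mul]; norm_num
  rw [e5] at main
  have e6 : B / R^2 = C * 5 ^ (3/2 : ℝ) * R ^ (-(1/2) : ℝ) := by
    rw [hBdef, Real.mul_rpow (by norm_num) hR0.le, ← Real.rpow_natCast R 2, mul_div_assoc, mul_div_assoc, ← Real.rpow_sub hR0]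
    norm_num; ring
  have e7 : 64 * B / (R/2)^2 = 256 * (B / R^2) := by field_simp; norm_num
  rw [e7, e6] at main
  linarith

def ZSet : Set ℂ := {ρ | xiE ρ = 0}

noncomputable def poisK (a y : ℝ) : ℝ := a / (a ^ 2 + y ^ 2)

lemma re_term (n : ℕ) (s ρ : ℂ) : ((n : ℂ) / (s - ρ)).re = n * poisK (s.re - ρ.re) (s.im - ρ.im) := by
  rw [div_eq_mul_inv, ← Complex.ofReal_natCast, Complex.re_ofReal_mul, Complex.inv_re, Complex.normSq_apply, poisK]
  simp only [Complex.sub_re, Complex.sub_im]; ring_nf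

lemma hadamard_tendsto {s : ℂ} (hs : 1 ≤ s.re) :
    Tendsto (fun R => ∑ ρ ∈ ZR R, (ordE ρ : ℝ) * poisK (s.re - ρ.re) (s.im - ρ.im)) atTop (𝓝 (logDeriv xiE s).re) := by
  obtain ⟨C, hC, hb⟩ := hadamard_bound
  have h1 : Tendsto (fun R => ∑ ρ ∈ ZR R, (ordE ρ : ℂ) / (s - ρ)) atTop (𝓝 (logDeriv xiE s)) := by
    rw [tendsto_iff_norm_sub_tendsto_zero]
    have h2 : Tendsto (fun R : ℝ => C * ‖s - (1 - s)‖ * R ^ (-(1/2) : ℝ)) atTop (𝓝 0) := by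
      rw [← mul_zero (C * ‖s - (1 - s)‖)]
      exact (tendsto_rpow_neg_atTop (by norm_num)).const_mul _
    refine squeeze_zero' (Eventually.of_forall fun R => norm_nonneg _) ?_ h2
    filter_upwards [eventually_ge_atTop 32, eventually_ge_atTop (32 * ‖s‖)] with R h3 h4
    rw [norm_sub_rev]
    exact hb R h3 s (by linarith) (xiE_ne_zero_of_one_le hs)
  have := (Complex.continuous_re.tendsto _).comp h1
  refine this.congr fun R => ?_
  simp only [Function.comp, Complex.re_sum, re_term]

lemma poisK_nonneg {a y : ℝ} (ha : 0 ≤ a) : 0 ≤ poisK a y := by unfold poisK; positivity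

lemma hadamard_hasSum {s : ℂ} (hs : 1 ≤ s.re) :
    HasSum (fun ρ : ZSet => (ordE ρ : ℝ) * poisK (s.re - (ρ:ℂ).re) (s.im - (ρ:ℂ).im)) (logDeriv xiE s).re := by
  classical
  set f : ℂ → ℝ := fun ρ => (ordE ρ : ℝ) * poisK (s.re - ρ.re) (s.im - ρ.im) with hf
  have hnn : ∀ ρ, xiE ρ = 0 → 0 ≤ f ρ := fun ρ h =>
    mul_nonneg (Nat.cast_nonneg _) (poisK_nonneg (by linarith [(xiE_zero_re h).2]))
  have ht := hadamard_tendsto hs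
  have hmono : ∀ R R', R ≤ R' → ∑ ρ ∈ ZR R, f ρ ≤ ∑ ρ ∈ ZR R', f ρ := by
    intro R R' h
    refine Finset.sum_le_sum_of_subset_of_nonneg (fun ρ hρ => ?_) (fun ρ hρ _ => hnn ρ (mem_ZR.mp hρ).2)
    exact mem_ZR.mpr ⟨(mem_ZR.mp hρ).1.trans h, (mem_ZR.mp hρ).2⟩
  have hle : ∀ R, ∑ ρ ∈ ZR R, f ρ ≤ (logDeriv xiE s).re := fun R =>
    (Monotone.ge_of_tendsto (fun a b h => hmono a b h) ht R)
  refine hasSum_of_isLUB_of_nonneg _ (fun ρ => hnn ρ ρ.2) ⟨?_, ?_⟩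
  · rintro x ⟨F, rfl⟩
    obtain ⟨R, hR⟩ : ∃ R : ℝ, ∀ ρ ∈ F, ‖(ρ:ℂ) - 1/2‖ ≤ R := by
      refine ⟨∑ ρ ∈ F, ‖(ρ:ℂ) - 1/2‖, fun ρ hρ => ?_⟩
      exact Finset.single_le_sum (f := fun ρ : ZSet => ‖(ρ:ℂ) - 1/2‖) (fun _ _ => norm_nonneg _) hρ
    refine le_trans ?_ (hle R)
    have : ∑ ρ ∈ F, f ρ = ∑ ρ ∈ F.map (Function.Embedding.subtype _), f ρ := by simp
    simp only
    rw [this]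
    refine Finset.sum_le_sum_of_subset_of_nonneg (fun ρ hρ => ?_) (fun ρ hρ _ => hnn ρ (mem_ZR.mp hρ).2)
    simp only [Finset.mem_map, Function.Embedding.subtype_apply] at hρ
    obtain ⟨r, hr, rfl⟩ := hρ
    exact mem_ZR.mpr ⟨hR r hr, r.2⟩
  · intro x hx
    refine le_of_tendsto ht (Eventually.of_forall fun R => ?_)
    let F : Finset ZSet := (ZR R).subtype (fun ρ => ρ ∈ ZSet)
    have h1 := hx ⟨F, rfl⟩
    refine le_trans (le_of_eq ?_) h1
    simp only
    have : ∑ ρ ∈ F, f ρ = ∑ ρ ∈ F.map (Function.Embedding.subtype _), f ρ := by simp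
    rw [this]
    refine Finset.sum_congr ?_ fun _ _ => rfl
    ext ρ
    simp only [Finset.mem_map, Function.Embedding.subtype_apply, F, Finset.mem_subtype]
    constructor
    · intro h; exact ⟨⟨ρ, (mem_ZR.mp h).2⟩, h, rfl⟩
    · rintro ⟨r, hr, rfl⟩; exact hr

lemma norm_GammaSeq_le {s : ℂ} (hs : 0 < s.re) {n : ℕ} (hn : n ≠ 0) :
    ‖Complex.GammaSeq s n‖ ≤ Real.Gamma s.re := by
  rw [Complex.GammaSeq_eq_approx_Gamma_integral hs hn, Real.Gamma_eq_integral hs,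
    intervalIntegral.integral_of_le (Nat.cast_nonneg n)]
  have hi := Real.GammaIntegral_convergent hs
  have hsub : Ioc (0:ℝ) n ⊆ Ioi 0 := fun x hx => hx.1
  refine (norm_integral_le_of_norm_le (hi.mono_set hsub) ?_).trans
    (setIntegral_mono_set hi ?_ hsub.eventuallyLE)
  · refine (ae_restrict_iff' measurableSet_Ioc).mpr (Eventually.of_forall fun x hx => ?_)
    rw [norm_mul, Complex.norm_cpow_eq_rpow_re_of_pos hx.1]
    simp only [Complex.sub_re, Complex.one_re]
    refine mul_le_mul_of_nonneg_right ?_ (Real.rpow_nonneg hx.1.le _)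
    rw [Complex.norm_real, Real.norm_eq_abs, abs_of_nonneg]
    · exact Real.one_sub_div_pow_le_exp_neg hx.2
    · refine pow_nonneg (sub_nonneg.mpr ?_) _
      exact div_le_one_of_le₀ hx.2 (Nat.cast_nonneg n)
  · refine (ae_restrict_iff' measurableSet_Ioi).mpr (Eventually.of_forall fun x hx => ?_)
    have := Real.rpow_nonneg (le_of_lt hx) (s.re - 1)
    simp only [Pi.zero_apply]; positivity

lemma GammaSeq_ne_zero {s : ℂ} (hs : 0 < s.re) {n : ℕ} (hn : n ≠ 0) : Complex.GammaSeq s n ≠ 0 := by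
  unfold Complex.GammaSeq
  refine div_ne_zero (mul_ne_zero ?_ (by exact_mod_cast Nat.factorial_ne_zero n)) ?_
  · rw [Complex.cpow_ne_zero_iff]; left; exact_mod_cast hn
  · refine Finset.prod_ne_zero_iff.mpr fun j _ h => ?_
    have := congrArg Complex.re h
    simp at this
    linarith [Nat.cast_nonneg (α := ℝ) j]

lemma add_nat_ne {s : ℂ} (hs : 0 < s.re) (j : ℕ) : s + j ≠ 0 := by
  intro h
  have := congrArg Complex.re h
  simp at this
  linarith [Nat.cast_nonneg (α := ℝ) j]

lemma GammaSeq_hasDeriv {s : ℂ} (hs : 0 < s.re) {n : ℕ} (hn : n ≠ 0) :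
    DifferentiableAt ℂ (fun s => Complex.GammaSeq s n) s ∧
    logDeriv (fun s => Complex.GammaSeq s n) s = Real.log n - ∑ j ∈ Finset.range (n+1), 1 / (s + j) := by
  have hn' : (n:ℂ) ≠ 0 := by exact_mod_cast hn
  have d1 : DifferentiableAt ℂ (fun s : ℂ => (n:ℂ) ^ s * (n.factorial : ℂ)) s :=
    (differentiableAt_id.const_cpow (Or.inl hn')).mul_const _
  have d2 : DifferentiableAt ℂ (fun s : ℂ => ∏ j ∈ Finset.range (n+1), (s + j)) s := by fun_prop
  have n1 : (n:ℂ) ^ s * (n.factorial : ℂ) ≠ 0 :=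
    mul_ne_zero (by rw [Complex.cpow_ne_zero_iff]; left; exact hn') (by exact_mod_cast Nat.factorial_ne_zero n)
  have n2 : ∏ j ∈ Finset.range (n+1), (s + j) ≠ 0 := Finset.prod_ne_zero_iff.mpr fun j _ => add_nat_ne hs j
  refine ⟨d1.div d2 n2, ?_⟩
  have : (fun s => Complex.GammaSeq s n) = fun s : ℂ => ((n:ℂ) ^ s * (n.factorial : ℂ)) / ∏ j ∈ Finset.range (n+1), (s + j) := rfl
  rw [this, logDeriv_div s n1 n2 d1 d2, logDeriv_prod (fun j _ => add_nat_ne hs j) (fun j _ => by fun_prop)]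
  congr 1
  · rw [logDeriv_mul_const _ _ (by exact_mod_cast Nat.factorial_ne_zero n), logDeriv_apply]
    have h := (hasDerivAt_id s).const_cpow (c := (n:ℂ)) (Or.inl hn')
    simp only [id] at h
    rw [h.deriv, mul_one, Complex.natCast_log, mul_div_cancel_left₀]
    rw [Complex.cpow_ne_zero_iff]; left; exact hn'
  · refine Finset.sum_congr rfl fun j _ => ?_
    simp [logDeriv_apply]

lemma deriv_GammaSeq_tendsto {s : ℂ} (hs : 0 < s.re) :
    Tendsto (fun n : ℕ => deriv (fun s => Complex.GammaSeq s n) s) atTop (𝓝 (deriv Complex.Gamma s)) := by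
  set r := s.re / 2 with hr
  have hr0 : 0 < r := by positivity
  have hre : ∀ z ∈ Metric.closedBall s r, r ≤ z.re ∧ z.re ≤ 3 * r := by
    intro z hz
    rw [Metric.mem_closedBall, dist_eq_norm] at hz
    have := (Complex.abs_re_le_norm (z - s)).trans hz
    rw [Complex.sub_re, abs_le] at this
    constructor <;> linarith
  obtain ⟨M, hM⟩ : ∃ M, ∀ x ∈ Icc r (3*r), Real.Gamma x ≤ M := by
    have hc : ContinuousOn Real.Gamma (Icc r (3*r)) := fun x hx =>
      (Real.differentiableAt_Gamma fun m => by
        have : (0:ℝ) ≤ m := Nat.cast_nonneg m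
        have := hx.1; intro h; linarith).continuousAt.continuousWithinAt
    obtain ⟨M, hM⟩ := (isCompact_Icc.image_of_continuousOn hc).bddAbove
    exact ⟨M, fun x hx => hM ⟨x, hx, rfl⟩⟩
  have hdc : ∀ f : ℂ → ℂ, (∀ z, 0 < z.re → DifferentiableAt ℂ f z) →
      deriv f s = (2 * Real.pi * Complex.I)⁻¹ • ∮ z in C(s, r), (1 / (z - s) ^ 2) • f z := by
    intro f hf
    have hD : DifferentiableOn ℂ f (closure (Metric.ball s r)) := fun z hz =>
      (hf z (by linarith [(hre z (Metric.closure_ball_subset_closedBall hz)).1])).differentiableWithinAt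
    rw [DiffContOnCl.deriv_eq_smul_circleIntegral hr0 hD.diffContOnCl, smul_smul, inv_mul_cancel₀, one_smul]
    exact Complex.two_pi_I_ne_zero
  have e1 : deriv Complex.Gamma s = _ := hdc Complex.Gamma fun z hz => Complex.differentiableAt_Gamma z fun m h => by
    rw [h] at hz; simp at hz; linarith [Nat.cast_nonneg (α := ℝ) m]
  rw [e1]
  have e2 : ∀ᶠ n : ℕ in atTop, (2 * Real.pi * Complex.I)⁻¹ • ∮ z in C(s, r), (1 / (z - s) ^ 2) • Complex.GammaSeq z n = deriv (fun s => Complex.GammaSeq s n) s := by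
    filter_upwards [eventually_ne_atTop 0] with n hn
    rw [hdc _ fun z hz => (GammaSeq_hasDeriv hz hn).1]
  refine Tendsto.congr' e2 (Tendsto.const_smul ?_ _)
  unfold circleIntegral
  have hmem : ∀ θ : ℝ, circleMap s r θ ∈ Metric.closedBall s r := fun θ => circleMap_mem_closedBall s hr0.le θ
  have hnorm : ∀ θ : ℝ, ‖circleMap s r θ - s‖ = r := fun θ => by simp [circleMap, abs_of_pos hr0]
  refine intervalIntegral.tendsto_integral_filter_of_dominated_convergence (fun _ => r * (1 / r^2 * M)) ?_ ?_ ?_ ?_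
  · filter_upwards [eventually_ne_atTop 0] with n hn
    refine Continuous.aestronglyMeasurable ?_
    refine (show Continuous (deriv (circleMap s r)) by
      rw [show deriv (circleMap s r) = fun θ => circleMap 0 r θ * Complex.I from funext (deriv_circleMap s r)]
      exact (continuous_circleMap 0 r).mul continuous_const).fun_smul (Continuous.fun_smul ?_ ?_)
    · refine Continuous.div continuous_const (((continuous_circleMap s r).sub continuous_const).pow 2) fun θ => ?_
      rw [← norm_ne_zero_iff, norm_pow, hnorm]; positivity
    · rw [continuous_iff_continuousAt]
      intro θ
      have h1 := (GammaSeq_hasDeriv (s := circleMap s r θ) (by linarith [(hre _ (hmem θ)).1]) hn).1.continuousAt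
      exact ContinuousAt.comp (f := circleMap s r) (x := θ) h1 (continuous_circleMap s r).continuousAt
  · filter_upwards [eventually_ne_atTop 0] with n hn
    refine Eventually.of_forall fun θ _ => ?_
    have h := hre _ (hmem θ)
    rw [norm_smul, norm_smul, norm_div, norm_pow, hnorm, norm_one, deriv_circleMap, norm_mul, Complex.norm_I, mul_one]
    have : ‖circleMap 0 r θ‖ = r := by simp [abs_of_pos hr0]
    rw [this]
    gcongr
    exact (norm_GammaSeq_le (by linarith) hn).trans (hM _ h)
  · exact intervalIntegrable_const
  · refine Eventually.of_forall fun θ _ => ?_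
    exact ((Complex.GammaSeq_tendsto_Gamma _).const_smul _).const_smul _

lemma digamma_tendsto {s : ℂ} (hs : 0 < s.re) :
    Tendsto (fun n : ℕ => (Real.log n : ℂ) - ∑ j ∈ Finset.range (n+1), 1 / (s + j)) atTop (𝓝 (Complex.digamma s)) := by
  have h := (deriv_GammaSeq_tendsto hs).div (Complex.GammaSeq_tendsto_Gamma s) (Complex.Gamma_ne_zero_of_re_pos hs)
  rw [Complex.digamma_def, logDeriv_apply]
  refine h.congr' ?_
  filter_upwards [eventually_ne_atTop 0] with n hn
  exact (GammaSeq_hasDeriv hs hn).2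

lemma log_step {z : ℂ} (hz : 0 < z.re) : ‖Complex.log (z + 1) - Complex.log z - 1 / z‖ ≤ 1 / ‖z‖ ^ 2 := by
  have hz0 : z ≠ 0 := by rintro rfl; simp at hz
  have hzn : 0 < ‖z‖ := norm_pos_iff.mpr hz0
  have h := norm_image_sub_le_of_norm_deriv_le_segment_01' (f := fun u : ℝ => Complex.log (z + u) - (u:ℂ) * (1 / z))
    (f' := fun u : ℝ => 1 / (z + u) - 1 / z) (C := 1 / ‖z‖^2) ?_ ?_
  · simp only [Complex.ofReal_one, Complex.ofReal_zero, add_zero, one_mul, zero_mul, sub_zero] at h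
    refine le_trans (le_of_eq (congrArg _ ?_)) h; ring
  · intro u hu
    have hsl : z + u ∈ Complex.slitPlane := Or.inl (by simp; linarith [hu.1])
    have d1 : HasDerivAt (fun u : ℝ => z + (u:ℂ)) 1 u := (Complex.ofRealCLM.hasDerivAt (x := u)).const_add z
    have d2 : HasDerivAt (fun u : ℝ => (u:ℂ) * (1/z)) (1 * (1/z)) u := (Complex.ofRealCLM.hasDerivAt (x := u)).mul_const _
    have := (d1.clog_real hsl).sub d2
    rw [one_mul] at this
    exact this.hasDerivWithinAt
  · intro u hu
    have hne : z + u ≠ 0 := by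
      intro h; have := congrArg Complex.re h; simp at this; linarith [hu.1]
    have e : 1 / (z + u) - 1 / z = - u / (z * (z + u)) := by field_simp; ring
    rw [e, norm_div, norm_neg, norm_mul, Complex.norm_real, Real.norm_eq_abs, abs_of_nonneg hu.1]
    have h1 : ‖z‖ ≤ ‖z + u‖ := by
      rw [Complex.norm_def, Complex.norm_def]
      refine Real.sqrt_le_sqrt ?_
      simp [Complex.normSq_apply]
      nlinarith [hu.1]
    rw [pow_two]
    gcongr
    exact hu.2.le

lemma norm_sq_add_nat {s : ℂ} (hs : 0 < s.re) (j : ℕ) : ‖s‖^2 + (j:ℝ)^2 ≤ ‖s + j‖^2 := by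
  rw [← Complex.normSq_eq_norm_sq, ← Complex.normSq_eq_norm_sq]
  simp [Complex.normSq_apply]
  nlinarith [Nat.cast_nonneg (α := ℝ) j]

lemma term_bound {x : ℝ} (hx : 0 < x) (j : ℕ) : 1 / (x^2 + ((j:ℝ)+1)^2) ≤ x ^ (-(4/5):ℝ) * (1 / ((j:ℝ)+1) ^ (6/5:ℝ)) := by
  have hj : (0:ℝ) < (j:ℝ) + 1 := by positivity
  rw [Real.rpow_neg hx.le, ← one_div, one_div_mul_one_div]
  refine one_div_le_one_div_of_le (by positivity) ?_
  have := Real.geom_mean_le_arith_mean2_weighted (w₁ := 2/5) (w₂ := 3/5) (by norm_num) (by norm_num) (sq_nonneg x) (sq_nonneg ((j:ℝ)+1)) (by norm_num)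
  rw [← Real.rpow_natCast, ← Real.rpow_natCast, ← Real.rpow_mul hx.le, ← Real.rpow_mul hj.le] at this
  norm_num at this ⊢
  nlinarith [sq_nonneg x, sq_nonneg ((j:ℝ)+1)]

lemma sum_log_bound {s : ℂ} (hs : 0 < s.re) (n : ℕ) :
    ‖Complex.log (s + n) - Complex.log s - ∑ j ∈ Finset.range n, 1 / (s + j)‖ ≤ ∑ j ∈ Finset.range n, 1 / ‖s + j‖^2 := by
  induction n with
  | zero => simp
  | succ n ih =>
    rw [Finset.sum_range_succ, Finset.sum_range_succ]
    have h := log_step (z := s + n) (by simp; positivity)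
    have e : Complex.log (s + (n+1:ℕ)) - Complex.log s - (∑ j ∈ Finset.range n, 1 / (s + j) + 1 / (s + n)) =
      (Complex.log (s + n) - Complex.log s - ∑ j ∈ Finset.range n, 1 / (s + j)) + (Complex.log (s + n + 1) - Complex.log (s + n) - 1 / (s + n)) := by
      push_cast; ring_nf
    rw [e]
    exact (norm_add_le _ _).trans (add_le_add ih h)

lemma digamma_bound : ∃ C : ℝ, 0 < C ∧ ∀ s : ℂ, 0 < s.re →
    |(Complex.digamma s).re - Real.log ‖s‖| ≤ 1 / ‖s‖^2 + C * ‖s‖ ^ (-(4/5):ℝ) := by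
  have hsum : Summable (fun j : ℕ => 1 / ((j:ℝ)+1) ^ (6/5:ℝ)) := by
    have := (summable_nat_add_iff 1).mpr (Real.summable_one_div_nat_rpow.mpr (show (1:ℝ) < 6/5 by norm_num))
    simpa using this
  refine ⟨∑' j : ℕ, 1 / ((j:ℝ)+1) ^ (6/5:ℝ) + 1, by positivity, fun s hs => ?_⟩
  have hs0 : s ≠ 0 := by rintro rfl; simp at hs
  have hsn : 0 < ‖s‖ := norm_pos_iff.mpr hs0
  have hb : ∀ n : ℕ, ∑ j ∈ Finset.range (n+1), 1 / ‖s + j‖^2 ≤ 1 / ‖s‖^2 + (∑' j : ℕ, 1 / ((j:ℝ)+1) ^ (6/5:ℝ) + 1) * ‖s‖ ^ (-(4/5):ℝ) := by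
    intro n
    rw [Finset.sum_range_succ', add_comm]
    refine add_le_add (by simp) ?_
    have h1 : ∑ j ∈ Finset.range n, 1 / ‖s + (j+1:ℕ)‖^2 ≤ ∑ j ∈ Finset.range n, ‖s‖ ^ (-(4/5):ℝ) * (1 / ((j:ℝ)+1) ^ (6/5:ℝ)) := by
      refine Finset.sum_le_sum fun j _ => ?_
      refine le_trans ?_ (term_bound hsn j)
      refine one_div_le_one_div_of_le (by positivity) ?_
      have := norm_sq_add_nat hs (j+1)
      push_cast at this ⊢; exact this
    refine h1.trans ?_
    rw [← Finset.mul_sum, mul_comm]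
    refine mul_le_mul_of_nonneg_right ?_ (by positivity)
    have := hsum.sum_le_tsum (Finset.range n) (fun j _ => by positivity)
    linarith
  have ht := (Complex.continuous_re.tendsto _).comp (digamma_tendsto hs)
  have hl : Tendsto (fun n : ℕ => Real.log ‖s + (n+1:ℕ)‖ - Real.log n) atTop (𝓝 0) := by
    have h1 : Tendsto (fun n : ℕ => 1 + (s + 1) / (n:ℂ)) atTop (𝓝 1) := by
      have : Tendsto (fun n : ℕ => (s+1) / (n:ℂ)) atTop (𝓝 0) := tendsto_const_div_atTop_nhds_zero_nat (s+1)
      simpa using this.const_add 1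
    have h2 := (Real.continuousAt_log (show ‖(1:ℂ)‖ ≠ 0 by simp)).tendsto.comp h1.norm
    simp only [norm_one, Real.log_one] at h2
    refine h2.congr' ?_
    filter_upwards [eventually_ne_atTop 0] with n hn
    have hn' : (n:ℂ) ≠ 0 := by exact_mod_cast hn
    simp only [Function.comp]
    rw [← Real.log_div (norm_ne_zero_iff.mpr (add_nat_ne hs _)) (by exact_mod_cast hn)]
    congr 1
    have : (n:ℝ) = ‖(n:ℂ)‖ := by simp
    rw [this, ← norm_div]
    congr 1
    push_cast
    field_simp
    ring
  have ht2 := (ht.add hl).sub_const (Real.log ‖s‖)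
  rw [add_zero] at ht2
  refine le_of_tendsto ht2.abs (Eventually.of_forall fun n => ?_)
  refine le_trans ?_ (hb n)
  refine le_trans ?_ (sum_log_bound hs (n+1))
  refine le_trans (le_of_eq ?_) (Complex.abs_re_le_norm _)
  congr 1
  simp only [Function.comp, Complex.sub_re, Complex.log_re, Complex.ofReal_re]
  ring

noncomputable def lamS (s : ℂ) : ℂ := LSeries (fun n => (ArithmeticFunction.vonMangoldt n : ℂ)) s

noncomputable def Aarch (s : ℂ) : ℝ := (1/s + 1/(s-1)).re - Real.log Real.pi / 2 + (Complex.digamma (s/2)).re / 2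

lemma logDeriv_Gammaℝ {s : ℂ} (hs : 0 < s.re) : DifferentiableAt ℂ Complex.Gammaℝ s ∧
    logDeriv Complex.Gammaℝ s = - (Real.log Real.pi : ℂ) / 2 + Complex.digamma (s/2) / 2 := by
  have hpi : (Real.pi : ℂ) ≠ 0 := by exact_mod_cast Real.pi_ne_zero
  have e : Complex.Gammaℝ = fun s => (Real.pi : ℂ) ^ (-s/2) * Complex.Gamma (s/2) := funext Complex.Gammaℝ_def
  have hs2 : 0 < (s/2).re := by simpa using hs
  have hG : DifferentiableAt ℂ Complex.Gamma (s/2) := Complex.differentiableAt_Gamma _ fun m h => by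
    rw [h] at hs2; simp at hs2; linarith [Nat.cast_nonneg (α := ℝ) m]
  have d0 : HasDerivAt (fun s : ℂ => s/2) (1/2) s := (hasDerivAt_id s).div_const 2
  have d2 : HasDerivAt (fun s : ℂ => Complex.Gamma (s/2)) (deriv Complex.Gamma (s/2) * (1/2)) s :=
    HasDerivAt.comp (h := fun s : ℂ => s/2) (h₂ := Complex.Gamma) s hG.hasDerivAt d0
  have d1 : HasDerivAt (fun s : ℂ => (Real.pi : ℂ) ^ (-s/2)) ((Real.pi : ℂ) ^ (-s/2) * Complex.log Real.pi * (-1/2)) s :=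
    (((hasDerivAt_id s).neg).div_const 2).const_cpow (Or.inl hpi)
  have n1 : (Real.pi : ℂ) ^ (-s/2) ≠ 0 := by rw [Complex.cpow_ne_zero_iff]; left; exact hpi
  have n2 := Complex.Gamma_ne_zero_of_re_pos hs2
  rw [e]
  refine ⟨(d1.mul d2).differentiableAt, ?_⟩
  rw [logDeriv_mul s n1 n2 d1.differentiableAt d2.differentiableAt, logDeriv_apply, logDeriv_apply, d1.deriv, d2.deriv,
    Complex.digamma_def, logDeriv_apply, Complex.ofReal_log Real.pi_pos.le]
  field_simp

lemma logDeriv_xiE {s : ℂ} (hs : 1 < s.re) : (logDeriv xiE s).re = Aarch s - (lamS s).re := by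
  have h0 : 0 < s.re := by linarith
  have hs0 : s ≠ 0 := by rintro rfl; simp at h0
  have hs1 : s ≠ 1 := by rintro rfl; simp at hs
  have heq : xiE =ᶠ[𝓝 s] fun s => (s * (s - 1)) * s.Gammaℝ * riemannZeta s := by
    have o1 : {s : ℂ | 0 < s.re} ∈ 𝓝 s := (isOpen_lt continuous_const Complex.continuous_re).mem_nhds h0
    filter_upwards [o1, isOpen_ne.mem_nhds hs1] with s hs0 hs1
    rw [xiE_eq_zeta hs0 hs1]
  obtain ⟨dG, lG⟩ := logDeriv_Gammaℝ h0
  have nG := Complex.Gammaℝ_ne_zero_of_re_pos h0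
  have dz := differentiableAt_riemannZeta hs1
  have nz := riemannZeta_ne_zero_of_one_le_re hs.le
  have hs1' := sub_ne_zero.mpr hs1
  have np : s * (s - 1) ≠ 0 := mul_ne_zero hs0 hs1'
  have dp : DifferentiableAt ℂ (fun s : ℂ => s * (s - 1)) s := by fun_prop
  have dpG : DifferentiableAt ℂ (fun s : ℂ => s * (s - 1) * s.Gammaℝ) s := by fun_prop (disch := assumption)
  have hL : logDeriv riemannZeta s = - lamS s := by
    rw [lamS, ArithmeticFunction.LSeries_vonMangoldt_eq_deriv_riemannZeta_div hs, logDeriv_apply]; ring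
  have : logDeriv xiE s = (1/s + 1/(s-1)) + (- (Real.log Real.pi : ℂ) / 2 + Complex.digamma (s/2) / 2) - lamS s := by
    rw [logDeriv_apply, heq.deriv_eq, heq.self_of_nhds, ← logDeriv_apply (fun s => (s * (s - 1)) * s.Gammaℝ * riemannZeta s),
      logDeriv_mul (f := fun s => s * (s - 1) * s.Gammaℝ) (g := riemannZeta) s (mul_ne_zero np nG) nz dpG dz,
      logDeriv_mul (f := fun s => s * (s - 1)) (g := Complex.Gammaℝ) s np nG dp dG, lG, hL,
      logDeriv_mul (f := fun s : ℂ => s) (g := fun s => s - 1) s hs0 hs1' (by fun_prop) (by fun_prop)]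
    simp [logDeriv_apply]
    ring
  rw [this, Aarch]
  simp only [Complex.add_re, Complex.sub_re, Complex.neg_re, Complex.div_ofNat_re, Complex.ofReal_re]
  ring

lemma Aarch_bound : ∃ C : ℝ, 0 < C ∧ ∀ s : ℂ, 5/4 ≤ s.re →
    |Aarch s - Real.log (‖s‖ / (2 * Real.pi)) / 2| ≤ C * ‖s‖ ^ (-(4/5):ℝ) := by
  obtain ⟨C, hC, hb⟩ := digamma_bound
  refine ⟨6 + 4 + C * 2, by positivity, fun s hs => ?_⟩
  have hn : 5/4 ≤ ‖s‖ := hs.trans (Complex.re_le_norm s)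
  have hn0 : 0 < ‖s‖ := by linarith
  set x := ‖s‖ with hx
  have p1 : x⁻¹ ≤ x ^ (-(4/5):ℝ) := by
    rw [← Real.rpow_neg_one]
    exact Real.rpow_le_rpow_of_exponent_le (by linarith) (by norm_num)
  have p2 : 1 / x^2 ≤ x ^ (-(4/5):ℝ) := by
    rw [one_div, ← Real.rpow_natCast, ← Real.rpow_neg hn0.le]
    exact Real.rpow_le_rpow_of_exponent_le (by linarith) (by norm_num)
  have h1 := hb (s/2) (by simp; linarith)
  have hs2 : ‖s/2‖ = x/2 := by rw [norm_div]; simp [hx]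
  rw [hs2] at h1
  have p3 : (x/2) ^ (-(4/5):ℝ) ≤ 2 * x ^ (-(4/5):ℝ) := by
    rw [Real.div_rpow hn0.le (by norm_num), div_eq_mul_inv, mul_comm, ← Real.rpow_neg (by norm_num)]
    refine mul_le_mul_of_nonneg_right ?_ (by positivity)
    calc (2:ℝ) ^ (-(-(4/5)):ℝ) ≤ 2 ^ (1:ℝ) := Real.rpow_le_rpow_of_exponent_le (by norm_num) (by norm_num)
      _ = 2 := Real.rpow_one _
  have q1 : ‖1/s + 1/(s-1)‖ ≤ 6 * x⁻¹ := by
    refine (norm_add_le _ _).trans ?_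
    rw [norm_div, norm_div, norm_one]
    have : x ≤ 5 * ‖s - 1‖ := by
      have a1 := norm_add_le (s - 1) 1
      rw [sub_add_cancel, norm_one] at a1
      have a2 := Complex.re_le_norm (s - 1)
      simp at a2
      linarith
    have a3 : 1 / ‖s-1‖ ≤ 5 * x⁻¹ := by
      rw [div_le_iff₀ (by linarith), mul_assoc, mul_comm, inv_mul_eq_div, div_mul_eq_mul_div, le_div_iff₀ hn0]
      linarith
    rw [one_div]; linarith
  have q2 := (Complex.abs_re_le_norm (1/s + 1/(s-1))).trans q1
  have hl : Real.log (x/2) = Real.log (x / (2 * Real.pi)) + Real.log Real.pi := by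
    rw [← Real.log_mul (by positivity) Real.pi_ne_zero]; congr 1; field_simp
  have e : Aarch s - Real.log (x / (2 * Real.pi)) / 2 = (1/s + 1/(s-1)).re + ((Complex.digamma (s/2)).re - Real.log (x/2)) / 2 := by
    rw [Aarch, hl]; ring
  rw [e]
  refine (abs_add_le _ _).trans ?_
  rw [abs_div, abs_two]
  have p4 : 1/(x/2)^2 = 4 * (1/x^2) := by field_simp; norm_num
  rw [p4] at h1
  have : C * (x/2) ^ (-(4/5):ℝ) ≤ C * (2 * x ^ (-(4/5):ℝ)) := by gcongr
  have : 0 ≤ x ^ (-(4/5):ℝ) := by positivity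
  nlinarith

lemma lam_summable {σ : ℝ} (hσ : 1 < σ) : Summable (fun n : ℕ => (ArithmeticFunction.vonMangoldt n : ℝ) * (n:ℝ) ^ (-σ)) := by
  have h := (ArithmeticFunction.LSeriesSummable_vonMangoldt (s := σ) (by simpa using hσ)).norm
  refine h.congr fun n => ?_
  rcases eq_or_ne n 0 with rfl | hn
  · simp
  · rw [LSeries.norm_term_eq, if_neg hn, Real.rpow_neg (Nat.cast_nonneg n)]
    simp [abs_of_nonneg ArithmeticFunction.vonMangoldt_nonneg, div_eq_mul_inv]

lemma lamS_re_hasSum {σ τ : ℝ} (hσ : 1 < σ) :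
    HasSum (fun n : ℕ => (ArithmeticFunction.vonMangoldt n : ℝ) * (n:ℝ) ^ (-σ) * Real.cos (τ * Real.log n)) (lamS (σ + τ * Complex.I)).re := by
  have h := (ArithmeticFunction.LSeriesSummable_vonMangoldt (s := σ + τ * Complex.I) (by simpa using hσ)).LSeriesHasSum
  have h2 := Complex.hasSum_re h
  refine h2.congr_fun fun n => ?_
  rcases eq_or_ne n 0 with rfl | hn
  · simp
  · have hn' : (n:ℂ) ≠ 0 := by exact_mod_cast hn
    have hn0 : (0:ℝ) < n := by exact_mod_cast Nat.pos_of_ne_zero hn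
    rw [LSeries.term_of_ne_zero hn, div_eq_mul_inv, ← Complex.cpow_neg, Complex.re_ofReal_mul, mul_assoc]
    congr 1
    rw [Complex.cpow_def_of_ne_zero hn', ← Complex.natCast_log, Complex.exp_re, Real.rpow_def_of_pos hn0]
    have e1 : ((Real.log n : ℂ) * -(σ + τ * Complex.I)).re = Real.log n * -σ := by
      rw [Complex.re_ofReal_mul]; simp
    have e2 : ((Real.log n : ℂ) * -(σ + τ * Complex.I)).im = -(τ * Real.log n) := by
      rw [Complex.im_ofReal_mul]; simp [mul_comm]
    rw [e1, e2, Real.cos_neg]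

lemma p_upper : ∃ C : ℝ, 0 < C ∧ ∀ s : ℂ, 5/4 ≤ s.re → (logDeriv xiE s).re ≤ Real.log ‖s‖ / 2 + C := by
  obtain ⟨C, hC, hb⟩ := Aarch_bound
  set S := ∑' n : ℕ, (ArithmeticFunction.vonMangoldt n : ℝ) * (n:ℝ) ^ (-(5/4):ℝ) with hS
  have hsm := lam_summable (σ := 5/4) (by norm_num)
  have hS0 : 0 ≤ S := tsum_nonneg fun n => mul_nonneg ArithmeticFunction.vonMangoldt_nonneg (by positivity)
  refine ⟨C + S, by positivity, fun s hs => ?_⟩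
  rw [logDeriv_xiE (by linarith)]
  have h1 := hb s hs
  have hn : 5/4 ≤ ‖s‖ := hs.trans (Complex.re_le_norm s)
  have h2 : ‖s‖ ^ (-(4/5):ℝ) ≤ 1 := Real.rpow_le_one_of_one_le_of_nonpos (by linarith) (by norm_num)
  have h3 : Real.log (‖s‖ / (2 * Real.pi)) ≤ Real.log ‖s‖ := by
    refine Real.log_le_log (by positivity) (div_le_self (norm_nonneg _) ?_)
    linarith [Real.pi_gt_three]
  have h4 := lamS_re_hasSum (σ := s.re) (τ := s.im) (by linarith)
  rw [Complex.re_add_im] at h4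
  have h5 : -(lamS s).re ≤ S := by
    refine hasSum_le (fun n => ?_) h4.neg hsm.hasSum
    have hL : 0 ≤ (ArithmeticFunction.vonMangoldt n : ℝ) := ArithmeticFunction.vonMangoldt_nonneg
    rcases Nat.eq_zero_or_pos n with rfl | hn
    · simp
    have : (n:ℝ) ^ (-s.re) ≤ (n:ℝ) ^ (-(5/4):ℝ) := Real.rpow_le_rpow_of_exponent_le (by exact_mod_cast hn) (by linarith)
    have h6 : 0 ≤ (n:ℝ) ^ (-s.re) := by positivity
    have h7 := Real.neg_one_le_cos (s.im * Real.log n)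
    have h8 : ArithmeticFunction.vonMangoldt n * (n:ℝ) ^ (-s.re) ≤ ArithmeticFunction.vonMangoldt n * (n:ℝ) ^ (-(5/4):ℝ) :=
      mul_le_mul_of_nonneg_left this hL
    nlinarith [mul_nonneg hL h6]
  have h6 := (abs_le.mp h1).2
  nlinarith

lemma ordE_eq_zero {ρ : ℂ} (h : xiE ρ ≠ 0) : ordE ρ = 0 := by
  unfold ordE analyticOrderNatAt
  have : analyticOrderAt xiE ρ = 0 := by
    rw [(xiE_differentiable.analyticAt ρ).analyticOrderAt_eq_zero]; exact h
  simp [this]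

lemma hasSum_ZSet {f : ℂ → ℝ} {a : ℝ} : HasSum (fun ρ : ZSet => (ordE ρ : ℝ) * f ρ) a ↔
    HasSum (fun ρ : ℂ => (ordE ρ : ℝ) * f ρ) a := by
  refine hasSum_subtype_iff_of_support_subset (f := fun ρ : ℂ => (ordE ρ : ℝ) * f ρ) ?_
  intro ρ hρ
  by_contra h
  exact hρ (by simp [ordE_eq_zero h])

instance ZSet_countable : Countable ZSet := by
  have : ZSet ⊆ ⋃ n : ℕ, (ZR n : Set ℂ) := by
    intro ρ hρ
    obtain ⟨n, hn⟩ := exists_nat_ge ‖ρ - 1/2‖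
    exact mem_iUnion.mpr ⟨n, by simpa using mem_ZR.mpr ⟨hn, hρ⟩⟩
  exact (Set.Countable.mono this (countable_iUnion fun n => (ZR n).countable_toSet)).to_subtype

/-- the nontrivial zeros contribute weight 0 outside the strip -/
lemma ord_strip {ρ : ℂ} {u v : ℝ} (h : 0 < ρ.re → ρ.re < 1 → u ≤ v) :
    (ordE ρ : ℝ) * u ≤ ordE ρ * v := by
  by_cases hz : xiE ρ = 0
  · exact mul_le_mul_of_nonneg_left (h (xiE_zero_re hz).1 (xiE_zero_re hz).2) (by positivity)
  · simp [ordE_eq_zero hz]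

lemma zsum_one : ∃ C : ℝ, 0 < C ∧ ∀ t : ℝ, Summable (fun ρ : ℂ => (ordE ρ : ℝ) * (1 / (1 + (t - ρ.im)^2))) ∧
    ∑' ρ : ℂ, (ordE ρ : ℝ) * (1 / (1 + (t - ρ.im)^2)) ≤ C * Real.log (|t| + 3) := by
  obtain ⟨C, hC, hb⟩ := p_upper
  refine ⟨10 * (1 + C), by positivity, fun t => ?_⟩
  obtain ⟨s, sre, sim⟩ : ∃ s : ℂ, s.re = 5/4 ∧ s.im = t := ⟨⟨5/4, t⟩, rfl, rfl⟩
  have h := (hasSum_ZSet (f := fun ρ => poisK (s.re - ρ.re) (s.im - ρ.im))).mp (hadamard_hasSum (s := s) (by rw [sre]; norm_num))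
  have hle : ∀ ρ : ℂ, (ordE ρ : ℝ) * (1 / (1 + (t - ρ.im)^2)) ≤ 10 * (ordE ρ * poisK (s.re - ρ.re) (s.im - ρ.im)) := by
    intro ρ
    rw [mul_left_comm]
    apply ord_strip
    intro h0 h1
    rw [sre, sim, poisK, ← mul_div_assoc, div_le_div_iff₀ (by positivity) (by have := sq_pos_of_pos (show 0 < 5/4 - ρ.re by linarith); positivity)]
    nlinarith [sq_nonneg (t - ρ.im), mul_nonneg (sq_nonneg (t - ρ.im)) (show 0 ≤ 1 - ρ.re by linarith)]
  have hsm : Summable (fun ρ : ℂ => (ordE ρ : ℝ) * (1 / (1 + (t - ρ.im)^2))) :=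
    Summable.of_nonneg_of_le (fun ρ => by positivity) hle (h.summable.mul_left 10)
  refine ⟨hsm, ?_⟩
  refine (hsm.tsum_le_tsum hle (h.summable.mul_left 10)).trans ?_
  rw [tsum_mul_left, h.tsum_eq]
  have h1 := hb s sre.ge
  have hn : ‖s‖ ≤ |t| + 3 := by
    refine (Complex.norm_le_abs_re_add_abs_im s).trans ?_
    rw [sre, sim, abs_of_pos (by norm_num)]; linarith
  have hn0 : 0 < ‖s‖ := lt_of_lt_of_le (by rw [sre]; norm_num) (Complex.re_le_norm s)
  have h2 := Real.log_le_log hn0 hn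
  have h3 : 1 ≤ Real.log (|t| + 3) := by
    rw [Real.le_log_iff_exp_le (by positivity)]
    have := Real.exp_one_lt_d9; have := abs_nonneg t; linarith
  have h4 := le_mul_of_one_le_right hC.le h3
  linarith

lemma zsum_T : ∃ C : ℝ, 0 < C ∧ ∀ t T : ℝ, 2 ≤ T → Summable (fun ρ : ℂ => (ordE ρ : ℝ) * (1 / (T^2 + (t - ρ.im)^2))) ∧
    ∑' ρ : ℂ, (ordE ρ : ℝ) * (1 / (T^2 + (t - ρ.im)^2)) ≤ C * Real.log (T + |t| + 3) / T := by
  obtain ⟨C, hC, hb⟩ := p_upper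
  refine ⟨2 * (1 + C), by positivity, fun t T hT => ?_⟩
  obtain ⟨s, sre, sim⟩ : ∃ s : ℂ, s.re = T ∧ s.im = t := ⟨⟨T, t⟩, rfl, rfl⟩
  have h := (hasSum_ZSet (f := fun ρ => poisK (s.re - ρ.re) (s.im - ρ.im))).mp (hadamard_hasSum (s := s) (by rw [sre]; linarith))
  have hle : ∀ ρ : ℂ, (ordE ρ : ℝ) * (1 / (T^2 + (t - ρ.im)^2)) ≤ (2 / T) * (ordE ρ * poisK (s.re - ρ.re) (s.im - ρ.im)) := by
    intro ρ
    rw [mul_left_comm]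
    apply ord_strip
    intro h0 h1
    have ha : 0 < T - ρ.re := by linarith
    rw [sre, sim, poisK, div_mul_div_comm, div_le_div_iff₀ (by positivity) (by positivity)]
    have e1 : T ≤ 2 * (T - ρ.re) := by linarith
    have e2 : (T - ρ.re)^2 + (t - ρ.im)^2 ≤ T^2 + (t - ρ.im)^2 := by nlinarith
    rw [one_mul]
    exact mul_le_mul e1 e2 (by positivity) (by positivity)
  have hsm : Summable (fun ρ : ℂ => (ordE ρ : ℝ) * (1 / (T^2 + (t - ρ.im)^2))) :=
    Summable.of_nonneg_of_le (fun ρ => by positivity) hle (h.summable.mul_left _)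
  refine ⟨hsm, ?_⟩
  refine (hsm.tsum_le_tsum hle (h.summable.mul_left _)).trans ?_
  rw [tsum_mul_left, h.tsum_eq]
  have h1 := hb s (by rw [sre]; linarith)
  have hn : ‖s‖ ≤ T + |t| + 3 := by
    refine (Complex.norm_le_abs_re_add_abs_im s).trans ?_
    rw [sre, sim, abs_of_pos (by linarith)]; linarith
  have hn0 : 0 < ‖s‖ := lt_of_lt_of_le (by rw [sre]; linarith) (Complex.re_le_norm s)
  have h2 := Real.log_le_log hn0 hn
  have h3 : 1 ≤ Real.log (T + |t| + 3) := by
    rw [Real.le_log_iff_exp_le (by positivity)]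
    have := Real.exp_one_lt_d9; have := abs_nonneg t; linarith
  rw [div_mul_eq_mul_div]
  have h4 := le_mul_of_one_le_right hC.le h3
  apply div_le_div_of_nonneg_right _ (by linarith : (0:ℝ) ≤ T)
  linarith

lemma zeroBand_finite (T : ℝ) : (zeroBand T).Finite := by
  refine (ZR (1 + |2*T| + |T|)).finite_toSet.subset ?_
  intro ρ ⟨h1, h2, h3⟩
  refine mem_ZR.mpr ⟨?_, (xiE_eq_zero_iff _).mpr h1⟩
  refine (Complex.norm_le_abs_re_add_abs_im _).trans ?_
  have e1 : |(ρ - 1/2).re| ≤ 1 := by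
    rw [abs_le]; simp; constructor <;> linarith [h1.2.1, h1.2.2]
  have e2 : |(ρ - 1/2).im| ≤ |2*T| + |T| := by
    simp only [Complex.sub_im, Complex.div_ofNat_im, Complex.one_im, zero_div, sub_zero]
    rw [abs_le]; constructor <;> linarith [neg_abs_le T, le_abs_self (2*T), abs_nonneg T, abs_nonneg (2*T)]
  linarith

noncomputable def band (T : ℝ) : Finset ℂ := (zeroBand_finite T).toFinset

lemma mem_band {T : ℝ} {ρ : ℂ} : ρ ∈ band T ↔ xiE ρ = 0 ∧ T < ρ.im ∧ ρ.im ≤ 2 * T := by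
  simp [band, zeroBand, xiE_eq_zero_iff]

lemma Nline_eq (T : ℝ) : Nline T = ∑ ρ ∈ (band T).filter (fun ρ => ρ.re = 1/2), (ordE ρ : ℝ) := by
  unfold Nline
  rw [finsum_mem_eq_finite_toFinset_sum _ ((zeroBand_finite T).subset (sep_subset _ _))]
  refine Finset.sum_congr ?_ ?_
  · ext ρ; simp [band]
  · intro ρ hρ
    simp only [Finset.mem_filter, mem_band] at hρ
    rw [ordE_eq_zetaMult hρ.1.1]

structure GoodG (G : ℝ → ℝ) (θ : ℝ) : Prop where
  smooth : ContDiff ℝ (⊤ : ℕ∞) G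
  even : ∀ a, G (-a) = G a
  supp : ∀ a, θ ≤ |a| → G a = 0
  pos : 0 < θ
  lt : θ < 1

noncomputable def KK (G : ℝ → ℝ) (X Y : ℝ) : ℝ := ∫ a in (0:ℝ)..1, G a * Real.exp (X * a) * Real.cos (Y * a)

lemma KK_bound {G : ℝ → ℝ} {θ : ℝ} (hG : GoodG G θ) : ∃ C : ℝ, 0 < C ∧ ∀ X Y : ℝ,
    |KK G X Y| ≤ C * Real.exp |X| ∧ |KK G X Y| * Y^2 ≤ C * (1 + |X|)^2 * Real.exp |X| := by
  have d0 : Differentiable ℝ G := hG.smooth.differentiable (by simp)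
  have s1 : ContDiff ℝ 1 (deriv G) := by
    have : ContDiff ℝ 2 G := contDiff_infty.mp hG.smooth 2
    exact ((contDiff_succ_iff_deriv (n := 1)).mp this).2.2
  have d1 : Differentiable ℝ (deriv G) := s1.differentiable (by simp)
  have c2 : Continuous (deriv (deriv G)) := s1.continuous_deriv (by simp)
  obtain ⟨B, hB⟩ : ∃ B, ∀ a ∈ Icc (0:ℝ) 1, |G a| + |deriv G a| + |deriv (deriv G) a| ≤ B := by
    obtain ⟨B, hB⟩ := (isCompact_Icc (a := (0:ℝ)) (b := 1)).bddAbove_image (f := fun a => |G a| + |deriv G a| + |deriv (deriv G) a|)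
      (by have := d0.continuous; have := d1.continuous; fun_prop)
    exact ⟨B, fun a ha => hB ⟨a, ha, rfl⟩⟩
  have hB0 : 0 ≤ B := le_trans (by positivity) (hB 0 (by simp))
  have hexp : ∀ X : ℝ, ∀ a ∈ Icc (0:ℝ) 1, Real.exp (X * a) ≤ Real.exp |X| := by
    intro X a ha
    refine Real.exp_le_exp.mpr ?_
    calc X * a ≤ |X| * a := mul_le_mul_of_nonneg_right (le_abs_self X) ha.1
      _ ≤ |X| := mul_le_of_le_one_right (abs_nonneg X) ha.2
  have hsub : ∀ a ∈ uIoc (0:ℝ) 1, a ∈ Icc (0:ℝ) 1 := fun a ha => by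
    rw [uIoc_of_le zero_le_one] at ha; exact ⟨ha.1.le, ha.2⟩
  refine ⟨2 * B + 1, by positivity, fun X Y => ⟨?_, ?_⟩⟩
  · have := intervalIntegral.norm_integral_le_of_norm_le_const (a := 0) (b := 1) (C := B * Real.exp |X|)
      (f := fun a => G a * Real.exp (X * a) * Real.cos (Y * a)) (fun a ha => by
        have ha := hsub a ha
        have h1 := hB a ha
        have h2 := hexp X a ha
        have h3 := Real.abs_cos_le_one (Y * a)
        rw [Real.norm_eq_abs, abs_mul, abs_mul, abs_of_pos (Real.exp_pos _)]
        calc |G a| * Real.exp (X * a) * |Real.cos (Y * a)| ≤ |G a| * Real.exp (X * a) * 1 := by gcongr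
          _ ≤ B * Real.exp |X| := by
            rw [mul_one]
            refine mul_le_mul ?_ h2 (Real.exp_pos _).le hB0
            linarith [abs_nonneg (deriv G a), abs_nonneg (deriv (deriv G) a)])
    rw [Real.norm_eq_abs] at this
    simp only [sub_zero, abs_one, mul_one] at this
    refine this.trans ?_
    gcongr
    linarith
  · set F := fun a => Y * (G a * Real.exp (X * a)) * Real.sin (Y * a) + (deriv G a + X * G a) * Real.exp (X * a) * Real.cos (Y * a) with hF
    set f2 := fun a => (deriv (deriv G) a + 2 * X * deriv G a + X^2 * G a) * Real.exp (X * a) * Real.cos (Y * a) with hf2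
    have hder : ∀ a, HasDerivAt F (Y^2 * (G a * Real.exp (X * a) * Real.cos (Y * a)) + f2 a) a := by
      intro a
      have g0 := (d0 a).hasDerivAt
      have g1 := (d1 a).hasDerivAt
      have e : HasDerivAt (fun a => Real.exp (X * a)) (Real.exp (X * a) * X) a := by
        simpa using ((hasDerivAt_id a).const_mul X).exp
      have s : HasDerivAt (fun a => Real.sin (Y * a)) (Real.cos (Y * a) * Y) a := by
        simpa using ((hasDerivAt_id a).const_mul Y).sin
      have c : HasDerivAt (fun a => Real.cos (Y * a)) (-Real.sin (Y * a) * Y) a := by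
        simpa using ((hasDerivAt_id a).const_mul Y).cos
      refine ((((g0.mul e).const_mul Y).mul s).add (((g1.add (g0.const_mul X)).mul e).mul c)).congr_deriv ?_
      simp only [hf2, Pi.mul_apply, Pi.add_apply]
      ring
    have cc : Continuous fun a => Y^2 * (G a * Real.exp (X * a) * Real.cos (Y * a)) := by
      have := d0.continuous; fun_prop
    have cf2 : Continuous f2 := by
      have := d0.continuous; have := d1.continuous; fun_prop
    have hint := intervalIntegral.integral_eq_sub_of_hasDerivAt (a := 0) (b := 1) (fun a _ => hder a) ((cc.add cf2).intervalIntegrable _ _)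
    rw [intervalIntegral.integral_add (cc.intervalIntegrable _ _) (cf2.intervalIntegrable _ _), intervalIntegral.integral_const_mul] at hint
    have hG1 : G 1 = 0 := hG.supp 1 (by simpa using hG.lt.le)
    have hG1' : deriv G 1 = 0 := by
      have : G =ᶠ[𝓝 1] fun _ => 0 := by
        filter_upwards [lt_mem_nhds hG.lt] with a ha
        exact hG.supp a (ha.le.trans (le_abs_self a))
      rw [this.deriv_eq]; simp
    have h3 : |∫ a in (0:ℝ)..1, f2 a| ≤ B * (1 + |X|)^2 * Real.exp |X| := by
      have := intervalIntegral.norm_integral_le_of_norm_le_const (a := 0) (b := 1) (C := B * (1 + |X|)^2 * Real.exp |X|)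
        (f := f2) (fun a ha => by
          have ha := hsub a ha
          have h1 := hB a ha
          have h2 := hexp X a ha
          have h3 := Real.abs_cos_le_one (Y * a)
          rw [Real.norm_eq_abs, abs_mul, abs_mul, abs_of_pos (Real.exp_pos _)]
          have h4 : |deriv (deriv G) a + 2 * X * deriv G a + X^2 * G a| ≤ B * (1 + |X|)^2 := by
            refine (abs_add_three _ _ _).trans ?_
            rw [abs_mul, abs_mul, abs_mul, abs_pow, abs_two]
            have p0 := abs_nonneg X
            have p1 := abs_nonneg (G a)
            have p2 := abs_nonneg (deriv G a)
            have p3 := abs_nonneg (deriv (deriv G) a)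
            calc _ ≤ (|G a| + |deriv G a| + |deriv (deriv G) a|) * (1 + |X|)^2 := by
                  nlinarith [mul_nonneg p0 p1, mul_nonneg p0 p3, mul_nonneg (sq_nonneg |X|) p2, mul_nonneg (sq_nonneg |X|) p3]
              _ ≤ _ := by gcongr
          calc _ ≤ |deriv (deriv G) a + 2 * X * deriv G a + X^2 * G a| * Real.exp (X * a) * 1 := by gcongr
            _ ≤ _ := by rw [mul_one]; gcongr)
      simpa using this
    have h4 : |F 0| ≤ B * (1 + |X|) := by
      have h1 := hB 0 (by simp)
      simp only [hF, mul_zero, Real.sin_zero, Real.exp_zero, Real.cos_zero, mul_one, zero_add]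
      refine (abs_add_le _ _).trans ?_
      rw [abs_mul]
      have p0 := abs_nonneg X
      have p1 := abs_nonneg (G 0)
      have p2 := abs_nonneg (deriv G 0)
      have p3 := abs_nonneg (deriv (deriv G) 0)
      nlinarith
    have h5 : F 1 = 0 := by simp [hF, hG1, hG1']
    rw [← abs_of_nonneg (sq_nonneg Y), ← abs_mul, mul_comm]
    have h6 : Y^2 * KK G X Y = - F 0 - ∫ a in (0:ℝ)..1, f2 a := by
      rw [KK]; linarith
    rw [h6]
    have h7 : B * (1 + |X|) ≤ B * (1 + |X|)^2 * Real.exp |X| := by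
      have e1 : 1 ≤ Real.exp |X| := Real.one_le_exp (abs_nonneg X)
      have e2 : 1 ≤ 1 + |X| := by linarith [abs_nonneg X]
      calc B * (1 + |X|) = B * (1+|X|) * 1 * 1 := by ring
        _ ≤ B * (1 + |X|) * (1+|X|) * Real.exp |X| := by gcongr
        _ = _ := by ring
    calc |-F 0 - ∫ a in (0:ℝ)..1, f2 a| ≤ |F 0| + |∫ a in (0:ℝ)..1, f2 a| := by
          rw [← abs_neg (F 0)]; exact abs_sub _ _
      _ ≤ 2 * (B * (1 + |X|)^2 * Real.exp |X|) := by linarith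
      _ ≤ (2 * B + 1) * (1 + |X|)^2 * Real.exp |X| := by
        have : 0 ≤ (1 + |X|)^2 * Real.exp |X| := by positivity
        linarith

lemma KK_continuous {G : ℝ → ℝ} {θ : ℝ} (hG : GoodG G θ) (X : ℝ) : Continuous (KK G X) := by
  have := hG.smooth.continuous
  exact intervalIntegral.continuous_parametric_intervalIntegral_of_continuous' (by fun_prop) 0 1

lemma KK_neg (G : ℝ → ℝ) (X Y : ℝ) : KK G X (-Y) = KK G X Y := by
  simp [KK]

lemma integral_odd {g : ℝ → ℝ} (h : ∀ a, g (-a) = - g a) : ∫ a, g a = 0 := by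
  have h1 := integral_neg_eq_self g volume
  simp only [h, integral_neg] at h1
  linarith

open FourierTransform in
lemma fourier_even {W : ℝ → ℝ} (hi : Integrable W) (he : ∀ a, W (-a) = W a) (ξ : ℝ) :
    𝓕 (fun a => (W a : ℂ)) ξ = ((∫ a, W a * Real.cos (2 * Real.pi * ξ * a) : ℝ) : ℂ) := by
  rw [Real.fourier_real_eq_integral_exp_smul]
  have e : ∀ a : ℝ, Complex.exp (((-2 * Real.pi * a * ξ : ℝ) : ℂ) * Complex.I) • (W a : ℂ)
      = ((W a * Real.cos (2 * Real.pi * ξ * a) : ℝ) : ℂ) + ((W a * -Real.sin (2 * Real.pi * ξ * a) : ℝ) : ℂ) * Complex.I := by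
    intro a
    rw [Complex.exp_mul_I, show -2 * Real.pi * a * ξ = -(2 * Real.pi * ξ * a) by ring, smul_eq_mul]
    push_cast
    rw [Complex.cos_neg, Complex.sin_neg]
    ring
  have i1 : Integrable fun a => W a * Real.cos (2 * Real.pi * ξ * a) := by
    refine hi.mul_bdd (c := 1) (by fun_prop) (ae_of_all _ fun a => ?_)
    simpa using Real.abs_cos_le_one _
  have i2 : Integrable fun a => W a * -Real.sin (2 * Real.pi * ξ * a) := by
    refine hi.mul_bdd (c := 1) (by fun_prop) (ae_of_all _ fun a => ?_)
    simpa using Real.abs_sin_le_one _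
  simp_rw [e]
  rw [integral_add i1.ofReal (i2.ofReal.mul_const _), integral_mul_const, integral_complex_ofReal, integral_complex_ofReal,
    integral_odd (g := fun a => W a * -Real.sin (2 * Real.pi * ξ * a))]
  · simp
  · intro a; rw [he]; simp

open FourierTransform in
lemma cos_inversion {W : ℝ → ℝ} (hc : Continuous W) (hi : Integrable W) (he : ∀ a, W (-a) = W a)
    (hΦ : Integrable fun Y => ∫ a, W a * Real.cos (Y * a)) (v : ℝ) :
    ∫ Y, (∫ a, W a * Real.cos (Y * a)) * Real.cos (v * Y) = 2 * Real.pi * W v := by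
  set Φ := fun Y => ∫ a, W a * Real.cos (Y * a) with hΦd
  have hF : 𝓕 (fun a => (W a : ℂ)) = fun ξ => ((Φ (2 * Real.pi * ξ) : ℝ) : ℂ) := by
    funext ξ; exact fourier_even hi he ξ
  have hpi : (2 * Real.pi) ≠ 0 := by positivity
  have hi2 : Integrable fun ξ => Φ (2 * Real.pi * ξ) := hΦ.comp_mul_left' hpi
  have h := Continuous.fourierInv_fourier_eq (f := fun a => (W a : ℂ)) (by fun_prop) hi.ofReal (by rw [hF]; exact hi2.ofReal)
  have hv := congrFun h v
  rw [hF, Real.fourierInv_eq_fourier_neg, fourier_even hi2] at hv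
  · have h2 : ∫ a, Φ (2 * Real.pi * a) * Real.cos (2 * Real.pi * -v * a) = W v := by exact_mod_cast hv
    have h3 := Measure.integral_comp_mul_left (fun Y => Φ Y * Real.cos (v * Y)) (2 * Real.pi)
    have h4 : ∀ a, Real.cos (2 * Real.pi * -v * a) = Real.cos (v * (2 * Real.pi * a)) := fun a => by
      rw [← Real.cos_neg]; ring_nf
    simp_rw [h4] at h2
    rw [h2, abs_of_pos (by positivity), smul_eq_mul] at h3
    change ∫ Y, Φ Y * Real.cos (v * Y) = _
    rw [h3, mul_inv_cancel_left₀ hpi]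
  · intro a
    simp only [hΦd]; congr 1; funext x
    rw [show 2 * Real.pi * -a * x = -(2 * Real.pi * a * x) by ring, Real.cos_neg]

lemma W_integral {G : ℝ → ℝ} {θ : ℝ} (hG : GoodG G θ) (k Y : ℝ) :
    ∫ a, G a * Real.exp (k * |a|) * Real.cos (Y * a) = 2 * KK G k Y := by
  have h := integral_comp_abs (f := fun a => G a * Real.exp (k * a) * Real.cos (Y * a))
  have e : ∀ a, G |a| * Real.exp (k * |a|) * Real.cos (Y * |a|) = G a * Real.exp (k * |a|) * Real.cos (Y * a) := by
    intro a
    rcases abs_choice a with h | h <;> simp [h, hG.even]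
  simp_rw [e] at h
  rw [h, KK, intervalIntegral.integral_of_le zero_le_one]
  congr 1
  refine setIntegral_eq_of_subset_of_forall_sdiff_eq_zero measurableSet_Ioi (fun a ha => ha.1) ?_
  rintro a ⟨h1, h2⟩
  have : 1 < a := by by_contra h; exact h2 ⟨h1, not_lt.mp h⟩
  rw [hG.supp a (by rw [abs_of_pos (by linarith)]; linarith [hG.lt])]; simp

lemma W_integrable {G : ℝ → ℝ} {θ : ℝ} (hG : GoodG G θ) (k : ℝ) :
    Integrable fun a => G a * Real.exp (k * |a|) := by
  have := hG.smooth.continuous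
  refine Continuous.integrable_of_hasCompactSupport (by fun_prop) ?_
  refine HasCompactSupport.of_support_subset_isCompact (isCompact_Icc (a := -1) (b := 1)) ?_
  intro a ha
  by_contra h
  apply ha
  have : θ ≤ |a| := by
    by_contra h2
    rw [not_le, abs_lt] at h2
    exact h ⟨by linarith [hG.lt], by linarith [hG.lt]⟩
  simp [hG.supp a this]

lemma KK_integrable {G : ℝ → ℝ} {θ : ℝ} (hG : GoodG G θ) (k : ℝ) : Integrable (KK G k) := by
  obtain ⟨C, hC, hb⟩ := KK_bound hG
  refine Integrable.mono' (g := fun Y => (C * (1 + |k|)^2 * Real.exp |k| + C * Real.exp |k|) * (1 + Y^2)⁻¹)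
    (integrable_inv_one_add_sq.const_mul _) (KK_continuous hG k).aestronglyMeasurable (ae_of_all _ fun Y => ?_)
  rw [Real.norm_eq_abs, ← div_eq_mul_inv, le_div_iff₀ (by positivity)]
  linarith [(hb k Y).1, (hb k Y).2]

lemma KK_inversion {G : ℝ → ℝ} {θ : ℝ} (hG : GoodG G θ) (k v : ℝ) :
    ∫ Y, KK G k Y * Real.cos (v * Y) = Real.pi * (G v * Real.exp (k * |v|)) := by
  have hc := hG.smooth.continuous
  have h := cos_inversion (W := fun a => G a * Real.exp (k * |a|)) (by fun_prop) (W_integrable hG k)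
    (fun a => by simp [hG.even]) (by simp_rw [W_integral hG]; exact (KK_integrable hG k).const_mul 2) v
  have e : ∀ Y, (∫ a, G a * Real.exp (k * |a|) * Real.cos (Y * a)) * Real.cos (v * Y) = 2 * (KK G k Y * Real.cos (v * Y)) := by
    intro Y; rw [W_integral hG]; ring
  simp only [e, integral_const_mul] at h
  linarith

lemma poisK_eq_integral {a : ℝ} (ha : 0 < a) (y : ℝ) :
    ∫ v in Ioi (0:ℝ), Real.exp (-a * v) * Real.cos (v * y) = poisK a y := by
  have hre : ((-a : ℝ) + y * Complex.I : ℂ).re < 0 := by simpa using ha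
  have h := integral_exp_mul_complex_Ioi hre 0
  have hi := integrableOn_exp_mul_complex_Ioi hre 0
  have h2 := congrArg Complex.re h
  have h3 : (∫ x in Ioi (0:ℝ), Complex.exp (((-a : ℝ) + y * Complex.I : ℂ) * x)).re = ∫ x in Ioi (0:ℝ), (Complex.exp (((-a : ℝ) + y * Complex.I : ℂ) * x)).re :=
    (integral_re hi).symm
  rw [h3] at h2
  have h4 : ∀ x : ℝ, (Complex.exp (((-a : ℝ) + y * Complex.I : ℂ) * x)).re = Real.exp (-a * x) * Real.cos (x * y) := by
    intro x
    rw [Complex.exp_re]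
    congr 2 <;> simp [mul_comm]
  simp_rw [h4] at h2
  rw [h2, poisK]
  simp only [Complex.ofReal_zero, mul_zero, Complex.exp_zero]
  rw [neg_div, Complex.neg_re, one_div, Complex.inv_re, Complex.normSq_apply]
  simp; ring_nf

lemma cos_shift {φ : ℝ → ℝ} (hi : Integrable φ) (he : ∀ y, φ (-y) = φ y) (t γ v : ℝ) :
    ∫ τ, φ (t - τ) * Real.cos (v * (τ - γ)) = (∫ y, φ y * Real.cos (v * y)) * Real.cos (v * (t - γ)) := by
  have h1 := integral_sub_left_eq_self (fun y => φ y * Real.cos (v * (t - y - γ))) volume t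
  simp only [sub_sub_cancel] at h1
  rw [h1]
  have e : ∀ y, φ y * Real.cos (v * (t - y - γ)) = Real.cos (v * (t - γ)) * (φ y * Real.cos (v * y)) + Real.sin (v * (t - γ)) * (φ y * Real.sin (v * y)) := by
    intro y
    rw [show v * (t - y - γ) = v * (t - γ) - v * y by ring, Real.cos_sub]; ring
  have i1 : Integrable fun y => φ y * Real.cos (v * y) :=
    hi.mul_bdd (c := 1) (by fun_prop) (ae_of_all _ fun a => by simpa using Real.abs_cos_le_one _)
  have i2 : Integrable fun y => φ y * Real.sin (v * y) :=
    hi.mul_bdd (c := 1) (by fun_prop) (ae_of_all _ fun a => by simpa using Real.abs_sin_le_one _)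
  simp_rw [e]
  rw [integral_add (i1.const_mul _) (i2.const_mul _), integral_const_mul, integral_const_mul, integral_odd (g := fun y => φ y * Real.sin (v * y)) (fun y => by simp [he])]
  ring

lemma poisson_conv {φ : ℝ → ℝ} (hi : Integrable φ) (he : ∀ y, φ (-y) = φ y) {a : ℝ} (ha : 0 < a) (t γ : ℝ) :
    ∫ τ, φ (t - τ) * poisK a (τ - γ) =
      ∫ v in Ioi (0:ℝ), Real.exp (-a * v) * ((∫ y, φ y * Real.cos (v * y)) * Real.cos (v * (t - γ))) := by
  have hi' : Integrable fun τ => φ (t - τ) := hi.comp_sub_left t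
  have hex : Integrable (fun v => Real.exp (-a * v)) (volume.restrict (Ioi 0)) :=
    integrableOn_exp_mul_Ioi (by linarith) 0
  have hprod : Integrable (Function.uncurry fun τ v => φ (t - τ) * (Real.exp (-a * v) * Real.cos (v * (τ - γ)))) (volume.prod (volume.restrict (Ioi 0))) := by
    have h := (hi'.mul_prod hex).mul_bdd (g := fun p : ℝ × ℝ => Real.cos (p.2 * (p.1 - γ))) (c := 1)
      (by fun_prop) (ae_of_all _ fun p => by simpa using Real.abs_cos_le_one _)
    refine h.congr (ae_of_all _ fun p => ?_)
    simp only [Function.uncurry]; ring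
  simp_rw [← poisK_eq_integral ha, ← integral_const_mul]
  rw [integral_integral_swap hprod]
  congr 1; funext v
  rw [← cos_shift hi he, ← integral_const_mul]
  congr 1; funext τ; ring

lemma xiE_line_cont {σ : ℝ} (hσ : 1 ≤ σ) : Continuous fun τ : ℝ => (logDeriv xiE (σ + τ * Complex.I)).re := by
  refine Complex.continuous_re.comp ?_
  simp only [logDeriv_apply]
  refine Continuous.div₀ ?_ ?_ ?_
  · have : Continuous (deriv xiE) := (xiE_differentiable.contDiff (n := 1)).continuous_deriv (by simp)
    fun_prop
  · have := xiE_differentiable.continuous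
    fun_prop
  · intro τ; exact xiE_ne_zero_of_one_le (by simpa using hσ)

lemma Aarch_diff : ∃ C : ℝ, 0 < C ∧ ∀ t τ : ℝ, 3 ≤ t →
    |Aarch (((5/4:ℝ):ℂ) + τ * Complex.I) - Real.log (t / (2 * Real.pi)) / 2| ≤ C * Real.log t * t ^ (-(4/5):ℝ) * (1 + |t - τ|) ^ (4/5:ℝ) := by
  obtain ⟨C, hC, hb⟩ := Aarch_bound
  refine ⟨2 * C + 4, by positivity, fun t τ ht => ?_⟩
  have ht0 : 0 < t := by linarith
  set s : ℂ := ((5/4:ℝ):ℂ) + τ * Complex.I with hs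
  have sre : s.re = 5/4 := by simp [hs]
  have sim : s.im = τ := by simp [hs]
  have h1 := hb s sre.ge
  set n := ‖s‖ with hn
  have hn1 : 5/4 ≤ n := by rw [← sre]; exact Complex.re_le_norm s
  have hn0 : 0 < n := by linarith
  have hn2 : |τ| ≤ n := by rw [← sim]; exact Complex.abs_im_le_norm s
  have hn3 : n ≤ 5/4 + |τ| := by
    refine (Complex.norm_le_abs_re_add_abs_im s).trans ?_
    rw [sre, sim, abs_of_pos (by norm_num)]
  set r := (1 + |t - τ|) / t with hr
  have hr0 : 0 < r := by positivity
  have hrt : r * t = 1 + |t - τ| := by rw [hr]; field_simp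
  have hpow : t ^ (-(4/5):ℝ) * (1 + |t - τ|) ^ (4/5:ℝ) = r ^ (4/5:ℝ) := by
    rw [hr, Real.div_rpow (by positivity) ht0.le, Real.rpow_neg ht0.le]; field_simp
  rw [mul_assoc, hpow]
  set R := r ^ (4/5:ℝ) with hR
  have hR0 : 0 < R := by positivity
  have hlt : 1 ≤ Real.log t := by
    rw [Real.le_log_iff_exp_le ht0]; have := Real.exp_one_lt_d9; linarith
  have htau1 : |τ| ≤ t + |t - τ| := by
    have := abs_sub_abs_le_abs_sub τ t
    rw [abs_of_pos ht0, abs_sub_comm] at this; linarith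
  have htau2 : t - |t - τ| ≤ |τ| := by
    have := abs_sub_abs_le_abs_sub t τ
    rw [abs_of_pos ht0] at this; linarith
  have hlog : Real.log (n / (2 * Real.pi)) - Real.log (t / (2 * Real.pi)) = Real.log (n / t) := by
    rw [Real.log_div hn0.ne' (by positivity), Real.log_div ht0.ne' (by positivity), Real.log_div hn0.ne' ht0.ne']; ring
  have hup : Real.log (n / t) ≤ 3 * R := by
    have e1 : n / t ≤ 1 + 2 * r := by
      rw [div_le_iff₀ ht0]; nlinarith
    have e2 : Real.log (n/t) ≤ Real.log (1 + 2 * r) := Real.log_le_log (by positivity) e1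
    have e3 : (1 + 2 * r) ^ (4/5:ℝ) ≤ 1 + (2*r) ^ (4/5:ℝ) := by
      have := Real.rpow_add_le_add_rpow (p := 4/5) (a := 1) (b := 2 * r) (by norm_num) (by positivity) (by norm_num) (by norm_num)
      simpa using this
    have e4 : Real.log ((1 + 2 * r) ^ (4/5:ℝ)) ≤ (2*r) ^ (4/5:ℝ) := by
      have := Real.log_le_sub_one_of_pos (show 0 < (1 + 2 * r) ^ (4/5:ℝ) by positivity)
      linarith
    rw [Real.log_rpow (by positivity)] at e4
    have e5 : (2*r) ^ (4/5:ℝ) ≤ 2 * R := by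
      rw [Real.mul_rpow (by norm_num) hr0.le]
      have : (2:ℝ) ^ (4/5:ℝ) ≤ 2 ^ (1:ℝ) := Real.rpow_le_rpow_of_exponent_le (by norm_num) (by norm_num)
      rw [Real.rpow_one] at this
      gcongr
    linarith
  rcases le_or_gt r (1/2) with h2 | h2
  · have hrR : r ≤ R := by
      have := Real.rpow_le_rpow_of_exponent_ge hr0 (by linarith) (show (4/5:ℝ) ≤ 1 by norm_num)
      rwa [Real.rpow_one] at this
    have hlow : -(2 * R) ≤ Real.log (n / t) := by
      have e1 : 1 - r ≤ n / t := by
        rw [le_div_iff₀ ht0]; nlinarith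
      have e2 : Real.log (1 - r) ≤ Real.log (n/t) := Real.log_le_log (by linarith) e1
      have e3 := Real.one_sub_inv_le_log_of_pos (show 0 < 1 - r by linarith)
      have e4 : (1 - r)⁻¹ ≤ 1 + 2 * r := by
        rw [inv_le_iff_one_le_mul₀ (by linarith)]; nlinarith
      linarith
    have hnR : n ^ (-(4/5):ℝ) ≤ 2 * R := by
      have e1 : 1 / (2 * n) ≤ r := by
        rw [div_le_iff₀ (by positivity)]
        have : t ≤ 2 * n := by nlinarith
        nlinarith [mul_le_mul_of_nonneg_left this hr0.le, abs_nonneg (t - τ)]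
      have e2 : (1 / (2 * n)) ^ (4/5:ℝ) ≤ R := Real.rpow_le_rpow (by positivity) e1 (by norm_num)
      rw [Real.div_rpow (by norm_num) (by positivity), Real.one_rpow, Real.mul_rpow (by norm_num) hn0.le, div_le_iff₀ (by positivity)] at e2
      rw [Real.rpow_neg hn0.le, inv_le_iff_one_le_mul₀ (by positivity)]
      have : (2:ℝ) ^ (4/5:ℝ) ≤ 2 ^ (1:ℝ) := Real.rpow_le_rpow_of_exponent_le (by norm_num) (by norm_num)
      rw [Real.rpow_one] at this
      have h3 : 0 < R * n ^ (4/5:ℝ) := by positivity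
      nlinarith
    have h4 : R ≤ Real.log t * R := le_mul_of_one_le_left hR0.le hlt
    have h5 : C * n ^ (-(4/5):ℝ) ≤ C * (2 * (Real.log t * R)) := mul_le_mul_of_nonneg_left (by linarith) hC.le
    rw [abs_le] at h1 ⊢
    constructor <;> linarith [h1.1, h1.2]
  · have hR1 : 1/2 ≤ R := by
      have e1 : (1/2:ℝ) ^ (4/5:ℝ) ≤ R := Real.rpow_le_rpow (by norm_num) h2.le (by norm_num)
      have := Real.rpow_le_rpow_of_exponent_ge (show (0:ℝ) < 1/2 by norm_num) (by norm_num) (show (4/5:ℝ) ≤ 1 by norm_num)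
      rw [Real.rpow_one] at this
      linarith
    have hlow : -(2 * (Real.log t * R)) ≤ Real.log (n / t) := by
      rw [Real.log_div hn0.ne' ht0.ne']
      have := Real.log_nonneg (show 1 ≤ n by linarith)
      nlinarith
    have hnR : n ^ (-(4/5):ℝ) ≤ 1 := Real.rpow_le_one_of_one_le_of_nonpos (by linarith) (by norm_num)
    have h4 : R ≤ Real.log t * R := le_mul_of_one_le_left hR0.le hlt
    have h5 : C * n ^ (-(4/5):ℝ) ≤ C * (2 * (Real.log t * R)) := mul_le_mul_of_nonneg_left (by linarith) hC.le
    rw [abs_le] at h1 ⊢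
    constructor <;> linarith [h1.1, h1.2]

lemma hsc {ι : Type*} {f g : ι → ℝ} {a b : ℝ} (h : HasSum f a) (hf : ∀ i, g i = f i) (hb : b = a) : HasSum g b := by
  rw [hb, funext hf]; exact h

lemma omega_integrable : Integrable fun y : ℝ => (1 + |y|) ^ (-(6/5):ℝ) := by
  have := integrable_one_add_norm (E := ℝ) (μ := volume) (r := 6/5) (by simp; norm_num)
  simpa using this

lemma omega_eq (y : ℝ) : 1 / (1 + |y|)^2 * (1 + |y|) ^ (4/5:ℝ) = (1 + |y|) ^ (-(6/5):ℝ) := by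
  have h : 0 < 1 + |y| := by positivity
  rw [show (-(6/5):ℝ) = -2 + 4/5 by norm_num, Real.rpow_add h, Real.rpow_neg h.le, Real.rpow_two, one_div]

lemma omega_ge (y : ℝ) : 1 / (1 + |y|)^2 ≤ (1 + |y|) ^ (-(6/5):ℝ) := by
  rw [← omega_eq]
  refine le_mul_of_one_le_right (by positivity) (Real.one_le_rpow (by linarith [abs_nonneg y]) (by norm_num))

lemma lamS_abs {τ : ℝ} : |(lamS (((5/4:ℝ):ℂ) + τ * Complex.I)).re| ≤ ∑' n : ℕ, (ArithmeticFunction.vonMangoldt n : ℝ) * (n:ℝ) ^ (-(5/4):ℝ) := by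
  have h := lamS_re_hasSum (σ := 5/4) (τ := τ) (by norm_num)
  have hsm := lam_summable (σ := 5/4) (by norm_num)
  rw [← h.tsum_eq]
  rw [← Real.norm_eq_abs]
  refine (norm_tsum_le_tsum_norm (E := ℝ) ?_).trans ?_
  · refine hsm.of_nonneg_of_le (fun n => norm_nonneg _) fun n => ?_
    rw [norm_mul, norm_mul, Real.norm_of_nonneg ArithmeticFunction.vonMangoldt_nonneg, Real.norm_of_nonneg (by positivity)]
    exact mul_le_of_le_one_right (mul_nonneg ArithmeticFunction.vonMangoldt_nonneg (by positivity)) (Real.abs_cos_le_one _)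
  · refine Summable.tsum_le_tsum (fun n => ?_) ?_ hsm
    · rw [norm_mul, norm_mul, Real.norm_of_nonneg ArithmeticFunction.vonMangoldt_nonneg, Real.norm_of_nonneg (by positivity)]
      exact mul_le_of_le_one_right (mul_nonneg ArithmeticFunction.vonMangoldt_nonneg (by positivity)) (Real.abs_cos_le_one _)
    · refine hsm.of_nonneg_of_le (fun n => norm_nonneg _) fun n => ?_
      rw [norm_mul, norm_mul, Real.norm_of_nonneg ArithmeticFunction.vonMangoldt_nonneg, Real.norm_of_nonneg (by positivity)]
      exact mul_le_of_le_one_right (mul_nonneg ArithmeticFunction.vonMangoldt_nonneg (by positivity)) (Real.abs_cos_le_one _)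

lemma lam_int {φ : ℝ → ℝ} (hi : Integrable φ) (he : ∀ y, φ (-y) = φ y) (t : ℝ) :
    HasSum (fun n : ℕ => (ArithmeticFunction.vonMangoldt n : ℝ) * (n:ℝ) ^ (-(5/4):ℝ) * ((∫ y, φ y * Real.cos (Real.log n * y)) * Real.cos (t * Real.log n)))
      (∫ τ, φ (t - τ) * (lamS (((5/4:ℝ):ℂ) + τ * Complex.I)).re) := by
  have hi' : Integrable fun τ => φ (t - τ) := hi.comp_sub_left t
  have hsm := lam_summable (σ := 5/4) (by norm_num)
  have hint : ∀ n : ℕ, Integrable fun τ => φ (t - τ) * Real.cos (Real.log n * (τ - 0)) := fun n =>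
    hi'.mul_bdd (c := 1) (by fun_prop) (ae_of_all _ fun a => by simpa using Real.abs_cos_le_one _)
  have hl : ∀ n : ℕ, 0 ≤ (ArithmeticFunction.vonMangoldt n : ℝ) * (n:ℝ) ^ (-(5/4):ℝ) := fun n =>
    mul_nonneg ArithmeticFunction.vonMangoldt_nonneg (by positivity)
  have h := hasSum_integral_of_summable_integral_norm (μ := volume)
    (F := fun (n : ℕ) (τ : ℝ) => (ArithmeticFunction.vonMangoldt n : ℝ) * (n:ℝ) ^ (-(5/4):ℝ) * (φ (t - τ) * Real.cos (Real.log n * (τ - 0))))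
    (fun n => (hint n).const_mul _) ?_
  · refine hsc h (fun n => ?_) ?_
    · rw [integral_const_mul, cos_shift hi he, sub_zero, mul_comm t]
    · congr 1; funext τ
      have h1 := (lamS_re_hasSum (σ := 5/4) (τ := τ) (by norm_num)).mul_left (φ (t - τ))
      rw [← h1.tsum_eq]
      congr 1; funext n
      rw [sub_zero, mul_comm τ]; ring
  · refine Summable.of_nonneg_of_le (fun n => integral_nonneg fun _ => norm_nonneg _) (fun n => ?_) (hsm.mul_right (∫ τ, |φ (t - τ)|))
    simp_rw [norm_mul _ (φ _ * _), Real.norm_of_nonneg (hl n)]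
    rw [integral_const_mul]
    refine mul_le_mul_of_nonneg_left ?_ (hl n)
    refine integral_mono (hint n).norm hi'.abs fun τ => ?_
    simp only [norm_mul, Real.norm_eq_abs]
    exact mul_le_of_le_one_right (abs_nonneg _) (Real.abs_cos_le_one _)

lemma explicit_gen : ∃ C : ℝ, 0 < C ∧ ∀ (φ : ℝ → ℝ) (B : ℝ), Continuous φ → (∀ y, φ (-y) = φ y) →
    (∀ y, |φ y| ≤ B * (1 / (1 + |y|)^2)) → ∀ t : ℝ, 3 ≤ t → ∃ D : ℝ,
    HasSum (fun ρ : ℂ => (ordE ρ : ℝ) * ∫ v in Ioi (0:ℝ), Real.exp (-(5/4 - ρ.re) * v) * ((∫ y, φ y * Real.cos (v * y)) * Real.cos (v * (t - ρ.im)))) D ∧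
    |D + (∑' n : ℕ, (ArithmeticFunction.vonMangoldt n : ℝ) * (n:ℝ) ^ (-(5/4):ℝ) * ((∫ y, φ y * Real.cos (Real.log n * y)) * Real.cos (t * Real.log n)))
      - Real.log (t / (2 * Real.pi)) / 2 * ∫ y, φ y| ≤ C * B * Real.log t * t ^ (-(4/5):ℝ) := by
  obtain ⟨C, hC, hA⟩ := Aarch_diff
  set Ω := ∫ y : ℝ, (1 + |y|) ^ (-(6/5):ℝ) with hΩ
  have hΩ0 : 0 ≤ Ω := integral_nonneg fun y => by positivity
  refine ⟨C * Ω + 1, by positivity, fun φ B hc he hb t ht => ?_⟩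
  have hB : 0 ≤ B := by
    have := (abs_nonneg _).trans (hb 0); simpa using this
  have ht0 : 0 < t := by linarith
  have hlt : 0 < Real.log t := Real.log_pos (by linarith)
  have hi : Integrable φ := (omega_integrable.const_mul B).mono' hc.aestronglyMeasurable (ae_of_all _ fun y =>
    (hb y).trans (mul_le_mul_of_nonneg_left (omega_ge y) hB))
  have hi' : Integrable fun τ => φ (t - τ) := hi.comp_sub_left t
  set p : ℝ → ℝ := fun τ => (logDeriv xiE (((5/4:ℝ):ℂ) + τ * Complex.I)).re with hp
  set lam : ℝ → ℝ := fun τ => (lamS (((5/4:ℝ):ℂ) + τ * Complex.I)).re with hlam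
  set A : ℝ → ℝ := fun τ => Aarch (((5/4:ℝ):ℂ) + τ * Complex.I) with hAd
  have hpA : ∀ τ, p τ = A τ - lam τ := fun τ => logDeriv_xiE (by simp; norm_num)
  have hpc : Continuous p := xiE_line_cont (by norm_num)
  have hlc : Continuous lam := by
    have h1 : lam = fun τ => ∑' n : ℕ, (ArithmeticFunction.vonMangoldt n : ℝ) * (n:ℝ) ^ (-(5/4):ℝ) * Real.cos (τ * Real.log n) := by
      funext τ; exact ((lamS_re_hasSum (by norm_num)).tsum_eq).symm
    rw [h1]
    refine continuous_tsum (fun n => by fun_prop) (lam_summable (σ := 5/4) (by norm_num)) fun n τ => ?_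
    rw [norm_mul, norm_mul, Real.norm_of_nonneg ArithmeticFunction.vonMangoldt_nonneg, Real.norm_of_nonneg (by positivity)]
    exact mul_le_of_le_one_right (mul_nonneg ArithmeticFunction.vonMangoldt_nonneg (by positivity)) (Real.abs_cos_le_one _)
  have hAc : Continuous A := by
    have : A = fun τ => p τ + lam τ := by funext τ; rw [hpA]; ring
    rw [this]; fun_prop
  set c0 := Real.log (t / (2 * Real.pi)) / 2 with hc0
  set M := C * B * Real.log t * t ^ (-(4/5):ℝ) with hM
  have hdiff : ∀ τ, |φ (t - τ) * (A τ - c0)| ≤ M * (1 + |t - τ|) ^ (-(6/5):ℝ) := by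
    intro τ
    rw [abs_mul]
    refine (mul_le_mul (hb (t - τ)) (hA t τ ht) (abs_nonneg _) (by positivity)).trans (le_of_eq ?_)
    rw [← omega_eq, hM]; ring
  have hom : Integrable fun τ => M * (1 + |t - τ|) ^ (-(6/5):ℝ) := (omega_integrable.comp_sub_left t).const_mul M
  have iA0 : Integrable fun τ => φ (t - τ) * (A τ - c0) :=
    hom.mono' (by fun_prop) (ae_of_all _ hdiff)
  have iA : Integrable fun τ => φ (t - τ) * A τ := by
    refine (iA0.add (hi'.mul_const c0)).congr (ae_of_all _ fun τ => ?_)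
    simp only [Pi.add_apply]; ring
  have il : Integrable fun τ => φ (t - τ) * lam τ :=
    hi'.mul_bdd hlc.aestronglyMeasurable (ae_of_all _ fun τ => lamS_abs)
  have ip : Integrable fun τ => φ (t - τ) * p τ := by
    refine (iA.sub il).congr (ae_of_all _ fun τ => ?_)
    simp only [Pi.sub_apply, hpA]; ring
  have hsumP : ∀ τ, HasSum (fun ρ : ZSet => (ordE ρ : ℝ) * poisK (5/4 - (ρ:ℂ).re) (τ - (ρ:ℂ).im)) (p τ) := by
    intro τ
    have := hadamard_hasSum (s := ((5/4:ℝ):ℂ) + τ * Complex.I) (by simp; norm_num)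
    refine hsc this (fun ρ => ?_) rfl
    simp
  have hpos : ∀ ρ : ZSet, 0 < 5/4 - (ρ:ℂ).re := fun ρ => by linarith [(xiE_zero_re ρ.2).2]
  have hKc : ∀ ρ : ZSet, Continuous fun τ : ℝ => poisK (5/4 - (ρ:ℂ).re) (τ - (ρ:ℂ).im) := by
    intro ρ
    unfold poisK
    refine continuous_const.div₀ (by fun_prop) fun τ => ?_
    have := hpos ρ; positivity
  have hle : ∀ τ, ∀ s : Finset ZSet, ∑ ρ ∈ s, (ordE ρ : ℝ) * poisK (5/4 - (ρ:ℂ).re) (τ - (ρ:ℂ).im) ≤ p τ := fun τ s =>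
    sum_le_hasSum s (fun ρ _ => mul_nonneg (by positivity) (poisK_nonneg (hpos ρ).le)) (hsumP τ)
  have iT : ∀ ρ : ZSet, Integrable fun τ => φ (t - τ) * ((ordE ρ : ℝ) * poisK (5/4 - (ρ:ℂ).re) (τ - (ρ:ℂ).im)) := by
    intro ρ
    refine ip.mono ?_ (ae_of_all _ fun τ => ?_)
    · have := hKc ρ; fun_prop
    · have h1 := hle τ {ρ}
      rw [Finset.sum_singleton] at h1
      have h2 : 0 ≤ (ordE ρ : ℝ) * poisK (5/4 - (ρ:ℂ).re) (τ - (ρ:ℂ).im) := mul_nonneg (by positivity) (poisK_nonneg (hpos ρ).le)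
      rw [norm_mul, norm_mul _ (p τ), Real.norm_of_nonneg h2, Real.norm_of_nonneg (h2.trans h1)]
      gcongr
  have hS := hasSum_integral_of_summable_integral_norm (μ := volume)
    (F := fun (ρ : ZSet) (τ : ℝ) => φ (t - τ) * ((ordE ρ : ℝ) * poisK (5/4 - (ρ:ℂ).re) (τ - (ρ:ℂ).im))) iT ?_
  · refine ⟨∫ τ, φ (t - τ) * p τ, ?_, ?_⟩
    · refine (hasSum_ZSet (f := fun ρ => ∫ v in Ioi (0:ℝ), Real.exp (-(5/4 - ρ.re) * v) * ((∫ y, φ y * Real.cos (v * y)) * Real.cos (v * (t - ρ.im))))).mp ?_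
      refine hsc hS (fun ρ => ?_) ?_
      · rw [← poisson_conv hi he (hpos ρ), ← integral_const_mul]
        congr 1; funext τ; ring
      · congr 1; funext τ
        rw [tsum_mul_left, (hsumP τ).tsum_eq]
    · rw [(lam_int hi he t).tsum_eq]
      have e1 : ∫ τ, φ (t - τ) * p τ = (∫ τ, φ (t - τ) * A τ) - ∫ τ, φ (t - τ) * lam τ := by
        rw [← integral_sub iA il]; congr 1; funext τ; rw [hpA]; ring
      have e2 : ∫ τ, φ (t - τ) * (A τ - c0) = (∫ τ, φ (t - τ) * A τ) - c0 * ∫ y, φ y := by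
        rw [← integral_sub_left_eq_self φ volume t, ← integral_const_mul, ← integral_sub iA (hi'.const_mul c0)]
        congr 1; funext τ; ring
      have e3 : (∫ τ, φ (t - τ) * p τ) + (∫ τ, φ (t - τ) * lam τ) - c0 * ∫ y, φ y = ∫ τ, φ (t - τ) * (A τ - c0) := by
        rw [e2, e1]; ring
      rw [e3]
      have e4 : |∫ τ, φ (t - τ) * (A τ - c0)| ≤ ∫ τ, M * (1 + |t - τ|) ^ (-(6/5):ℝ) := by
        rw [← Real.norm_eq_abs]
        exact norm_integral_le_of_norm_le hom (ae_of_all _ hdiff)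
      refine e4.trans ?_
      rw [integral_const_mul, integral_sub_left_eq_self (fun y => (1 + |y|) ^ (-(6/5):ℝ)) volume t]
      have : 0 ≤ B * Real.log t * t ^ (-(4/5):ℝ) := by positivity
      rw [hM]; nlinarith
  · refine summable_of_sum_le (c := ∫ τ, |φ (t - τ) * p τ|) (fun ρ => integral_nonneg fun _ => norm_nonneg _) fun s => ?_
    rw [← integral_finsetSum _ (fun ρ _ => (iT ρ).norm)]
    refine integral_mono (integrable_finsetSum _ fun ρ _ => (iT ρ).norm) ip.abs fun τ => ?_
    have h2 : ∀ ρ : ZSet, 0 ≤ (ordE ρ : ℝ) * poisK (5/4 - (ρ:ℂ).re) (τ - (ρ:ℂ).im) := fun ρ => mul_nonneg (by positivity) (poisK_nonneg (hpos ρ).le)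
    simp only [norm_mul (φ _), Real.norm_of_nonneg (h2 _), abs_mul]
    rw [← Finset.mul_sum, Real.norm_eq_abs]
    refine mul_le_mul_of_nonneg_left ((hle τ s).trans (le_abs_self _)) (abs_nonneg _)

lemma KK_Ioi {G : ℝ → ℝ} {θ : ℝ} (hG : GoodG G θ) {L : ℝ} (hL : 0 < L) (x y : ℝ) :
    ∫ v in Ioi (0:ℝ), Real.exp (-(5/4 - x) * v) * (G (v/L) * Real.exp (3/4 * |v|) * Real.cos (v * y)) = L * KK G (L * (x - 1/2)) (L * y) := by
  set f := fun v => Real.exp (-(5/4 - x) * v) * (G (v/L) * Real.exp (3/4 * |v|) * Real.cos (v * y)) with hf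
  have h := integral_comp_mul_left_Ioi f 0 hL
  rw [mul_zero, smul_eq_mul] at h
  have h2 : ∫ v in Ioi (0:ℝ), f v = L * ∫ a in Ioi (0:ℝ), f (L * a) := by rw [h]; field_simp
  rw [h2, KK, intervalIntegral.integral_of_le zero_le_one]
  congr 1
  rw [setIntegral_eq_of_subset_of_forall_sdiff_eq_zero measurableSet_Ioi (s := Ioc 0 1) (fun a ha => ha.1)]
  · refine setIntegral_congr_fun measurableSet_Ioc fun a ha => ?_
    simp only [hf]
    rw [abs_of_pos (mul_pos hL ha.1), mul_div_cancel_left₀ _ hL.ne', show L * (x - 1/2) * a = -(5/4 - x) * (L * a) + 3/4 * (L * a) by ring, Real.exp_add]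
    ring_nf
  · rintro a ⟨h1, h2⟩
    have : 1 < a := by by_contra h; exact h2 ⟨h1, not_lt.mp h⟩
    simp only [hf]
    rw [mul_div_cancel_left₀ _ hL.ne', hG.supp a (by rw [abs_of_pos (by linarith)]; linarith [hG.lt])]; simp

noncomputable def MM (G : ℝ → ℝ) (T t : ℝ) : ℝ :=
  ∑ n ∈ Finset.range (⌊T⌋₊ + 1), (ArithmeticFunction.vonMangoldt n : ℝ) * (n:ℝ) ^ (-(1/2):ℝ) * G (Real.log n / Real.log T) * Real.cos (t * Real.log n)

lemma explicit_G {G : ℝ → ℝ} {θ : ℝ} (hG : GoodG G θ) : ∃ C : ℝ, 0 < C ∧ ∀ T : ℝ, 3 ≤ T → ∀ t ∈ Icc T (2*T), ∃ D : ℝ,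
    HasSum (fun ρ : ℂ => (ordE ρ : ℝ) * (Real.log T * KK G (Real.log T * (ρ.re - 1/2)) (Real.log T * (t - ρ.im)))) D ∧
    |D - (G 0 * Real.log T / 2 - MM G T t)| ≤ C := by
  obtain ⟨C1, hC1, hE⟩ := explicit_gen
  obtain ⟨C2, hC2, hK⟩ := KK_bound hG
  refine ⟨C1 * (10 * C2) * 2 * 1600 + 2 * |G 0| + 1, by positivity, fun T hT t ht => ?_⟩
  set L := Real.log T with hL
  have hT0 : 0 < T := by linarith
  have hL1 : 1 ≤ L := by
    rw [hL, Real.le_log_iff_exp_le hT0]; have := Real.exp_one_lt_d9; linarith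
  have hL0 : 0 < L := by linarith
  have hpi := Real.pi_gt_three
  have hpi4 := Real.pi_le_four
  set φ := fun y => (L / Real.pi) * KK G (3/4 * L) (L * y) with hφ
  have hw : ∀ v, ∫ y, φ y * Real.cos (v * y) = G (v / L) * Real.exp (3/4 * |v|) := by
    intro v
    have h1 := Measure.integral_comp_mul_left (fun Y => KK G (3/4 * L) Y * Real.cos (v / L * Y)) L
    rw [KK_inversion hG, abs_of_pos (by positivity), smul_eq_mul] at h1
    simp only [hφ, mul_assoc (L / Real.pi)]
    rw [integral_const_mul]
    have e : ∀ y, v * y = v / L * (L * y) := fun y => by field_simp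
    simp_rw [e]
    rw [h1, abs_div, abs_of_pos hL0]
    have : 3/4 * L * (|v| / L) = 3/4 * |v| := by field_simp
    rw [this]; field_simp
  have hTL : Real.exp |3/4 * L| = T ^ (3/4:ℝ) := by
    rw [abs_of_pos (by positivity), Real.rpow_def_of_pos hT0, mul_comm]
  have hc : Continuous φ := by
    have := KK_continuous hG (3/4 * L); fun_prop
  have he : ∀ y, φ (-y) = φ y := fun y => by simp only [hφ, mul_neg, KK_neg]
  have hb : ∀ y, |φ y| ≤ (10 * C2 * L * T ^ (3/4:ℝ)) * (1 / (1 + |y|)^2) := by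
    intro y
    obtain ⟨k1, k2⟩ := hK (3/4 * L) (L * y)
    rw [hTL] at k1 k2
    set k := |KK G (3/4 * L) (L * y)|
    have hk0 : 0 ≤ k := abs_nonneg _
    set R := T ^ (3/4:ℝ)
    have hR : 0 < R := by positivity
    rw [← mul_div_assoc, mul_one, le_div_iff₀ (by positivity), hφ]
    simp only
    rw [abs_mul, abs_of_pos (by positivity)]
    have k3 : k * y^2 ≤ 4 * C2 * R := by
      have : k * y^2 * L^2 ≤ 4 * C2 * R * L^2 := by
        calc k * y^2 * L^2 = k * (L*y)^2 := by ring
          _ ≤ C2 * (1 + |3/4*L|)^2 * R := k2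
          _ ≤ C2 * (2 * L)^2 * R := by
            rw [abs_of_pos (by positivity)]; gcongr; linarith
          _ = _ := by ring
      exact le_of_mul_le_mul_right this (by positivity)
    have k4 : (1 + |y|)^2 ≤ 2 + 2 * y^2 := by nlinarith [sq_nonneg (|y| - 1), sq_abs y]
    have k5 : L / Real.pi ≤ L := div_le_self hL0.le (by linarith)
    calc L / Real.pi * k * (1 + |y|)^2 ≤ L * k * (2 + 2 * y^2) := by gcongr
      _ = L * (2 * k + 2 * (k * y^2)) := by ring
      _ ≤ L * (2 * (C2 * R) + 2 * (4 * C2 * R)) := by gcongr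
      _ = _ := by ring
  have ht3 : 3 ≤ t := hT.trans ht.1
  obtain ⟨D, hD1, hD2⟩ := hE φ _ hc he hb t ht3
  refine ⟨D, hsc hD1 (fun ρ => ?_) rfl, ?_⟩
  · simp_rw [hw]
    rw [KK_Ioi hG hL0]
  · simp_rw [hw] at hD2
    have e0 : ∫ y, φ y = G 0 := by have := hw 0; simpa using this
    have e1 : ∑' n : ℕ, (ArithmeticFunction.vonMangoldt n : ℝ) * (n:ℝ) ^ (-(5/4):ℝ) * ((G (Real.log n / L) * Real.exp (3/4 * |Real.log n|)) * Real.cos (t * Real.log n)) = MM G T t := by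
      rw [tsum_eq_sum (s := Finset.range (⌊T⌋₊ + 1)), MM]
      · refine Finset.sum_congr rfl fun n _ => ?_
        rcases Nat.eq_zero_or_pos n with rfl | hn
        · simp
        have hn' : (0:ℝ) < n := by exact_mod_cast hn
        have : Real.exp (3/4 * |Real.log n|) = (n:ℝ) ^ (3/4:ℝ) := by
          rw [abs_of_nonneg (Real.log_natCast_nonneg n), Real.rpow_def_of_pos hn', mul_comm]
        rw [this, show (-(1/2):ℝ) = -(5/4) + 3/4 by norm_num, Real.rpow_add hn']
        ring
      · intro n hn
        simp only [Finset.mem_range, not_lt] at hn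
        have h1 : T < n := (Nat.floor_lt hT0.le).mp hn
        rw [hG.supp]
        · simp
        · have := Real.log_le_log hT0 h1.le
          refine hG.lt.le.trans (le_trans ?_ (le_abs_self _))
          rw [one_le_div hL0]; exact this
    rw [e0, e1] at hD2
    have e2 : C1 * (10 * C2 * L * T ^ (3/4:ℝ)) * Real.log t * t ^ (-(4/5):ℝ) ≤ C1 * (10 * C2) * 2 * 1600 := by
      have l1 : Real.log t ≤ 2 * L := by
        have : Real.log t ≤ Real.log (T^2) := Real.log_le_log (by linarith) (by nlinarith [ht.2])
        rw [Real.log_pow] at this; exact_mod_cast this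
      have l2 : t ^ (-(4/5):ℝ) ≤ T ^ (-(4/5):ℝ) := Real.rpow_le_rpow_of_nonpos hT0 ht.1 (by norm_num)
      have l3 : L ≤ T ^ (1/40:ℝ) / (1/40) := Real.log_le_rpow_div hT0.le (by norm_num)
      have l4 : L * L * (T ^ (3/4:ℝ) * T ^ (-(4/5):ℝ)) ≤ 1600 := by
        calc L * L * (T ^ (3/4:ℝ) * T ^ (-(4/5):ℝ)) ≤ (T ^ (1/40:ℝ) / (1/40)) * (T ^ (1/40:ℝ) / (1/40)) * (T ^ (3/4:ℝ) * T ^ (-(4/5):ℝ)) := by gcongr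
          _ = 1600 * (T ^ (1/40:ℝ) * T ^ (1/40:ℝ) * T ^ (3/4:ℝ) * T ^ (-(4/5):ℝ)) := by ring
          _ = 1600 := by
            rw [← Real.rpow_add hT0, ← Real.rpow_add hT0, ← Real.rpow_add hT0]; norm_num
      have l5 : 0 ≤ Real.log t := Real.log_nonneg (by linarith)
      calc C1 * (10 * C2 * L * T ^ (3/4:ℝ)) * Real.log t * t ^ (-(4/5):ℝ)
          ≤ C1 * (10 * C2 * L * T ^ (3/4:ℝ)) * (2 * L) * T ^ (-(4/5):ℝ) := by gcongr
        _ = C1 * (10 * C2) * 2 * (L * L * (T ^ (3/4:ℝ) * T ^ (-(4/5):ℝ))) := by ring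
        _ ≤ _ := by gcongr
    have e3 : |Real.log (t / (2 * Real.pi)) / 2 * G 0 - G 0 * L / 2| ≤ 2 * |G 0| := by
      have : Real.log (t / (2 * Real.pi)) / 2 * G 0 - G 0 * L / 2 = (Real.log (t / (2 * Real.pi)) - L) / 2 * G 0 := by ring
      rw [this, abs_mul]
      refine mul_le_mul_of_nonneg_right ?_ (abs_nonneg _)
      rw [hL, ← Real.log_div (by positivity) hT0.ne']
      set z := t / (2 * Real.pi) / T with hz
      have z1 : z ≤ 1 := by
        rw [hz, div_div, div_le_one (by positivity)]; nlinarith [ht.2]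
      have z2 : 1/8 ≤ z := by
        rw [hz, div_div, le_div_iff₀ (by positivity)]; nlinarith [ht.1]
      have z3 : Real.log z ≤ 0 := Real.log_nonpos (by linarith) z1
      have z4 : Real.log (1/8) ≤ Real.log z := Real.log_le_log (by norm_num) z2
      have z5 : -4 ≤ Real.log (1/8) := by
        rw [Real.le_log_iff_exp_le (by norm_num), show (-4:ℝ) = -(1 * (4:ℕ)) by norm_num, Real.exp_neg, Real.exp_mul, Real.rpow_natCast, one_div]
        refine inv_anti₀ (by norm_num) ?_
        have := Real.exp_one_gt_d9
        calc (8:ℝ) ≤ 2^4 := by norm_num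
          _ ≤ _ := by gcongr; linarith
      rw [abs_le]; constructor <;> linarith
    rw [abs_le] at *
    constructor <;> linarith [hD2.1, hD2.2, e3.1, e3.2]

lemma mertens_nat : ∃ C > 0, ∀ N : ℕ, 1 ≤ N →
    |∑ n ∈ Finset.Ioc 0 N, ArithmeticFunction.vonMangoldt n / n - Real.log N| ≤ C := by
  refine ⟨Real.log 4 + 5, by positivity, fun N hN => ?_⟩
  have hN' : (0:ℝ) < N := by exact_mod_cast hN
  have h1 : ∑ n ∈ Finset.Ioc 0 N, ArithmeticFunction.vonMangoldt n * ((N / n : ℕ):ℝ)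
      = Real.log (N.factorial) := by
    rw [← ArithmeticFunction.sum_Ioc_mul_zeta_eq_sum, ArithmeticFunction.vonMangoldt_mul_zeta]
    clear hN hN'
    induction N with
    | zero => simp
    | succ k ih =>
      rw [Finset.sum_Ioc_succ_top (by omega), ih, Nat.factorial_succ]
      push_cast
      rw [Real.log_mul (by positivity) (by positivity), ArithmeticFunction.log_apply]
      push_cast; ring
  have h2 : Real.log (N.factorial) ≤ N * Real.log N := by
    rw [← Real.log_pow]
    exact Real.log_le_log (by positivity) (by exact_mod_cast Nat.factorial_le_pow N)
  have h3 : N * Real.log N - N ≤ Real.log (N.factorial) := by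
    have := Stirling.le_log_factorial_stirling (n := N) (by omega)
    have h4 : 0 ≤ Real.log N := Real.log_natCast_nonneg N
    have h5 : 0 ≤ Real.log (2 * Real.pi) := Real.log_nonneg (by linarith [Real.pi_gt_three])
    linarith
  have h4 := Chebyshev.psi_le_const_mul_self (x := N) hN'.le
  rw [Chebyshev.psi, Nat.floor_natCast] at h4
  have h5 : N * ∑ n ∈ Finset.Ioc 0 N, ArithmeticFunction.vonMangoldt n / n
      ≤ Real.log (N.factorial) + ∑ n ∈ Finset.Ioc 0 N, ArithmeticFunction.vonMangoldt n := by
    rw [← h1, Finset.mul_sum, ← Finset.sum_add_distrib]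
    refine Finset.sum_le_sum fun n hn => ?_
    have hn0 : (0:ℝ) < n := by exact_mod_cast (Finset.mem_Ioc.mp hn).1
    have : (N:ℝ) / n ≤ ((N / n : ℕ):ℝ) + 1 := by
      rw [← Nat.floor_div_eq_div (K := ℝ)]; exact (Nat.lt_floor_add_one _).le
    have h6 := mul_le_mul_of_nonneg_left this (ArithmeticFunction.vonMangoldt_nonneg (n := n))
    calc _ = ArithmeticFunction.vonMangoldt n * (N / n) := by ring
      _ ≤ _ := by linarith
  have h6 : Real.log (N.factorial) ≤ N * ∑ n ∈ Finset.Ioc 0 N, ArithmeticFunction.vonMangoldt n / n := by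
    rw [← h1, Finset.mul_sum]
    refine Finset.sum_le_sum fun n hn => ?_
    have : ((N / n : ℕ):ℝ) ≤ (N:ℝ) / n := Nat.cast_div_le
    have h6 := mul_le_mul_of_nonneg_left this (ArithmeticFunction.vonMangoldt_nonneg (n := n))
    calc _ ≤ ArithmeticFunction.vonMangoldt n * (N / n) := h6
      _ = _ := by ring
  have hl4 : 0 < Real.log 4 := Real.log_pos (by norm_num)
  rw [abs_le]
  constructor
  · refine le_of_mul_le_mul_left ?_ hN'
    nlinarith
  · refine le_of_mul_le_mul_left ?_ hN'
    nlinarith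

lemma mertens : ∃ C > 0, ∀ x : ℝ, 1 ≤ x →
    |∑ n ∈ Finset.range (⌊x⌋₊ + 1), ArithmeticFunction.vonMangoldt n / n - Real.log x| ≤ C := by
  obtain ⟨C, hC, h⟩ := mertens_nat
  refine ⟨C + Real.log 2, by positivity, fun x hx => ?_⟩
  have h1 := h ⌊x⌋₊ (Nat.one_le_floor_iff x |>.mpr hx)
  have e : ∑ n ∈ Finset.range (⌊x⌋₊ + 1), ArithmeticFunction.vonMangoldt n / (n:ℝ)
     = ∑ n ∈ Finset.Ioc 0 ⌊x⌋₊, ArithmeticFunction.vonMangoldt n / (n:ℝ) := by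
    rw [Finset.range_eq_Ico, Finset.sum_eq_sum_Ico_succ_bot (by omega)]
    simp only [Nat.cast_zero, div_zero, zero_add]
    rfl
  rw [e]
  have hf : (1:ℝ) ≤ ⌊x⌋₊ := by exact_mod_cast (Nat.one_le_floor_iff x |>.mpr hx)
  have h2 : Real.log ⌊x⌋₊ ≤ Real.log x := Real.log_le_log (by linarith) (Nat.floor_le (by linarith))
  have h3 : Real.log x ≤ Real.log 2 + Real.log ⌊x⌋₊ := by
    rw [← Real.log_mul (by norm_num) (by linarith)]
    exact Real.log_le_log (by linarith) (by linarith [Nat.lt_floor_add_one x])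
  rw [abs_le] at *
  constructor <;> linarith [h1.1, h1.2]

lemma mertens_smooth {f f' : ℝ → ℝ} (hd : ∀ a, HasDerivAt f (f' a) a) (hc : Continuous f')
    (h1 : f 1 = 0) : ∃ C > 0, ∀ T ≥ (3:ℝ),
    |∑ n ∈ Finset.range (⌊T⌋₊ + 1), ArithmeticFunction.vonMangoldt n / n * f (Real.log n / Real.log T)
      - Real.log T * ∫ a in (0:ℝ)..1, f a| ≤ C := by
  obtain ⟨C, hC, h⟩ := mertens
  have hnn : 0 ≤ ∫ a in (0:ℝ)..1, |f' a| :=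
    intervalIntegral.integral_nonneg zero_le_one fun a _ => abs_nonneg _
  refine ⟨C * (∫ a in (0:ℝ)..1, |f' a|) + 1, by positivity, fun T hT => ?_⟩
  have hL : 0 < Real.log T := Real.log_pos (by linarith)
  set L := Real.log T with hLd
  have key : ∀ n ∈ Finset.range (⌊T⌋₊ + 1), ArithmeticFunction.vonMangoldt n / n * f (Real.log n / L)
      = ∫ a in Icc (0:ℝ) 1, -(ArithmeticFunction.vonMangoldt n / n * (Ici (Real.log n / L)).indicator f' a) := by
    intro n hn
    have c0 : 0 ≤ Real.log n / L := div_nonneg (Real.log_natCast_nonneg n) hL.le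
    have c1 : Real.log n / L ≤ 1 := by
      rw [div_le_one hL]
      rcases Nat.eq_zero_or_pos n with rfl | hp
      · simpa using hL.le
      · refine Real.log_le_log (by exact_mod_cast hp) ?_
        exact (Nat.le_floor_iff (by linarith)).mp (by simpa [Nat.lt_succ_iff] using hn)
    rw [integral_neg, integral_const_mul, setIntegral_indicator measurableSet_Ici,
      show Icc (0:ℝ) 1 ∩ Ici (Real.log n / L) = Icc (Real.log n / L) 1 by
        ext a; simp only [mem_inter_iff, mem_Icc, mem_Ici]
        exact ⟨fun h => ⟨h.2, h.1.2⟩, fun h => ⟨⟨c0.trans h.1, h.2⟩, h.1⟩⟩,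
      integral_Icc_eq_integral_Ioc, ← intervalIntegral.integral_of_le c1,
      intervalIntegral.integral_eq_sub_of_hasDerivAt (fun a _ => hd a) (hc.intervalIntegrable _ _), h1]
    ring
  have hint : ∀ n ∈ Finset.range (⌊T⌋₊ + 1), IntegrableOn (fun a =>
      -(ArithmeticFunction.vonMangoldt n / n * (Ici (Real.log n / L)).indicator f' a)) (Icc (0:ℝ) 1) :=
    fun n _ => (((hc.continuousOn.integrableOn_Icc).indicator measurableSet_Ici).const_mul _).neg
  have hM : ∀ a ∈ Icc (0:ℝ) 1, ∑ n ∈ Finset.range (⌊T⌋₊ + 1),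
      -(ArithmeticFunction.vonMangoldt n / n * (Ici (Real.log n / L)).indicator f' a)
      = -(f' a * ∑ n ∈ Finset.range (⌊Real.exp (a * L)⌋₊ + 1), ArithmeticFunction.vonMangoldt n / n) := by
    intro a ha
    have hexp : Real.exp (a * L) ≤ T := by
      rw [← Real.exp_log (show 0 < T by linarith)]
      exact Real.exp_le_exp.mpr (by nlinarith [ha.2])
    rw [Finset.sum_neg_distrib, Finset.mul_sum]
    congr 1
    rw [← Finset.sum_subset (Finset.range_mono (Nat.add_le_add_right (Nat.floor_le_floor hexp) 1))]
    · refine Finset.sum_congr rfl fun n hn => ?_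
      rcases Nat.eq_zero_or_pos n with rfl | hp
      · simp
      have : (n:ℝ) ≤ Real.exp (a * L) :=
        (Nat.le_floor_iff (Real.exp_pos _).le).mp (by simpa [Nat.lt_succ_iff] using hn)
      rw [indicator_of_mem (by
        rw [mem_Ici, div_le_iff₀ hL]
        exact (Real.log_le_iff_le_exp (by exact_mod_cast hp)).mpr this)]
      ring
    · intro n _ hn
      rcases Nat.eq_zero_or_pos n with rfl | hp
      · simp
      have : Real.exp (a * L) < n :=
        (Nat.floor_lt (Real.exp_pos _).le).mp (by simpa [Nat.lt_succ_iff] using hn)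
      rw [indicator_of_notMem (by
        rw [mem_Ici, div_le_iff₀ hL, not_le]
        exact (Real.lt_log_iff_exp_lt (by exact_mod_cast hp)).mpr this)]
      ring
  rw [Finset.sum_congr rfl key, ← integral_finsetSum _ hint, setIntegral_congr_fun measurableSet_Icc hM]
  have ibp : ∫ a in (0:ℝ)..1, f a = ∫ a in (0:ℝ)..1, -(a * f' a) := by
    have := intervalIntegral.integral_eq_sub_of_hasDerivAt (a := 0) (b := 1)
      (f := fun a => a * f a) (f' := fun a => f a + a * f' a)
      (fun a _ => ((hasDerivAt_id a).mul (hd a)).congr_deriv (by simp))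
      ((((continuous_iff_continuousAt.mpr fun a => (hd a).continuousAt)).add
        (continuous_id.mul hc)).intervalIntegrable _ _)
    rw [intervalIntegral.integral_add
      ((continuous_iff_continuousAt.mpr fun a => (hd a).continuousAt).intervalIntegrable _ _)
      (Continuous.intervalIntegrable (u := fun y => y * f' y) (by fun_prop) _ _)] at this
    rw [intervalIntegral.integral_neg]
    simp only [h1, mul_zero, zero_mul, sub_zero, id] at this
    linarith
  have hi1 : IntegrableOn (fun a => -(f' a * ∑ n ∈ Finset.range (⌊Real.exp (a * L)⌋₊ + 1),
      ArithmeticFunction.vonMangoldt n / (n:ℝ))) (Icc (0:ℝ) 1) :=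
    (integrable_finsetSum _ hint).congr (by
      filter_upwards [ae_restrict_mem measurableSet_Icc] with a ha using hM a ha)
  rw [ibp, ← intervalIntegral.integral_const_mul, intervalIntegral.integral_of_le zero_le_one,
    ← integral_Icc_eq_integral_Ioc, ← integral_sub hi1
      (Continuous.integrableOn_Icc (by fun_prop)), ← Real.norm_eq_abs]
  refine (norm_integral_le_of_norm_le (g := fun a => C * |f' a|)
    (Continuous.integrableOn_Icc (by fun_prop)) ?_).trans ?_
  · filter_upwards [ae_restrict_mem measurableSet_Icc] with a ha
    have := h (Real.exp (a * L)) (Real.one_le_exp (by nlinarith [ha.1]))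
    rw [Real.log_exp] at this
    rw [Real.norm_eq_abs, show ∀ x y : ℝ, -(x * y) - L * -(a * x) = -(x * (y - a * L)) by
      intros; ring, abs_neg, abs_mul, mul_comm C]
    gcongr
  · rw [integral_const_mul, integral_Icc_eq_integral_Ioc, ← intervalIntegral.integral_of_le zero_le_one]
    linarith

lemma int_cos_le {k : ℝ} (hk : k ≠ 0) (a b : ℝ) : |∫ t in a..b, Real.cos (t * k)| ≤ 2 / |k| := by
  have : ∫ t in a..b, Real.cos (t * k) = (Real.sin (b * k) - Real.sin (a * k)) / k := by
    rw [intervalIntegral.integral_comp_mul_right (fun x => Real.cos x) hk, integral_cos, smul_eq_mul]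
    field_simp
  rw [this, abs_div]
  gcongr
  have h1 := Real.abs_sin_le_one (b * k)
  have h2 := Real.abs_sin_le_one (a * k)
  linarith [abs_sub (Real.sin (b * k)) (Real.sin (a * k))]

lemma log_diff {n m : ℕ} (hm : 1 ≤ m) (h : m < n) : ((n:ℝ) - m) / n ≤ Real.log n - Real.log m := by
  have hm' : (0:ℝ) < m := by exact_mod_cast hm
  have hn' : (0:ℝ) < n := by exact_mod_cast hm.trans h.le
  have := Real.log_le_sub_one_of_pos (div_pos hm' hn')
  rw [Real.log_div hm'.ne' hn'.ne'] at this
  rw [sub_div, div_self hn'.ne']; linarith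

lemma int_coscos {N n m : ℕ} (hn : 1 ≤ n) (hm : 1 ≤ m) (hnN : n ≤ N) (hmN : m ≤ N) (h : n ≠ m) (a b : ℝ) :
    |∫ t in a..b, Real.cos (t * Real.log n) * Real.cos (t * Real.log m)| ≤ 2 * N / |(n:ℝ) - m| := by
  wlog hlt : m < n generalizing n m
  · have := this hm hn hmN hnN h.symm (by omega)
    rw [abs_sub_comm] at this
    simpa only [mul_comm (Real.cos (_ * Real.log m))] using this
  have h1 := log_diff hm hlt
  have hn' : (0:ℝ) < n := by exact_mod_cast hn
  have hN' : (n:ℝ) ≤ N := by exact_mod_cast hnN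
  have hd : (0:ℝ) < (n:ℝ) - m := sub_pos.mpr (by exact_mod_cast hlt)
  have hm0 : 0 ≤ Real.log m := Real.log_natCast_nonneg m
  have hp : 0 < ((n:ℝ) - m) / n := by positivity
  have e : ∀ t, Real.cos (t * Real.log n) * Real.cos (t * Real.log m)
     = (1/2) * (Real.cos (t * (Real.log n - Real.log m)) + Real.cos (t * (Real.log n + Real.log m))) := by
    intro t; rw [mul_sub t, mul_add t, Real.cos_sub, Real.cos_add]; ring
  simp_rw [e]
  rw [intervalIntegral.integral_const_mul, intervalIntegral.integral_add
    (Continuous.intervalIntegrable (by fun_prop) _ _) (Continuous.intervalIntegrable (by fun_prop) _ _)]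
  have b1 := int_cos_le (k := Real.log n - Real.log m) (by linarith) a b
  have b2 := int_cos_le (k := Real.log n + Real.log m) (by linarith) a b
  have c : ∀ k, ((n:ℝ) - m) / n ≤ k → 2 / |k| ≤ 2 * N / |(n:ℝ) - m| := by
    intro k hk
    rw [abs_of_pos (hp.trans_le hk), abs_of_pos hd, div_le_div_iff₀ (hp.trans_le hk) hd]
    rw [div_le_iff₀ hn'] at hk
    nlinarith [mul_le_mul_of_nonneg_left hN' (hp.trans_le (by rwa [div_le_iff₀ hn'] : _ ≤ k)).le]
  have b1 := b1.trans (c _ h1)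
  have b2 := b2.trans (c _ (by linarith))
  rw [abs_mul, abs_of_pos (by norm_num : (0:ℝ) < 1/2)]
  linarith [abs_add_le (∫ t in a..b, Real.cos (t * (Real.log n - Real.log m)))
    (∫ t in a..b, Real.cos (t * (Real.log n + Real.log m)))]

lemma harm (N : ℕ) : ∑ k ∈ Finset.Icc 1 N, 1 / (k:ℝ) ≤ 1 + Real.log N := by
  have := harmonic_le_one_add_log N
  rw [harmonic_eq_sum_Icc] at this
  push_cast at this
  simpa only [one_div] using this

lemma harm_shift {N n : ℕ} (hn : n ≤ N) :
    ∑ m ∈ (Finset.Icc 1 N).erase n, 1 / |(n:ℝ) - m| ≤ 2 * (1 + Real.log N) := by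
  classical
  have h0 := harm N
  rw [← Finset.sum_filter_add_sum_filter_not _ (fun m => m < n)]
  have a1 : ∑ m ∈ ((Finset.Icc 1 N).erase n).filter (fun m => m < n), 1 / |(n:ℝ) - m|
      ≤ ∑ k ∈ Finset.Icc 1 N, 1 / (k:ℝ) := by
    rw [show ∑ m ∈ ((Finset.Icc 1 N).erase n).filter (fun m => m < n), 1 / |(n:ℝ) - m|
      = ∑ m ∈ ((Finset.Icc 1 N).erase n).filter (fun m => m < n), 1 / ((n - m : ℕ):ℝ) from
      Finset.sum_congr rfl fun m hm => by
        have := (Finset.mem_filter.mp hm).2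
        rw [Nat.cast_sub this.le, abs_of_nonneg (sub_nonneg.mpr (by exact_mod_cast this.le))]]
    rw [← Finset.sum_image (f := fun k : ℕ => 1 / (k:ℝ)) (g := fun m => n - m)]
    · refine Finset.sum_le_sum_of_subset_of_nonneg ?_ fun _ _ _ => by positivity
      intro k hk
      simp only [Finset.mem_image, Finset.mem_filter, Finset.mem_erase, Finset.mem_Icc] at hk ⊢
      omega
    · intro x hx y hy hxy
      simp only [Finset.mem_filter, Finset.mem_erase, Finset.mem_Icc, Finset.mem_coe] at hx hy hxy
      omega
  have a2 : ∑ m ∈ ((Finset.Icc 1 N).erase n).filter (fun m => ¬ m < n), 1 / |(n:ℝ) - m|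
      ≤ ∑ k ∈ Finset.Icc 1 N, 1 / (k:ℝ) := by
    rw [show ∑ m ∈ ((Finset.Icc 1 N).erase n).filter (fun m => ¬ m < n), 1 / |(n:ℝ) - m|
      = ∑ m ∈ ((Finset.Icc 1 N).erase n).filter (fun m => ¬ m < n), 1 / ((m - n : ℕ):ℝ) from
      Finset.sum_congr rfl fun m hm => by
        have := not_lt.mp (Finset.mem_filter.mp hm).2
        rw [Nat.cast_sub this, abs_sub_comm, abs_of_nonneg (sub_nonneg.mpr (by exact_mod_cast this))]]
    rw [← Finset.sum_image (f := fun k : ℕ => 1 / (k:ℝ)) (g := fun m => m - n)]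
    · refine Finset.sum_le_sum_of_subset_of_nonneg ?_ fun _ _ _ => by positivity
      intro k hk
      simp only [Finset.mem_image, Finset.mem_filter, Finset.mem_erase, Finset.mem_Icc] at hk ⊢
      omega
    · intro x hx y hy hxy
      simp only [Finset.mem_filter, Finset.mem_erase, Finset.mem_Icc, Finset.mem_coe] at hx hy hxy
      omega
  linarith

lemma int_cossq {n : ℕ} (hn : 2 ≤ n) {T : ℝ} : ∫ t in T..2*T, Real.cos (t * Real.log n) * Real.cos (t * Real.log n)
     ≤ T / 2 + 1 := by
  have hl : 0.69 < Real.log n := by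
    have : Real.log 2 ≤ Real.log n := Real.log_le_log (by norm_num) (by exact_mod_cast hn)
    linarith [Real.log_two_gt_d9]
  have e : ∀ t, Real.cos (t * Real.log n) * Real.cos (t * Real.log n)
     = 1/2 + (1/2) * Real.cos (t * (2 * Real.log n)) := by
    intro t; rw [show t * (2 * Real.log n) = 2 * (t * Real.log n) by ring, Real.cos_two_mul]; ring
  simp_rw [e]
  rw [intervalIntegral.integral_add
    (Continuous.intervalIntegrable (by fun_prop) _ _) (Continuous.intervalIntegrable (by fun_prop) _ _),
    intervalIntegral.integral_const_mul, intervalIntegral.integral_const, smul_eq_mul]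
  have := int_cos_le (k := 2 * Real.log n) (by linarith) T (2*T)
  rw [abs_of_pos (show (0:ℝ) < 2 * Real.log n by linarith)] at this
  have h2 : 2 / (2 * Real.log n) ≤ 2 := by rw [div_le_iff₀ (by linarith)]; linarith
  linarith [le_abs_self (∫ t in T..2*T, Real.cos (t * (2 * Real.log n)))]

lemma mean_value (A : ℕ → ℝ) {N : ℕ} (hN : 1 ≤ N) {T : ℝ} (hT : 0 < T) :
    ∫ t in T..2*T, (∑ n ∈ Finset.Icc 1 N, A n * Real.cos (t * Real.log n))^2
     ≤ T * A 1 ^ 2 + T / 2 * ∑ n ∈ Finset.Icc 2 N, A n ^ 2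
      + (1 + 4 * N * (1 + Real.log N)) * ∑ n ∈ Finset.Icc 1 N, A n ^ 2 := by
  classical
  have e : ∀ t, (∑ n ∈ Finset.Icc 1 N, A n * Real.cos (t * Real.log n))^2
     = ∑ n ∈ Finset.Icc 1 N, ∑ m ∈ Finset.Icc 1 N,
        A n * A m * (Real.cos (t * Real.log n) * Real.cos (t * Real.log m)) := by
    intro t; rw [sq, Finset.sum_mul_sum]
    exact Finset.sum_congr rfl fun n _ => Finset.sum_congr rfl fun m _ => by ring
  simp_rw [e]
  rw [intervalIntegral.integral_finsetSum fun n _ => Continuous.intervalIntegrable (by fun_prop) _ _]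
  rw [Finset.sum_congr rfl fun n _ => intervalIntegral.integral_finsetSum
    fun m _ => Continuous.intervalIntegrable (by fun_prop) _ _]
  simp_rw [intervalIntegral.integral_const_mul]
  set I : ℕ → ℕ → ℝ := fun n m => ∫ t in T..2*T, Real.cos (t * Real.log n) * Real.cos (t * Real.log m)
  have step : ∀ n ∈ Finset.Icc 1 N, ∑ m ∈ Finset.Icc 1 N, A n * A m * I n m
      ≤ A n ^ 2 * I n n + ∑ m ∈ (Finset.Icc 1 N).erase n, (A n ^2 + A m ^2) * (N / |(n:ℝ) - m|) := by
    intro n hn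
    rw [← Finset.add_sum_erase _ _ hn, ← sq]
    refine add_le_add_right (Finset.sum_le_sum fun m hm => ?_) _
    have hm' := Finset.mem_erase.mp hm
    rw [Finset.mem_Icc] at hn hm'
    have := int_coscos hn.1 hm'.2.1 hn.2 hm'.2.2 hm'.1.symm T (2*T)
    calc A n * A m * I n m ≤ |A n * A m * I n m| := le_abs_self _
      _ = |A n * A m| * |I n m| := abs_mul _ _
      _ ≤ (1/2 * (A n ^ 2 + A m ^ 2)) * (2 * N / |(n:ℝ) - m|) := by
        gcongr
        rw [abs_le]; constructor <;> nlinarith [sq_nonneg (A n + A m), sq_nonneg (A n - A m)]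
      _ = _ := by ring
  refine (Finset.sum_le_sum step).trans ?_
  rw [Finset.sum_add_distrib]
  have sw : ∑ n ∈ Finset.Icc 1 N, ∑ m ∈ (Finset.Icc 1 N).erase n, (A n ^2 + A m ^2) * (N / |(n:ℝ) - m|)
     = 2 * ∑ n ∈ Finset.Icc 1 N, ∑ m ∈ (Finset.Icc 1 N).erase n, A n ^2 * (N / |(n:ℝ) - m|) := by
    simp_rw [add_mul, Finset.sum_add_distrib]
    rw [two_mul]
    congr 1
    rw [Finset.sum_comm' (t' := Finset.Icc 1 N) (s' := fun m => (Finset.Icc 1 N).erase m)]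
    · exact Finset.sum_congr rfl fun n _ => Finset.sum_congr rfl fun m _ => by rw [abs_sub_comm]
    · intro x y; simp only [Finset.mem_erase]; tauto
  have sb : ∑ n ∈ Finset.Icc 1 N, ∑ m ∈ (Finset.Icc 1 N).erase n, A n ^2 * (N / |(n:ℝ) - m|)
     ≤ ∑ n ∈ Finset.Icc 1 N, A n ^ 2 * (N * (2 * (1 + Real.log N))) := by
    refine Finset.sum_le_sum fun n hn => ?_
    rw [← Finset.mul_sum]
    simp_rw [div_eq_mul_one_div (N:ℝ) |_|]
    rw [← Finset.mul_sum]
    gcongr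
    exact harm_shift (Finset.mem_Icc.mp hn).2
  rw [sw]
  rw [← Finset.sum_mul] at sb
  have dg : ∑ n ∈ Finset.Icc 1 N, A n ^ 2 * I n n ≤ T * A 1 ^ 2 + T / 2 * ∑ n ∈ Finset.Icc 2 N, A n ^ 2
      + ∑ n ∈ Finset.Icc 1 N, A n ^ 2 := by
    have hs : Finset.Icc 1 N = insert 1 (Finset.Icc 2 N) := by
      ext k; simp only [Finset.mem_insert, Finset.mem_Icc]; omega
    rw [hs, Finset.sum_insert (by simp), Finset.sum_insert (by simp)]
    have i1 : I 1 1 = T := by simp only [I]; norm_num; ring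
    have i2 : ∑ n ∈ Finset.Icc 2 N, A n ^ 2 * I n n ≤ ∑ n ∈ Finset.Icc 2 N, A n ^ 2 * (T/2 + 1) := by
      refine Finset.sum_le_sum fun n hn => ?_
      gcongr
      exact int_cossq (Finset.mem_Icc.mp hn).1
    rw [← Finset.sum_mul] at i2
    rw [i1]
    nlinarith [sq_nonneg (A 1)]
  linarith

lemma mean_one (A : ℕ → ℝ) {N : ℕ} (hN : 1 ≤ N) {T : ℝ} :
    |(∫ t in T..2*T, ∑ n ∈ Finset.Icc 1 N, A n * Real.cos (t * Real.log n)) - T * A 1|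
      ≤ 4 * (N + ∑ n ∈ Finset.Icc 1 N, A n ^ 2) := by
  have hs : Finset.Icc 1 N = insert 1 (Finset.Icc 2 N) := by
    ext k; simp only [Finset.mem_insert, Finset.mem_Icc]; omega
  rw [intervalIntegral.integral_finsetSum fun n _ => Continuous.intervalIntegrable (by fun_prop) _ _]
  simp_rw [intervalIntegral.integral_const_mul]
  rw [hs, Finset.sum_insert (by simp), Finset.sum_insert (by simp),
    show A 1 * ∫ t in T..2*T, Real.cos (t * Real.log (1:ℕ)) = T * A 1 by norm_num; ring, add_sub_cancel_left]
  refine (Finset.abs_sum_le_sum_abs _ _).trans ?_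
  have : ∀ n ∈ Finset.Icc 2 N, |A n * ∫ t in T..2*T, Real.cos (t * Real.log n)| ≤ 4 * (1 + A n ^ 2) := by
    intro n hn
    have hl : 0.69 < Real.log n := by
      have : Real.log 2 ≤ Real.log n := Real.log_le_log (by norm_num) (by exact_mod_cast (Finset.mem_Icc.mp hn).1)
      linarith [Real.log_two_gt_d9]
    have h1 := int_cos_le (k := Real.log n) (by linarith) T (2*T)
    have h2 : 2 / |Real.log n| ≤ 4 := by
      rw [abs_of_pos (by linarith), div_le_iff₀ (by linarith)]; linarith
    rw [abs_mul, mul_comm]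
    refine mul_le_mul (h1.trans h2) ?_ (abs_nonneg _) (by norm_num)
    nlinarith [sq_nonneg (|A n| - 1/2), sq_abs (A n)]
  refine (Finset.sum_le_sum this).trans ?_
  rw [← Finset.mul_sum, Finset.sum_add_distrib, Finset.sum_const, Nat.card_Icc, nsmul_eq_mul, mul_one]
  have : ((N + 1 - 2 : ℕ):ℝ) ≤ N := by exact_mod_cast (by omega)
  have := sq_nonneg (A 1)
  linarith

noncomputable def FF (G : ℝ → ℝ) (T t : ℝ) : ℝ := G 0 * Real.log T - 2 * MM G T t

noncomputable def AA (G : ℝ → ℝ) (T : ℝ) (n : ℕ) : ℝ :=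
  if n = 1 then G 0 * Real.log T else
    -2 * (ArithmeticFunction.vonMangoldt n * (n:ℝ)^(-(1/2):ℝ) * G (Real.log n / Real.log T))

lemma FF_eq {G : ℝ → ℝ} {θ : ℝ} (hG : GoodG G θ) {T : ℝ} (hT : 3 ≤ T) (t : ℝ) :
    FF G T t = ∑ n ∈ Finset.Icc 1 ⌊T^θ⌋₊, AA G T n * Real.cos (t * Real.log n) := by
  have hL : 0 < Real.log T := Real.log_pos (by linarith)
  have hN : 1 ≤ ⌊T^θ⌋₊ := (Nat.one_le_floor_iff _).mpr (Real.one_le_rpow (by linarith) hG.pos.le)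
  have hNT : ⌊T^θ⌋₊ ≤ ⌊T⌋₊ := Nat.floor_le_floor (by
    simpa using Real.rpow_le_rpow_of_exponent_le (show 1 ≤ T by linarith) hG.lt.le)
  have hs : Finset.Icc 1 ⌊T^θ⌋₊ = insert 1 (Finset.Icc 2 ⌊T^θ⌋₊) := by
    ext k; simp only [Finset.mem_insert, Finset.mem_Icc]; omega
  rw [hs, Finset.sum_insert (by simp), FF, MM, sub_eq_add_neg, ← neg_mul, Finset.mul_sum]
  congr 1
  · simp [AA]
  rw [← Finset.sum_subset (s₁ := Finset.Icc 2 ⌊T^θ⌋₊)]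
  · refine Finset.sum_congr rfl fun n hn => ?_
    have := (Finset.mem_Icc.mp hn).1
    rw [AA, if_neg (by omega)]; ring
  · intro n hn
    rw [Finset.mem_Icc] at hn; rw [Finset.mem_range]; omega
  · intro n hn hn'
    rw [Finset.mem_Icc] at hn'
    rcases Nat.lt_or_ge n 2 with h | h
    · interval_cases n <;> simp
    have h2 : T^θ < n := (Nat.floor_lt (by positivity)).mp (by omega)
    have h3 : θ * Real.log T ≤ Real.log n := by
      rw [← Real.log_rpow (by linarith)]; exact Real.log_le_log (by positivity) h2.le
    rw [hG.supp _ (((le_div_iff₀ hL).mpr h3).trans (le_abs_self _))]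
    ring

lemma AA_sum {G : ℝ → ℝ} {θ : ℝ} (hG : GoodG G θ) : ∃ C > 0, ∀ T ≥ (3:ℝ),
    ∑ n ∈ Finset.Icc 2 ⌊T^θ⌋₊, AA G T n ^ 2 ≤ 4 * Real.log T ^ 2 * (∫ a in (0:ℝ)..1, a * G a ^ 2) + C * Real.log T := by
  have hdiff : Differentiable ℝ G := hG.smooth.differentiable (by simp)
  have hdc : Continuous (deriv G) := hG.smooth.continuous_deriv (by simp)
  have hGc : Continuous G := hG.smooth.continuous
  obtain ⟨C, hC, h⟩ := mertens_smooth (f := fun a => a * G a ^ 2)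
    (f' := fun a => G a ^ 2 + a * (2 * G a * deriv G a))
    (fun a => ((hasDerivAt_id a).mul ((hdiff a).hasDerivAt.pow 2)).congr_deriv (by simp))
    (by fun_prop) (by rw [hG.supp 1 (by simpa using hG.lt.le)]; ring)
  refine ⟨4 * C, by positivity, fun T hT => ?_⟩
  have hL : 0 < Real.log T := Real.log_pos (by linarith)
  have h1 := (abs_le.mp (h T hT)).2
  have hNT : ⌊T^θ⌋₊ ≤ ⌊T⌋₊ := Nat.floor_le_floor (by
    simpa using Real.rpow_le_rpow_of_exponent_le (show 1 ≤ T by linarith) hG.lt.le)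
  have h2 : ∑ n ∈ Finset.Icc 2 ⌊T^θ⌋₊, AA G T n ^ 2 ≤ ∑ n ∈ Finset.range (⌊T⌋₊ + 1),
      4 * Real.log T * (ArithmeticFunction.vonMangoldt n / n * (Real.log n / Real.log T * G (Real.log n / Real.log T) ^ 2)) := by
    refine (Finset.sum_le_sum fun n hn => ?_).trans (Finset.sum_le_sum_of_subset_of_nonneg
      (s := Finset.Icc 2 ⌊T^θ⌋₊) ?_ ?_)
    · have hn2 := (Finset.mem_Icc.mp hn).1
      have hn0 : (0:ℝ) < n := by exact_mod_cast (by omega : 0 < n)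
      rw [AA, if_neg (by omega), mul_pow, mul_pow, mul_pow, ← Real.rpow_natCast ((n:ℝ)^_), ← Real.rpow_mul hn0.le]
      norm_num
      rw [Real.rpow_neg_one]
      have h3 : ArithmeticFunction.vonMangoldt n ≤ Real.log n := ArithmeticFunction.vonMangoldt_le_log
      have h4 : 0 ≤ ArithmeticFunction.vonMangoldt n := ArithmeticFunction.vonMangoldt_nonneg
      calc 4 * (ArithmeticFunction.vonMangoldt n ^ 2 * (n:ℝ)⁻¹ * G (Real.log n / Real.log T) ^ 2)
          ≤ 4 * ((ArithmeticFunction.vonMangoldt n * Real.log n) * (n:ℝ)⁻¹ * G (Real.log n / Real.log T) ^ 2) := by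
            gcongr; nlinarith
        _ = _ := by field_simp
    · intro n hn
      rw [Finset.mem_Icc] at hn; rw [Finset.mem_range]; omega
    · intro n _ _
      have h4 : 0 ≤ ArithmeticFunction.vonMangoldt n := ArithmeticFunction.vonMangoldt_nonneg
      have := Real.log_natCast_nonneg n
      positivity
  rw [← Finset.mul_sum] at h2
  refine h2.trans ?_
  nlinarith

lemma ev_rpow_log {θ : ℝ} (h1 : θ < 1) {ε : ℝ} (hε : 0 < ε) (C : ℝ) :
    ∀ᶠ T : ℝ in atTop, (1 + T ^ θ * (1 + Real.log T)) * C ≤ ε * T := by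
  have l1 : (fun T : ℝ => (1:ℝ)) =o[atTop] (fun T : ℝ => T ^ (1:ℝ)) := by
    exact (Asymptotics.isLittleO_const_left.mpr (Or.inr (tendsto_norm_atTop_atTop.comp (tendsto_rpow_atTop (by norm_num)))))
  have l2 : (fun T : ℝ => T ^ θ * (1 + Real.log T)) =o[atTop] (fun T : ℝ => T ^ (1:ℝ)) := by
    have a1 : (fun T : ℝ => (1:ℝ) + Real.log T) =o[atTop] (fun T : ℝ => T ^ (1 - θ)) := by
      refine Asymptotics.IsLittleO.add ?_ (isLittleO_log_rpow_atTop (by linarith))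
      exact (Asymptotics.isLittleO_const_left.mpr (Or.inr (tendsto_norm_atTop_atTop.comp (tendsto_rpow_atTop (by linarith)))))
    have := (Asymptotics.isBigO_refl (fun T : ℝ => T ^ θ) atTop).mul_isLittleO a1
    refine this.congr' (by rfl) ?_
    filter_upwards [eventually_gt_atTop 0] with T hT
    rw [← Real.rpow_add hT]; norm_num
  have l3 := (l1.add l2).mul_isBigO (Asymptotics.isBigO_refl (fun _ : ℝ => C) atTop)
  have l4 : (fun T : ℝ => T ^ (1:ℝ) * C) =O[atTop] (fun T : ℝ => T) := by
    simp only [Real.rpow_one]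
    simpa [mul_comm] using (Asymptotics.isBigO_refl (fun T : ℝ => T) atTop).const_mul_left C
  filter_upwards [(l3.trans_isBigO l4).def hε, eventually_gt_atTop 0] with T h hT
  rw [Real.norm_eq_abs, Real.norm_eq_abs, abs_of_pos hT] at h
  exact (le_abs_self _).trans h

lemma FF_mean {G : ℝ → ℝ} {θ : ℝ} (hG : GoodG G θ) {ε : ℝ} (hε : 0 < ε) : ∀ᶠ T in atTop,
    ∫ t in T..2*T, FF G T t ^ 2 ≤ T * Real.log T ^ 2 * (G 0 ^ 2 + 2 * (∫ a in (0:ℝ)..1, a * G a ^ 2) + ε) ∧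
    |(∫ t in T..2*T, FF G T t) - T * Real.log T * G 0| ≤ ε * (T * Real.log T) := by
  obtain ⟨C, hC, h⟩ := AA_sum hG
  set J := ∫ a in (0:ℝ)..1, a * G a ^ 2 with hJd
  have hJ : 0 ≤ J := intervalIntegral.integral_nonneg zero_le_one fun a ha => mul_nonneg ha.1 (sq_nonneg _)
  set C' := 4 * (G 0 ^ 2 + 4 * J + C) with hC'
  have hC'p : 0 < C' := by positivity
  filter_upwards [eventually_ge_atTop 3, ev_rpow_log hG.lt (half_pos hε) C',
    ev_rpow_log hG.lt (half_pos hε) 4, Real.isLittleO_pow_log_id_atTop (n := 1) |>.def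
      (show 0 < ε / (2 * (C' + 1)) by positivity),
    Real.tendsto_log_atTop.eventually_ge_atTop (C / ε + 1)] with T hT e1 e3 e2 e4
  have hL : 1 ≤ Real.log T := by
    rw [Real.le_log_iff_exp_le (by linarith)]; linarith [Real.exp_one_lt_d9]
  have hN : 1 ≤ ⌊T^θ⌋₊ := (Nat.one_le_floor_iff _).mpr (Real.one_le_rpow (by linarith) hG.pos.le)
  have hNle : (⌊T^θ⌋₊:ℝ) ≤ T^θ := Nat.floor_le (by positivity)
  have hN1 : (1:ℝ) ≤ (⌊T^θ⌋₊:ℝ) := by exact_mod_cast hN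
  have hlogN : Real.log ⌊T^θ⌋₊ ≤ Real.log T := by
    refine Real.log_le_log (by linarith) (hNle.trans ?_)
    simpa using Real.rpow_le_rpow_of_exponent_le (show 1 ≤ T by linarith) hG.lt.le
  have hs : Finset.Icc 1 ⌊T^θ⌋₊ = insert 1 (Finset.Icc 2 ⌊T^θ⌋₊) := by
    ext k; simp only [Finset.mem_insert, Finset.mem_Icc]; omega
  have h2 := h T hT
  have hA1 : AA G T 1 = G 0 * Real.log T := by simp [AA]
  have hall : ∑ n ∈ Finset.Icc 1 ⌊T^θ⌋₊, AA G T n ^ 2 ≤ C' / 4 * Real.log T ^ 2 := by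
    rw [hs, Finset.sum_insert (by simp), hA1, hC']
    have : C * Real.log T ≤ C * Real.log T ^ 2 := by gcongr; exact le_self_pow₀ hL (by norm_num)
    nlinarith
  have hall0 : 0 ≤ ∑ n ∈ Finset.Icc 1 ⌊T^θ⌋₊, AA G T n ^ 2 := Finset.sum_nonneg fun _ _ => sq_nonneg _
  have hlogN0 : 0 ≤ Real.log ⌊T^θ⌋₊ := Real.log_natCast_nonneg _
  simp_rw [FF_eq hG hT]
  constructor
  · refine (mean_value _ hN (by linarith)).trans ?_
    rw [hA1]
    have b1 : (1 + 4 * (⌊T^θ⌋₊:ℝ) * (1 + Real.log ⌊T^θ⌋₊)) * ∑ n ∈ Finset.Icc 1 ⌊T^θ⌋₊, AA G T n ^ 2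
        ≤ (4 * (1 + T^θ * (1 + Real.log T))) * (C' / 4 * Real.log T ^ 2) := by
      refine mul_le_mul ?_ hall hall0 (by positivity)
      have : (⌊T^θ⌋₊:ℝ) * (1 + Real.log ⌊T^θ⌋₊) ≤ T^θ * (1 + Real.log T) := by gcongr
      linarith
    have b2 : (4 * (1 + T^θ * (1 + Real.log T))) * (C' / 4 * Real.log T ^ 2) ≤ ε / 2 * T * Real.log T ^ 2 := by
      have := mul_le_mul_of_nonneg_right e1 (sq_nonneg (Real.log T))
      linarith
    have b3 : C ≤ ε * Real.log T := by
      have := mul_le_mul_of_nonneg_left e4 hε.le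
      rw [mul_add, mul_div_cancel₀ _ hε.ne'] at this; linarith
    have b4 : T / 2 * ∑ n ∈ Finset.Icc 2 ⌊T^θ⌋₊, AA G T n ^ 2 ≤ T / 2 * (4 * Real.log T ^ 2 * J + ε * Real.log T * Real.log T) := by
      gcongr
      refine h2.trans ?_
      gcongr
    nlinarith
  · rw [show T * Real.log T * G 0 = T * AA G T 1 by rw [hA1]; ring]
    refine (mean_one _ hN).trans ?_
    simp only [pow_one, id, Real.norm_eq_abs] at e2
    rw [abs_of_pos (by linarith : 0 < Real.log T), abs_of_pos (by linarith : 0 < T)] at e2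
    have b1 : 4 * (⌊T^θ⌋₊:ℝ) ≤ ε / 2 * T := by
      refine le_trans ?_ e3
      have : T ^ θ ≤ T^θ * (1 + Real.log T) := le_mul_of_one_le_right (by positivity) (by linarith)
      linarith
    have b2 : C' * Real.log T ≤ ε / 2 * T := by
      have := mul_le_mul_of_nonneg_left e2 hC'p.le
      refine this.trans ?_
      rw [← mul_assoc]
      gcongr
      rw [← mul_div_assoc, div_le_div_iff₀ (by positivity) (by norm_num)]
      nlinarith
    have b3 : T ≤ T * Real.log T := le_mul_of_one_le_right (by linarith) hL
    nlinarith

noncomputable def SS (G : ℝ → ℝ) (T t : ℝ) : ℝ := ∑ ρ ∈ band T,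
  ordE ρ * (2 * Real.log T * KK G (Real.log T * (ρ.re - 1/2)) (Real.log T * (t - ρ.im)))

/-- all zeros with height in `(T/2, 4T]` lie close to the line -/
def BoxT (T : ℝ) : Prop := ∀ ρ : ℂ, xiE ρ = 0 → T / 2 < ρ.im → ρ.im ≤ 4 * T → |Real.log T * (ρ.re - 1/2)| ≤ 1

lemma box_ev (hbox : ∀ᶠ T in atTop, ∀ ρ ∈ zeroBand T, |ρ.re - 1/2| < 0.3185 / (2 * Real.log T)) :
    ∀ᶠ T in atTop, BoxT T := by
  have h2 : Tendsto (fun T : ℝ => T / 2) atTop atTop := tendsto_id.atTop_div_const (by norm_num)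
  have h3 : Tendsto (fun T : ℝ => 2 * T) atTop atTop := tendsto_id.const_mul_atTop (by norm_num)
  filter_upwards [hbox, h2.eventually hbox, h3.eventually hbox, eventually_ge_atTop 4] with T b1 b2 b3 hT
  intro ρ hρ l u
  have hz := (xiE_eq_zero_iff ρ).mp hρ
  have hL : 0 < Real.log T := Real.log_pos (by linarith)
  have key : |ρ.re - 1/2| ≤ 1 / Real.log T := by
    rcases le_or_gt ρ.im T with h | h
    · refine (b2 ρ ⟨hz, l, by linarith⟩).le.trans ?_
      have : Real.log T ≤ 2 * Real.log (T/2) := by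
        rw [← Real.log_rpow (by linarith)]
        refine Real.log_le_log (by linarith) ?_
        norm_num; nlinarith
      rw [div_le_div_iff₀ (by linarith) hL]; linarith
    rcases le_or_gt ρ.im (2*T) with h' | h'
    · refine (b1 ρ ⟨hz, h, h'⟩).le.trans ?_
      rw [div_le_div_iff₀ (by linarith) hL]; linarith
    · refine (b3 ρ ⟨hz, h', by linarith⟩).le.trans ?_
      have : Real.log T ≤ Real.log (2*T) := Real.log_le_log (by linarith) (by linarith)
      rw [div_le_div_iff₀ (by linarith) hL]; linarith
  rw [abs_mul, abs_of_pos hL, mul_comm]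
  exact (le_div_iff₀ hL).mp key

/-- near zeros: pointwise bounds -/
lemma KK_near {G : ℝ → ℝ} {θ : ℝ} (hG : GoodG G θ) : ∃ C > 0, ∀ L ≥ (1:ℝ), ∀ X y, |X| ≤ 1 →
    |2 * L * KK G X (L * y)| ≤ C * L * (1 / (1 + y^2)) ∧
    (1 ≤ |y| → |2 * L * KK G X (L * y)| ≤ C / L * (1 / (1 + y^2))) := by
  obtain ⟨C, hC, h⟩ := KK_bound hG
  refine ⟨16 * C * Real.exp 1, by positivity, fun L hL X y hX => ?_⟩
  obtain ⟨h1, h2⟩ := h X (L * y)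
  have ee : Real.exp |X| ≤ Real.exp 1 := Real.exp_le_exp.mpr hX
  have k1 : |KK G X (L*y)| ≤ C * Real.exp 1 := h1.trans (by gcongr)
  have k2 : |KK G X (L*y)| * (L * y)^2 ≤ 4 * (C * Real.exp 1) := by
    refine h2.trans ?_
    calc C * (1 + |X|)^2 * Real.exp |X| ≤ C * (1 + 1)^2 * Real.exp 1 := by gcongr
      _ = _ := by ring
  set c := C * Real.exp 1
  have hc : 0 < c := by positivity
  set k := |KK G X (L*y)|
  have hk : 0 ≤ k := abs_nonneg _
  rw [abs_mul, abs_of_pos (by linarith : 0 < 2 * L), show 16 * C * Real.exp 1 = 16 * c by simp only [c]; ring]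
  have hy : 0 < 1 + y^2 := by positivity
  have k3 : L^2 * (k * y^2) ≤ 4 * c := by nlinarith
  constructor
  · rw [mul_one_div, le_div_iff₀ hy]
    have : k * y^2 ≤ L^2 * (k * y^2) := le_mul_of_one_le_left (by positivity) (one_le_pow₀ hL)
    have : k * (1 + y^2) ≤ 5 * c := by linarith
    nlinarith
  · intro hy1
    have hy2 : 1 ≤ y^2 := by rw [← sq_abs]; exact one_le_pow₀ hy1
    rw [mul_one_div, div_div, le_div_iff₀ (by positivity)]
    have : k * (1 + y^2) ≤ 2 * (k * y^2) := by nlinarith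
    have : L^2 * (k * (1 + y^2)) ≤ L^2 * (2 * (k * y^2)) := by gcongr
    nlinarith

/-- far zeros -/
lemma KK_far {G : ℝ → ℝ} {θ : ℝ} (hG : GoodG G θ) : ∃ C > 0, ∀ T ≥ (3:ℝ), ∀ x y, |x| ≤ 1/2 → T / 2 ≤ |y| →
    |2 * Real.log T * KK G (Real.log T * x) (Real.log T * y)| ≤ C * Real.log T * T^(1/2:ℝ) * (1 / (T^2 + y^2)) := by
  obtain ⟨C, hC, h⟩ := KK_bound hG
  refine ⟨40 * C, by positivity, fun T hT x y hx hy => ?_⟩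
  have hL : 1 ≤ Real.log T := by
    rw [Real.le_log_iff_exp_le (by linarith)]; linarith [Real.exp_one_lt_d9]
  obtain ⟨-, h2⟩ := h (Real.log T * x) (Real.log T * y)
  have hX : |Real.log T * x| ≤ Real.log T * (1/2) := by
    rw [abs_mul, abs_of_pos (by linarith)]; gcongr
  have k2 : |KK G (Real.log T * x) (Real.log T * y)| * (Real.log T * y)^2 ≤ C * (2 * Real.log T)^2 * T^(1/2:ℝ) := by
    refine h2.trans ?_
    rw [Real.rpow_def_of_pos (by linarith)]
    gcongr
    linarith
  set k := |KK G (Real.log T * x) (Real.log T * y)|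
  set L := Real.log T
  have hk : 0 ≤ k := abs_nonneg _
  have k3 : k * y^2 ≤ 4 * C * T^(1/2:ℝ) := by
    have : L^2 * (k * y^2) ≤ L^2 * (4 * C * T^(1/2:ℝ)) := by nlinarith
    exact le_of_mul_le_mul_left this (by positivity)
  have hy2 : T^2 ≤ 4 * y^2 := by rw [← sq_abs y]; nlinarith
  rw [abs_mul, abs_of_pos (by linarith : 0 < 2 * L), mul_one_div, le_div_iff₀ (by positivity)]
  have : k * (T^2 + y^2) ≤ 5 * (k * y^2) := by nlinarith
  have : k * (T^2 + y^2) ≤ 20 * (C * T^(1/2:ℝ)) := by linarith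
  nlinarith [mul_le_mul_of_nonneg_left this (by linarith : 0 ≤ 2 * L)]

lemma bandN : ∃ C > 0, ∀ T ≥ (3:ℝ), ∑ ρ ∈ band T, (ordE ρ : ℝ) ≤ C * (T * Real.log T) := by
  obtain ⟨C, hC, h⟩ := zsum_T
  refine ⟨8 * C, by positivity, fun T hT => ?_⟩
  obtain ⟨hs, hb⟩ := h (1.5 * T) T (by linarith)
  have hL : 1 ≤ Real.log T := by
    rw [Real.le_log_iff_exp_le (by linarith)]; linarith [Real.exp_one_lt_d9]
  have h1 := hs.sum_le_tsum (band T) fun ρ _ => by positivity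
  have h2 : ∑ ρ ∈ band T, (ordE ρ : ℝ) * (1 / (2 * T^2)) ≤ ∑ ρ ∈ band T, (ordE ρ:ℝ) * (1 / (T^2 + (1.5*T - ρ.im)^2)) := by
    refine Finset.sum_le_sum fun ρ hρ => ?_
    have := (mem_band.mp hρ).2
    gcongr
    nlinarith
  rw [← Finset.sum_mul] at h2
  have h3 : Real.log (T + |1.5*T| + 3) ≤ 3 * Real.log T := by
    rw [abs_of_pos (by linarith), ← Real.log_rpow (by linarith)]
    refine Real.log_le_log (by linarith) ?_
    norm_num
    nlinarith [mul_le_mul hT hT (by norm_num) (by linarith)]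
  have h4 := h2.trans (h1.trans hb)
  rw [mul_one_div, div_le_div_iff₀ (by positivity) (by linarith)] at h4
  have h5 : C * Real.log (T + |1.5*T| + 3) * (2 * T^2) ≤ C * (3 * Real.log T) * (2 * T^2) := by gcongr
  have h6 : T * ∑ ρ ∈ band T, (ordE ρ : ℝ) ≤ T * (6 * C * (T * Real.log T)) := by nlinarith
  have h7 := le_of_mul_le_mul_left h6 (by linarith)
  have : 0 ≤ C * (T * Real.log T) := by positivity
  linarith

lemma one_le_log {T : ℝ} (hT : 3 ≤ T) : 1 ≤ Real.log T := by
  rw [Real.le_log_iff_exp_le (by linarith)]; linarith [Real.exp_one_lt_d9]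

lemma log_le3 {T s : ℝ} (hT : 4 ≤ T) (h0 : 0 < s) (h : s ≤ 4 * T) : Real.log s ≤ 3 * Real.log T := by
  rw [← Real.log_rpow (by linarith)]
  refine Real.log_le_log h0 ?_
  norm_num
  nlinarith [mul_le_mul hT hT (by norm_num) (by linarith)]

lemma logsq_le {T : ℝ} (hT : 3 ≤ T) : Real.log T * T^(1/2:ℝ) * (Real.log T / T) ≤ 16 := by
  have h1 := Real.log_le_rpow_div (show 0 ≤ T by linarith) (show (0:ℝ) < 1/4 by norm_num)
  have hL := one_le_log hT
  have h2 : Real.log T * Real.log T ≤ 16 * T^(1/2:ℝ) := by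
    calc _ ≤ (T^(1/4:ℝ) / (1/4)) * (T^(1/4:ℝ) / (1/4)) := by gcongr
      _ = 16 * (T^(1/4:ℝ) * T^(1/4:ℝ)) := by ring
      _ = _ := by rw [← Real.rpow_add (by linarith)]; norm_num
  have h3 : T^(1/2:ℝ) * T^(1/2:ℝ) = T := by rw [← Real.rpow_add (by linarith)]; norm_num
  rw [← mul_div_assoc, div_le_iff₀ (by linarith)]
  have : 0 < T^(1/2:ℝ) := by positivity
  nlinarith

lemma SS_diff {G : ℝ → ℝ} {θ : ℝ} (hG : GoodG G θ) : ∃ C > 0, ∀ T ≥ (4:ℝ), BoxT T → ∀ t ∈ Icc T (2*T), ∀ α ≥ 0,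
    (∀ ρ : ℂ, xiE ρ = 0 → ρ ∉ band T → T / 2 < ρ.im → ρ.im ≤ 4 * T →
      |2 * Real.log T * KK G (Real.log T * (ρ.re - 1/2)) (Real.log T * (t - ρ.im))| ≤ α * (1 / (1 + (t - ρ.im)^2)))
    → |SS G T t - FF G T t| ≤ C * (1 + α * Real.log T) := by
  classical
  obtain ⟨C0, hC0, hE⟩ := explicit_G hG
  obtain ⟨C1, hC1, h1⟩ := zsum_one
  obtain ⟨C2, hC2, h2⟩ := zsum_T
  obtain ⟨C3, hC3, h3⟩ := KK_far hG
  refine ⟨2 * C0 + C3 * C2 * 48 + 3 * C1, by positivity, fun T hT hB t ht α hα hn => ?_⟩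
  have hL := one_le_log (show 3 ≤ T by linarith)
  obtain ⟨D, hD, hDb⟩ := hE T (by linarith) t ht
  obtain ⟨s1, b1⟩ := h1 t
  obtain ⟨s2, b2⟩ := h2 t T (by linarith)
  have hS : HasSum (fun ρ : ℂ => if ρ ∈ band T then ordE ρ * (2 * Real.log T * KK G (Real.log T * (ρ.re - 1/2)) (Real.log T * (t - ρ.im))) else 0)
      (SS G T t) := by
    have := hasSum_sum_of_ne_finset_zero (L := SummationFilter.unconditional ℂ) (s := band T) (f := fun ρ : ℂ => if ρ ∈ band T then (ordE ρ:ℝ) * (2 * Real.log T * KK G (Real.log T * (ρ.re - 1/2)) (Real.log T * (t - ρ.im))) else 0)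
      (fun ρ h => by simp [h])
    rwa [Finset.sum_congr rfl fun ρ h => if_pos h] at this
  have hd := (hD.mul_left 2).sub hS
  set β := C3 * Real.log T * T^(1/2:ℝ) with hβ
  have hβ0 : 0 ≤ β := by positivity
  have hmaj := (s1.hasSum.mul_left α).add (s2.hasSum.mul_left β)
  have hb := tsum_of_norm_bounded hmaj (f := fun ρ : ℂ => 2 * (ordE ρ * (Real.log T * KK G (Real.log T*(ρ.re-1/2)) (Real.log T*(t-ρ.im))))
     - if ρ ∈ band T then ordE ρ * (2 * Real.log T * KK G (Real.log T * (ρ.re - 1/2)) (Real.log T * (t - ρ.im))) else 0) (by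
    intro ρ
    by_cases hρ : ρ ∈ band T
    · rw [if_pos hρ]
      refine le_trans (le_of_eq ?_) (by positivity : (0:ℝ) ≤ _)
      rw [norm_eq_zero]; ring
    rw [if_neg hρ, sub_zero]
    by_cases hz : xiE ρ = 0
    swap
    · rw [ordE_eq_zero hz]; simp
    rw [show 2 * (ordE ρ * (Real.log T * KK G (Real.log T*(ρ.re-1/2)) (Real.log T*(t-ρ.im))))
      = ordE ρ * (2 * Real.log T * KK G (Real.log T * (ρ.re - 1/2)) (Real.log T * (t - ρ.im))) by ring,
      norm_mul, Real.norm_eq_abs, Real.norm_eq_abs, abs_of_nonneg (Nat.cast_nonneg _)]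
    rw [show ∀ a b : ℝ, α * (ordE ρ * a) + β * (ordE ρ * b) = ordE ρ * (α * a + β * b) by intros; ring]
    refine mul_le_mul_of_nonneg_left ?_ (Nat.cast_nonneg _)
    by_cases hr : T / 2 < ρ.im ∧ ρ.im ≤ 4 * T
    · refine (hn ρ hz hρ hr.1 hr.2).trans (le_add_of_nonneg_right (by positivity))
    · have hre := xiE_zero_re hz
      refine (h3 T (by linarith) (ρ.re - 1/2) (t - ρ.im) ?_ ?_).trans (le_add_of_nonneg_left (by positivity))
      · rw [abs_le]; constructor <;> linarith [hre.1, hre.2]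
      · rw [le_abs]
        by_cases h5 : T / 2 < ρ.im
        · right; have := not_le.mp fun h => hr ⟨h5, h⟩; linarith [ht.2]
        · left; linarith [ht.1, not_lt.mp h5])
  rw [hd.tsum_eq, Real.norm_eq_abs] at hb
  have l1 : Real.log (|t| + 3) ≤ 3 * Real.log T := by
    rw [abs_of_nonneg (by linarith [ht.1])]
    exact log_le3 hT (by linarith [ht.1]) (by linarith [ht.2])
  have l2 : Real.log (T + |t| + 3) ≤ 3 * Real.log T := by
    rw [abs_of_nonneg (by linarith [ht.1])]
    exact log_le3 hT (by linarith [ht.1]) (by linarith [ht.2])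
  have m1 : α * ∑' ρ : ℂ, (ordE ρ * (1/(1+(t-ρ.im)^2))) ≤ α * (C1 * (3 * Real.log T)) := by
    gcongr; exact b1.trans (by gcongr)
  have m2 : β * ∑' ρ : ℂ, (ordE ρ * (1/(T^2+(t-ρ.im)^2))) ≤ C3 * C2 * 48 := by
    calc _ ≤ β * (C2 * (3 * Real.log T) / T) := by gcongr; exact b2.trans (by gcongr)
      _ = C3 * C2 * 3 * (Real.log T * T^(1/2:ℝ) * (Real.log T / T)) := by rw [hβ]; ring
      _ ≤ C3 * C2 * 3 * 16 := by gcongr; exact logsq_le (by linarith)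
      _ = _ := by ring
  have e1 : |SS G T t - FF G T t| ≤ |2 * D - SS G T t| + 2 * C0 := by
    rw [FF]
    rw [show SS G T t - (G 0 * Real.log T - 2 * MM G T t) = -(2 * D - SS G T t) + 2 * (D - (G 0 * Real.log T/2 - MM G T t)) by ring]
    refine (abs_add_le _ _).trans ?_
    rw [abs_neg, abs_mul, abs_two]; linarith
  have : 0 ≤ α * Real.log T := by positivity
  have : 0 ≤ C3 * C2 * 48 * (α * Real.log T) := by positivity
  have : 0 ≤ C0 * (α * Real.log T) := by positivity
  nlinarith

lemma SS_compare {G : ℝ → ℝ} {θ : ℝ} (hG : GoodG G θ) : ∃ C > 0, ∀ T ≥ (4:ℝ), BoxT T →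
    (∀ t ∈ Icc T (2*T), |SS G T t - FF G T t| ≤ C * Real.log T ^ 2) ∧
    (∀ t ∈ Icc (T+1) (2*T-1), |SS G T t - FF G T t| ≤ C) ∧
    (∀ t ∈ Icc (T-1) (2*T+1), |SS G T t| ≤ C * Real.log T ^ 2) ∧
    (∀ t, t ≤ T - 1 ∨ 2*T+1 ≤ t → |SS G T t| ≤ C ∧
      |SS G T t| ≤ C / Real.log T * ∑ ρ ∈ band T, ordE ρ * (1 / (1 + (t - ρ.im)^2))) := by
  obtain ⟨C0, hC0, h0⟩ := SS_diff hG
  obtain ⟨C1, hC1, h1⟩ := KK_near hG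
  obtain ⟨C2, hC2, h2⟩ := zsum_one
  refine ⟨C0 * (1 + C1) + 3 * C1 * C2 + C1, by positivity, fun T hT hB => ?_⟩
  have hL := one_le_log (show 3 ≤ T by linarith)
  have hL2 : 1 ≤ Real.log T ^ 2 := one_le_pow₀ hL
  have p1 : 0 < C0 * (1 + C1) := by positivity
  have p2 : 0 < C1 * C2 := by positivity
  have bx : ∀ ρ ∈ band T, |Real.log T * (ρ.re - 1/2)| ≤ 1 := fun ρ hρ => by
    obtain ⟨a, b, c⟩ := mem_band.mp hρ
    exact hB ρ a (by linarith) (by linarith)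
  -- generic bound for the sum
  have gen : ∀ t α, 0 ≤ α → (∀ ρ ∈ band T,
      |2 * Real.log T * KK G (Real.log T * (ρ.re - 1/2)) (Real.log T * (t - ρ.im))| ≤ α * (1 / (1 + (t - ρ.im)^2)))
      → |SS G T t| ≤ α * ∑ ρ ∈ band T, ordE ρ * (1 / (1 + (t - ρ.im)^2)) := by
    intro t α _ h
    rw [SS, Finset.mul_sum]
    refine (Finset.abs_sum_le_sum_abs _ _).trans (Finset.sum_le_sum fun ρ hρ => ?_)
    rw [abs_mul, abs_of_nonneg (Nat.cast_nonneg _)]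
    have := mul_le_mul_of_nonneg_left (h ρ hρ) (Nat.cast_nonneg (α := ℝ) (ordE ρ))
    linarith
  refine ⟨fun t ht => ?_, fun t ht => ?_, fun t ht => ?_, fun t ht => ?_⟩
  · have := h0 T hT hB t ht (C1 * Real.log T) (by positivity) fun ρ hz _ l u =>
      (h1 _ hL _ _ (hB ρ hz l u)).1
    refine this.trans ?_
    have : 1 + C1 * Real.log T * Real.log T ≤ (1 + C1) * Real.log T ^ 2 := by nlinarith
    have := mul_le_mul_of_nonneg_left this hC0.le
    nlinarith
  · have := h0 T hT hB t ⟨by linarith [ht.1], by linarith [ht.2]⟩ (C1 / Real.log T) (by positivity) fun ρ hz hb l u =>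
      (h1 _ hL _ _ (hB ρ hz l u)).2 (by
        rw [le_abs]
        by_cases h5 : T < ρ.im
        · right; have := not_le.mp fun h => hb (mem_band.mpr ⟨hz, h5, h⟩); linarith [ht.2]
        · left; linarith [ht.1, not_lt.mp h5])
    rw [div_mul_cancel₀ _ (by linarith)] at this
    nlinarith
  · have g := gen t (C1 * Real.log T) (by positivity) fun ρ hρ => (h1 _ hL _ _ (bx ρ hρ)).1
    obtain ⟨s, b⟩ := h2 t
    have := (s.sum_le_tsum (band T) fun ρ _ => by positivity).trans b
    have l1 : Real.log (|t| + 3) ≤ 3 * Real.log T := by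
      rw [abs_of_nonneg (by linarith [ht.1])]
      exact log_le3 hT (by linarith [ht.1]) (by linarith [ht.2])
    refine g.trans ?_
    calc _ ≤ C1 * Real.log T * (C2 * (3 * Real.log T)) := by gcongr; exact this.trans (by gcongr)
      _ = 3 * (C1 * C2) * Real.log T ^ 2 := by ring
      _ ≤ _ := by nlinarith
  · have g := gen t (C1 / Real.log T) (by positivity) fun ρ hρ => (h1 _ hL _ _ (bx ρ hρ)).2 (by
        obtain ⟨_, b, c⟩ := mem_band.mp hρ
        rw [le_abs]
        rcases ht with ht | ht
        · right; linarith
        · left; linarith)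
    have s0 : 0 ≤ ∑ ρ ∈ band T, (ordE ρ:ℝ) * (1 / (1 + (t - ρ.im)^2)) :=
      Finset.sum_nonneg fun _ _ => by positivity
    constructor
    · have : ∃ t' ∈ Icc T (2*T), ∑ ρ ∈ band T, (ordE ρ:ℝ) * (1 / (1 + (t - ρ.im)^2))
          ≤ ∑ ρ ∈ band T, (ordE ρ:ℝ) * (1 / (1 + (t' - ρ.im)^2)) := by
        rcases ht with ht | ht
        · refine ⟨T, ⟨le_rfl, by linarith⟩, Finset.sum_le_sum fun ρ hρ => ?_⟩
          obtain ⟨_, b, c⟩ := mem_band.mp hρ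
          exact mul_le_mul_of_nonneg_left (one_div_le_one_div_of_le (by positivity) (by nlinarith)) (Nat.cast_nonneg _)
        · refine ⟨2*T, ⟨by linarith, le_rfl⟩, Finset.sum_le_sum fun ρ hρ => ?_⟩
          obtain ⟨_, b, c⟩ := mem_band.mp hρ
          exact mul_le_mul_of_nonneg_left (one_div_le_one_div_of_le (by positivity) (by nlinarith)) (Nat.cast_nonneg _)
      obtain ⟨t', ht', hle⟩ := this
      obtain ⟨s, b⟩ := h2 t'
      have := (s.sum_le_tsum (band T) fun ρ _ => by positivity).trans b
      have l1 : Real.log (|t'| + 3) ≤ 3 * Real.log T := by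
        rw [abs_of_nonneg (by linarith [ht'.1])]
        exact log_le3 hT (by linarith [ht'.1]) (by linarith [ht'.2])
      refine g.trans ?_
      calc _ ≤ C1 / Real.log T * (C2 * (3 * Real.log T)) := by
            gcongr; exact hle.trans (this.trans (by gcongr))
        _ = 3 * (C1 * C2) := by field_simp
        _ ≤ _ := by nlinarith
    · refine g.trans (mul_le_mul_of_nonneg_right ?_ s0)
      gcongr
      linarith

lemma pp_int (T : ℝ) : Integrable (fun t : ℝ => ∑ ρ ∈ band T, (ordE ρ:ℝ) * (1 / (1 + (t - ρ.im)^2))) ∧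
    ∫ t : ℝ, ∑ ρ ∈ band T, (ordE ρ:ℝ) * (1 / (1 + (t - ρ.im)^2)) = Real.pi * ∑ ρ ∈ band T, (ordE ρ:ℝ) := by
  have h : ∀ ρ ∈ band T, Integrable (fun t : ℝ => (ordE ρ:ℝ) * (1 / (1 + (t - ρ.im)^2))) := by
    intro ρ _
    simp only [one_div]
    exact (integrable_inv_one_add_sq.comp_sub_right ρ.im).const_mul _
  refine ⟨integrable_finsetSum _ h, ?_⟩
  rw [integral_finsetSum _ h, Finset.mul_sum]
  refine Finset.sum_congr rfl fun ρ _ => ?_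
  rw [integral_const_mul]
  simp only [one_div]
  rw [integral_sub_right_eq_self (fun t : ℝ => (1 + t^2)⁻¹) ρ.im, integral_univ_inv_one_add_sq, mul_comm]

lemma SS_int {G : ℝ → ℝ} {θ : ℝ} (hG : GoodG G θ) {T : ℝ} (hT : 3 ≤ T) : Continuous (SS G T) ∧
    Integrable (SS G T) ∧ Integrable (fun t => SS G T t ^ 2) ∧
    ∫ t, SS G T t = 2 * Real.pi * G 0 * ∑ ρ ∈ band T, (ordE ρ:ℝ) := by
  have hL := one_le_log hT
  have hc : Continuous (SS G T) := by
    unfold SS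
    refine continuous_finsetSum _ fun ρ _ => ?_
    have := KK_continuous hG (Real.log T * (ρ.re - 1/2))
    fun_prop
  have hi : ∀ ρ ∈ band T, Integrable (fun t => (ordE ρ:ℝ) * (2 * Real.log T * KK G (Real.log T * (ρ.re - 1/2)) (Real.log T * (t - ρ.im)))) := by
    intro ρ _
    have := (KK_integrable hG (Real.log T * (ρ.re - 1/2))).comp_mul_left' (show Real.log T ≠ 0 by linarith)
    exact ((this.comp_sub_right ρ.im).const_mul _).const_mul _
  have hI : Integrable (SS G T) := integrable_finsetSum _ hi
  refine ⟨hc, hI, ?_, ?_⟩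
  · obtain ⟨C, hC, hb⟩ := KK_bound hG
    have hbd : ∀ t, ‖SS G T t‖ ≤ ∑ ρ ∈ band T, (ordE ρ:ℝ) * (2 * Real.log T * (C * Real.exp |Real.log T * (ρ.re - 1/2)|)) := by
      intro t
      refine norm_sum_le_of_le _ fun ρ _ => ?_
      rw [norm_mul, norm_mul, Real.norm_of_nonneg (Nat.cast_nonneg _), Real.norm_of_nonneg (by linarith : 0 ≤ 2 * Real.log T)]
      gcongr
      exact (hb _ _).1
    have := hI.mul_bdd (c := _) hc.aestronglyMeasurable (ae_of_all _ hbd)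
    simpa only [sq] using this
  · unfold SS
    rw [integral_finsetSum _ hi, Finset.mul_sum]
    refine Finset.sum_congr rfl fun ρ _ => ?_
    rw [integral_const_mul, integral_const_mul,
      integral_sub_right_eq_self (fun t : ℝ => KK G (Real.log T * (ρ.re - 1/2)) (Real.log T * t)) ρ.im,
      Measure.integral_comp_mul_left (KK G (Real.log T * (ρ.re - 1/2))) (Real.log T)]
    have := KK_inversion hG (Real.log T * (ρ.re - 1/2)) 0
    simp only [zero_mul, Real.cos_zero, mul_one, abs_zero, mul_zero, Real.exp_zero] at this
    rw [this, abs_of_pos (by positivity), smul_eq_mul]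
    field_simp

lemma FF_cont (G : ℝ → ℝ) (T : ℝ) : Continuous (FF G T) := by
  unfold FF MM; fun_prop

lemma SS_upper {G : ℝ → ℝ} {θ : ℝ} (hG : GoodG G θ) : ∃ C > 0, ∀ T ≥ (4:ℝ), BoxT T →
    (∀ δ > 0, ∫ t, SS G T t ^ 2 ≤ (1 + δ) * (∫ t in T..2*T, FF G T t ^ 2) + (1 + 1/δ) * C * T + C * (Real.log T)^4 + C * T) ∧
    |(∫ t, SS G T t) - ∫ t in T..2*T, FF G T t| ≤ C * T + C * Real.log T ^ 2 := by
  obtain ⟨C, hC, h⟩ := SS_compare hG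
  obtain ⟨C1, hC1, hN⟩ := bandN
  refine ⟨4 * C^2 + Real.pi * C^2 * C1 + 4 * C + C * Real.pi * C1, by positivity, fun T hT hB => ?_⟩
  have hL := one_le_log (show 3 ≤ T by linarith)
  obtain ⟨ha, hb, hc, hd⟩ := h T hT hB
  obtain ⟨c1, c2, c3, c4⟩ := SS_int hG (show 3 ≤ T by linarith)
  obtain ⟨p1, p2⟩ := pp_int T
  have hN := hN T (by linarith)
  set pp : ℝ → ℝ := fun t : ℝ => ∑ ρ ∈ band T, (ordE ρ:ℝ) * (1 / (1 + (t - ρ.im)^2)) with hpp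
  have pp0 : ∀ t, 0 ≤ pp t := fun t => Finset.sum_nonneg fun _ _ => by positivity
  set L := Real.log T
  have hFc := FF_cont G T
  have ppI : ∫ t, pp t ≤ Real.pi * (C1 * (T * L)) := by rw [p2]; gcongr
  have eint : ∀ (u v c : ℝ), u ≤ v → ∫ t, (Icc u v).indicator (fun _ => c) t = (v - u) * c := by
    intro u v c huv
    rw [integral_indicator measurableSet_Icc, setIntegral_const, smul_eq_mul]
    simp [huv]
  have eI : ∀ (u v c : ℝ), Integrable ((Icc u v).indicator (fun _ : ℝ => c)) := fun u v c =>
    (integrable_indicator_iff measurableSet_Icc).mpr (continuous_const.integrableOn_Icc)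
  constructor
  · intro δ hδ
    have m1 : Integrable ((Icc T (2*T)).indicator (fun t => (1+δ) * FF G T t ^ 2 + (1 + 1/δ) * C^2)) :=
      (integrable_indicator_iff measurableSet_Icc).mpr (Continuous.integrableOn_Icc (by fun_prop))
    have m2 := eI (T-1) (T+1) (C^2 * L^4)
    have m3 := eI (2*T-1) (2*T+1) (C^2 * L^4)
    have m4 := p1.const_mul (C * (C / L))
    have i1 : ∫ t, (Icc T (2*T)).indicator (fun t => (1+δ) * FF G T t ^ 2 + (1 + 1/δ) * C^2) t
        = (1 + δ) * (∫ t in T..2*T, FF G T t ^ 2) + T * ((1 + 1/δ) * C^2) := by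
      rw [integral_indicator measurableSet_Icc, integral_Icc_eq_integral_Ioc,
        ← intervalIntegral.integral_of_le (by linarith), intervalIntegral.integral_add
          (Continuous.intervalIntegrable (by fun_prop) _ _) (Continuous.intervalIntegrable (by fun_prop) _ _),
        intervalIntegral.integral_const_mul, intervalIntegral.integral_const, smul_eq_mul]
      ring
    have main := integral_mono c3 (((m1.add m2).add m3).add m4) (fun t => ?_)
    · rw [integral_add' ((m1.add m2).add m3) m4, integral_add' (m1.add m2) m3, integral_add' m1 m2, i1,
        eint _ _ _ (by linarith), eint _ _ _ (by linarith), integral_const_mul] at main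
      refine main.trans ?_
      have q1 : C * (C / L) * (∫ t, pp t) ≤ Real.pi * C^2 * C1 * T := by
        calc _ ≤ C * (C / L) * (Real.pi * (C1 * (T * L))) := by gcongr
          _ = _ := by field_simp
      have q2 : (1 + 1/δ) * C^2 * T ≤ (1 + 1/δ) * (4 * C^2 + Real.pi * C^2 * C1 + 4 * C + C * Real.pi * C1) * T := by
        gcongr
        have : 0 ≤ Real.pi * C^2 * C1 + 4 * C + C * Real.pi * C1 := by positivity
        nlinarith
      have q3 : 4 * C^2 * L^4 ≤ (4 * C^2 + Real.pi * C^2 * C1 + 4 * C + C * Real.pi * C1) * L^4 := by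
        gcongr
        have : 0 ≤ Real.pi * C^2 * C1 + 4 * C + C * Real.pi * C1 := by positivity
        nlinarith
      have q4 : Real.pi * C^2 * C1 * T ≤ (4 * C^2 + Real.pi * C^2 * C1 + 4 * C + C * Real.pi * C1) * T := by
        gcongr
        have : 0 ≤ 4 * C ^ 2 + 4 * C + C * Real.pi * C1 := by positivity
        nlinarith
      linarith
    · simp only [Pi.add_apply]
      have n1 : 0 ≤ (Icc T (2*T)).indicator (fun t => (1+δ) * FF G T t ^ 2 + (1 + 1/δ) * C^2) t :=
        indicator_nonneg (fun t _ => by positivity) t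
      have n2 : 0 ≤ (Icc (T-1) (T+1)).indicator (fun _ => C^2 * L^4) t := indicator_nonneg (fun t _ => by positivity) t
      have n3 : 0 ≤ (Icc (2*T-1) (2*T+1)).indicator (fun _ => C^2 * L^4) t := indicator_nonneg (fun t _ => by positivity) t
      have n4 : 0 ≤ C * (C / L) * pp t := by have := pp0 t; positivity
      have edge : t ∈ Icc (T-1) (2*T+1) → SS G T t ^ 2 ≤ C^2 * L^4 := fun ht => by
        rw [← sq_abs]
        calc _ ≤ (C * L^2)^2 := by gcongr; exact hc t ht
          _ = _ := by ring
      by_cases k1 : t ∈ Icc (T-1) (T+1)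
      · rw [indicator_of_mem k1] at n2 ⊢
        have := edge ⟨k1.1, by linarith [k1.2]⟩
        linarith
      by_cases k2 : t ∈ Icc (2*T-1) (2*T+1)
      · rw [indicator_of_mem k2] at n3 ⊢
        have := edge ⟨by linarith [k2.1], k2.2⟩
        linarith
      by_cases k3 : t ∈ Icc (T+1) (2*T-1)
      · have k4 : t ∈ Icc T (2*T) := ⟨by linarith [k3.1], by linarith [k3.2]⟩
        rw [indicator_of_mem k4]
        have e := hb t k3
        set x := FF G T t
        set y := SS G T t
        have e2 : (y - x)^2 ≤ C^2 := sq_le_sq' (by linarith [abs_le.mp e]) (abs_le.mp e).2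
        have : y^2 ≤ (1 + δ) * x^2 + (1 + 1/δ) * (y - x)^2 := by
          have : (1 + δ) * x^2 + (1 + 1/δ) * (y - x)^2 - y^2 = (δ * x - (y - x))^2 / δ := by field_simp; ring
          have : 0 ≤ (δ * x - (y - x))^2 / δ := by positivity
          linarith
        have : (1 + 1/δ) * (y - x)^2 ≤ (1 + 1/δ) * C^2 := by gcongr
        linarith
      · obtain ⟨d1, d2⟩ := hd t (by
          simp only [mem_Icc, not_and_or, not_le] at k1 k2 k3
          by_contra hh
          push Not at hh
          rcases k1 with k1 | k1 <;> rcases k2 with k2 | k2 <;> rcases k3 with k3 | k3 <;> linarith)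
        have : SS G T t ^ 2 ≤ C * (C / L * pp t) := by
          rw [← sq_abs, sq]; gcongr
        linarith
  · have m1 : Integrable ((Icc T (2*T)).indicator (FF G T)) :=
      (integrable_indicator_iff measurableSet_Icc).mpr (Continuous.integrableOn_Icc (by fun_prop))
    have i1 : ∫ t in T..2*T, FF G T t = ∫ t, (Icc T (2*T)).indicator (FF G T) t := by
      rw [integral_indicator measurableSet_Icc, integral_Icc_eq_integral_Ioc,
        ← intervalIntegral.integral_of_le (by linarith)]
    have m0 := eI T (2*T) C
    have m2 := eI (T-1) (T+1) (C * L^2)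
    have m3 := eI (2*T-1) (2*T+1) (C * L^2)
    have m4 := p1.const_mul (C / L)
    rw [i1, ← integral_sub c2 m1, ← Real.norm_eq_abs]
    have main := norm_integral_le_of_norm_le (((m0.add m2).add m3).add m4)
      (f := fun t => SS G T t - (Icc T (2*T)).indicator (FF G T) t) (ae_of_all _ fun t => ?_)
    · refine main.trans ?_
      rw [integral_add' ((m0.add m2).add m3) m4, integral_add' (m0.add m2) m3, integral_add' m0 m2,
        eint _ _ _ (by linarith), eint _ _ _ (by linarith), eint _ _ _ (by linarith), integral_const_mul]
      have q1 : C / L * (∫ t, pp t) ≤ C * Real.pi * C1 * T := by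
        calc _ ≤ C / L * (Real.pi * (C1 * (T * L))) := by gcongr
          _ = _ := by field_simp
      have q3 : 4 * C * L^2 ≤ (4 * C^2 + Real.pi * C^2 * C1 + 4 * C + C * Real.pi * C1) * L^2 := by
        gcongr
        have : 0 ≤ 4 * C^2 + Real.pi * C^2 * C1 + C * Real.pi * C1 := by positivity
        nlinarith
      have q4 : (C + C * Real.pi * C1) * T ≤ (4 * C^2 + Real.pi * C^2 * C1 + 4 * C + C * Real.pi * C1) * T := by
        gcongr
        have : 0 ≤ 4 * C ^ 2 + Real.pi * C^2 * C1 := by positivity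
        nlinarith
      linarith
    · simp only [Pi.add_apply, Real.norm_eq_abs]
      have n1 : 0 ≤ (Icc T (2*T)).indicator (fun _ => C) t := indicator_nonneg (fun t _ => by positivity) t
      have n2 : 0 ≤ (Icc (T-1) (T+1)).indicator (fun _ => C * L^2) t := indicator_nonneg (fun t _ => by positivity) t
      have n3 : 0 ≤ (Icc (2*T-1) (2*T+1)).indicator (fun _ => C * L^2) t := indicator_nonneg (fun t _ => by positivity) t
      have n4 : 0 ≤ C / L * pp t := by have := pp0 t; positivity
      have edge : t ∈ Icc (T-1) (2*T+1) → |SS G T t - (Icc T (2*T)).indicator (FF G T) t| ≤ C * L^2 := fun ht => by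
        by_cases k4 : t ∈ Icc T (2*T)
        · rw [indicator_of_mem k4]; exact ha t k4
        · rw [indicator_of_notMem k4, sub_zero]; exact hc t ht
      by_cases k1 : t ∈ Icc (T-1) (T+1)
      · rw [indicator_of_mem k1 (fun _ => C * L^2)] at n2 ⊢
        have := edge ⟨k1.1, by linarith [k1.2]⟩
        linarith
      by_cases k2 : t ∈ Icc (2*T-1) (2*T+1)
      · rw [indicator_of_mem k2 (fun _ => C * L^2)] at n3 ⊢
        have := edge ⟨by linarith [k2.1], k2.2⟩
        linarith
      by_cases k3 : t ∈ Icc (T+1) (2*T-1)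
      · have k4 : t ∈ Icc T (2*T) := ⟨by linarith [k3.1], by linarith [k3.2]⟩
        rw [indicator_of_mem k4, indicator_of_mem k4]
        have e := hb t k3
        linarith
      · have hfar : t ≤ T - 1 ∨ 2*T+1 ≤ t := by
          simp only [mem_Icc, not_and_or, not_le] at k1 k2 k3
          by_contra hh
          push Not at hh
          rcases k1 with k1 | k1 <;> rcases k2 with k2 | k2 <;> rcases k3 with k3 | k3 <;> linarith
        obtain ⟨d1, d2⟩ := hd t hfar
        rw [indicator_of_notMem (fun hk : t ∈ Icc T (2*T) => by
          rcases hfar with h | h <;> linarith [hk.1, hk.2]) (FF G T), sub_zero]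
        linarith

lemma SS_mean {G : ℝ → ℝ} {θ : ℝ} (hG : GoodG G θ) (hB : ∀ᶠ T in atTop, BoxT T) {ε : ℝ} (hε : 0 < ε) : ∀ᶠ T in atTop,
    ∫ t, SS G T t ^ 2 ≤ T * Real.log T ^ 2 * (G 0 ^ 2 + 2 * (∫ a in (0:ℝ)..1, a * G a ^ 2) + ε) ∧
    |2 * Real.pi * G 0 * (∑ ρ ∈ band T, (ordE ρ:ℝ)) - T * Real.log T * G 0| ≤ ε * (T * Real.log T) := by
  obtain ⟨C, hC, h⟩ := SS_upper hG
  set J := ∫ a in (0:ℝ)..1, a * G a ^ 2 with hJd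
  have hJ : 0 ≤ J := intervalIntegral.integral_nonneg zero_le_one fun a ha => mul_nonneg ha.1 (sq_nonneg _)
  set Q := G 0 ^ 2 + 2 * J with hQ
  have hQ0 : 0 ≤ Q := by positivity
  set δ := min 1 (ε / (4 * (Q + 1))) with hδ
  have hδ0 : 0 < δ := by positivity
  set K := (1 + 1/δ) * C + C + C with hK
  have hK0 : 0 < K := by positivity
  have hq : ∀ᶠ T in atTop, Real.log T ^ 4 ≤ T := by
    filter_upwards [(Real.isLittleO_pow_log_id_atTop (n := 4)).def one_pos, eventually_gt_atTop 0] with T h hT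
    simpa [abs_of_pos hT] using (le_abs_self _).trans h
  filter_upwards [hB, eventually_ge_atTop 4, FF_mean hG (show 0 < ε / 4 by positivity), hq,
    Real.tendsto_log_atTop.eventually_ge_atTop (4 * K / ε)] with T hB hT ⟨f1, f2⟩ hq hlog
  have hL := one_le_log (show 3 ≤ T by linarith)
  obtain ⟨h1, h2⟩ := h T hT hB
  have h1 := h1 δ hδ0
  rw [(SS_int hG (show 3 ≤ T by linarith)).2.2.2] at h2
  rw [div_le_iff₀ hε] at hlog
  set L := Real.log T
  have hKL : K * T ≤ ε / 4 * (T * L) := by nlinarith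
  have hTL : T * L ≤ T * L^2 := by gcongr; exact le_self_pow₀ hL (by norm_num)
  constructor
  · refine h1.trans ?_
    have g1 : (1 + δ) * (∫ t in T..2*T, FF G T t ^ 2) ≤ (1 + δ) * (T * L^2 * (Q + ε/4)) := by gcongr
    have g2 : (1 + δ) * (Q + ε/4) ≤ Q + ε/4 + ε/4 + ε/4 := by
      have d1 : δ * (ε / 4) ≤ ε / 4 := by
        have := min_le_left 1 (ε / (4 * (Q + 1))); nlinarith
      have d2 : δ * Q ≤ ε / 4 := by
        have : δ * (Q + 1) ≤ ε / (4 * (Q+1)) * (Q + 1) := by gcongr; exact min_le_right _ _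
        rw [show ε / (4 * (Q+1)) * (Q + 1) = ε / 4 by field_simp] at this
        nlinarith
      linarith
    have g3 : (1 + δ) * (T * L^2 * (Q + ε/4)) ≤ T * L^2 * (Q + ε/4 + ε/4 + ε/4) := by
      have := mul_le_mul_of_nonneg_left g2 (show 0 ≤ T * L^2 by positivity)
      linarith
    have g4 : (1 + 1/δ) * C * T + C * L^4 + C * T ≤ K * T := by
      have : C * L^4 ≤ C * T := by gcongr
      rw [hK]; linarith
    have : ε / 4 * (T * L) ≤ ε / 4 * (T * L^2) := by gcongr
    linarith
  · have g : C * T + C * L^2 ≤ K * T := by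
      have : L^2 ≤ L^4 := pow_le_pow_right₀ hL (by norm_num)
      have : C * L^2 ≤ C * T := by gcongr; linarith
      have : 0 ≤ (1 + 1/δ) * C * T := by positivity
      rw [hK]; linarith
    have := abs_sub_le (2 * Real.pi * G 0 * (∑ ρ ∈ band T, (ordE ρ:ℝ))) (∫ t in T..2*T, FF G T t) (T * L * G 0)
    have : 0 ≤ ε * (T * L) := by positivity
    linarith

lemma refl_mem {T : ℝ} {ρ : ℂ} (h : ρ ∈ band T) : 1 - starRingEnd ℂ ρ ∈ band T := by
  rw [mem_band] at h ⊢
  rw [xiE_one_sub, xiE_conj, h.1]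
  simpa using h.2

lemma refl_ord (ρ : ℂ) : ordE (1 - starRingEnd ℂ ρ) = ordE ρ := by rw [ordE_one_sub, ordE_conj]

lemma band_refl (T : ℝ) (f : ℝ → ℝ → ℝ) : ∑ ρ ∈ band T, (ordE ρ:ℝ) * f (ρ.re - 1/2) ρ.im
    = ∑ ρ ∈ band T, (ordE ρ:ℝ) * f (-(ρ.re - 1/2)) ρ.im := by
  refine Finset.sum_nbij' (fun ρ => 1 - starRingEnd ℂ ρ) (fun ρ => 1 - starRingEnd ℂ ρ)
    (fun ρ h => refl_mem h) (fun ρ h => refl_mem h) (fun ρ _ => by simp) (fun ρ _ => by simp) fun ρ _ => ?_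
  rw [refl_ord]
  simp only [Complex.sub_re, Complex.sub_im, Complex.one_re, Complex.one_im, Complex.conj_re, Complex.conj_im]
  ring_nf

lemma cosh_int {G : ℝ → ℝ} {θ : ℝ} (hG : GoodG G θ) (X Y : ℝ) :
    Integrable (fun a => G a * Real.cosh (X * a)) ∧
    ∫ a, G a * Real.cosh (X * a) * Real.cos (Y * a) = KK G X Y + KK G (-X) Y := by
  have e : ∀ a, G a * Real.cosh (X * a) = (1/2) * (G a * Real.exp (X * |a|) + G a * Real.exp (-X * |a|)) := by
    intro a
    rw [← Real.cosh_abs, abs_mul, Real.cosh_eq]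
    rcases abs_choice X with h | h <;> rw [h] <;> ring_nf
  have i1 := W_integrable hG X
  have i2 := W_integrable hG (-X)
  have bd : ∀ {W : ℝ → ℝ}, Integrable W → Integrable fun a => W a * Real.cos (Y * a) := fun hW =>
    hW.mul_bdd (c := 1) (by fun_prop) (ae_of_all _ fun a => by simpa using Real.abs_cos_le_one _)
  refine ⟨by simp_rw [e]; exact (i1.add i2).const_mul _, ?_⟩
  simp_rw [e, mul_assoc, add_mul, integral_const_mul]
  rw [integral_add (bd i1) (bd i2), W_integral hG, W_integral hG]
  ring

noncomputable def VV (T a : ℝ) : ℂ := ∑ ρ ∈ band T,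
  ((ordE ρ * Real.cosh (Real.log T * (ρ.re - 1/2) * a) : ℝ) : ℂ) * Complex.exp ((Real.log T * ρ.im * a : ℝ) * Complex.I)

open FourierTransform in
lemma SS_fourier {G : ℝ → ℝ} {θ : ℝ} (hG : GoodG G θ) (T t : ℝ) :
    ((SS G T t : ℝ) : ℂ) = Real.log T * 𝓕 (fun a : ℝ => (G a : ℂ) * VV T a) (t * Real.log T / (2 * Real.pi)) := by
  have hpi : Real.pi ≠ 0 := Real.pi_ne_zero
  set L := Real.log T with hLd
  have e1 : SS G T t = L * ∑ ρ ∈ band T, (ordE ρ:ℝ) * (KK G (L * (ρ.re - 1/2)) (L * (t - ρ.im)) + KK G (-(L * (ρ.re - 1/2))) (L * (t - ρ.im))) := by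
    have := band_refl T (fun x y => KK G (L * x) (L * (t - y)))
    simp only [mul_add, Finset.sum_add_distrib]
    simp only [mul_neg] at this
    rw [← this, ← two_mul, Finset.mul_sum, Finset.mul_sum, SS]
    exact Finset.sum_congr rfl fun ρ _ => by rw [← hLd]; ring
  have term : ∀ ρ : ℂ, Integrable (fun a : ℝ => Complex.exp (((-2 * Real.pi * a * (t * L / (2 * Real.pi)) : ℝ) : ℂ) * Complex.I) •
      ((G a : ℂ) * (((ordE ρ * Real.cosh (L * (ρ.re - 1/2) * a) : ℝ) : ℂ) * Complex.exp ((L * ρ.im * a : ℝ) * Complex.I))))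
     ∧ ∫ a : ℝ, Complex.exp (((-2 * Real.pi * a * (t * L / (2 * Real.pi)) : ℝ) : ℂ) * Complex.I) •
      ((G a : ℂ) * (((ordE ρ * Real.cosh (L * (ρ.re - 1/2) * a) : ℝ) : ℂ) * Complex.exp ((L * ρ.im * a : ℝ) * Complex.I)))
      = (((ordE ρ:ℝ) * (KK G (L * (ρ.re - 1/2)) (L * (t - ρ.im)) + KK G (-(L * (ρ.re - 1/2))) (L * (t - ρ.im))) : ℝ) : ℂ) := by
    intro ρ
    have hW := cosh_int hG (L * (ρ.re - 1/2)) (L * (t - ρ.im))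
    have eq : ∀ a : ℝ, Complex.exp (((-2 * Real.pi * a * (t * L / (2 * Real.pi)) : ℝ) : ℂ) * Complex.I) •
      ((G a : ℂ) * (((ordE ρ * Real.cosh (L * (ρ.re - 1/2) * a) : ℝ) : ℂ) * Complex.exp ((L * ρ.im * a : ℝ) * Complex.I)))
      = (ordE ρ:ℂ) * (Complex.exp (((-2 * Real.pi * a * (L * (t - ρ.im) / (2 * Real.pi)) : ℝ) : ℂ) * Complex.I) •
        ((G a * Real.cosh (L * (ρ.re - 1/2) * a) : ℝ) : ℂ)) := by
      intro a
      rw [show ((-2 * Real.pi * a * (L * (t - ρ.im) / (2 * Real.pi)) : ℝ) : ℂ) * Complex.I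
        = ((-2 * Real.pi * a * (t * L / (2 * Real.pi)) : ℝ) : ℂ) * Complex.I + (L * ρ.im * a : ℝ) * Complex.I by
        rw [← add_mul, ← Complex.ofReal_add]; congr 2; field_simp; ring, Complex.exp_add]
      push_cast
      simp only [smul_eq_mul]
      ring
    have hF := fourier_even hW.1 (fun a => by rw [hG.even]; simp) (L * (t - ρ.im) / (2 * Real.pi))
    rw [Real.fourier_real_eq_integral_exp_smul, show 2 * Real.pi * (L * (t - ρ.im) / (2 * Real.pi)) = L * (t - ρ.im) by field_simp, hW.2] at hF
    constructor
    · simp_rw [eq]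
      refine Integrable.const_mul ?_ _
      refine hW.1.ofReal.bdd_mul (c := 1) (by fun_prop) (ae_of_all _ fun a => ?_)
      rw [Complex.norm_exp_ofReal_mul_I]
    · simp_rw [eq]
      rw [integral_const_mul, hF]; push_cast; ring
  rw [Real.fourier_real_eq_integral_exp_smul, e1]
  simp only [VV, Finset.mul_sum, Finset.smul_sum]
  rw [integral_finsetSum _ fun ρ _ => (term ρ).1, Finset.sum_congr rfl fun ρ _ => (term ρ).2, Complex.ofReal_sum, Finset.mul_sum]
  exact Finset.sum_congr rfl fun ρ _ => by push_cast; ring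

lemma VV_contDiff (T : ℝ) : ContDiff ℝ (⊤:ℕ∞) (VV T) := by
  unfold VV
  refine ContDiff.sum fun ρ _ => ?_
  refine ContDiff.mul ?_ ?_
  · exact Complex.ofRealCLM.contDiff.comp (contDiff_const.mul (Real.contDiff_cosh.comp (contDiff_const.mul contDiff_id)))
  · exact (((Complex.ofRealCLM.contDiff.comp (contDiff_const.mul contDiff_id))).mul contDiff_const).cexp

open FourierTransform in
lemma planch {G : ℝ → ℝ} {θ : ℝ} (hG : GoodG G θ) {T : ℝ} (hT : 3 ≤ T) :
    ∫ t, SS G T t ^ 2 = 2 * Real.pi * Real.log T * ∫ a, G a ^ 2 * ‖VV T a‖ ^ 2 := by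
  have hL := one_le_log hT
  have hcs : HasCompactSupport (fun a : ℝ => (G a : ℂ) * VV T a) := by
    refine HasCompactSupport.of_support_subset_isCompact (isCompact_Icc (a := -1) (b := 1)) ?_
    intro a ha
    by_contra h
    apply ha
    have : θ ≤ |a| := by
      by_contra h2
      rw [not_le, abs_lt] at h2
      exact h ⟨by linarith [hG.lt], by linarith [hG.lt]⟩
    simp [hG.supp a this]
  have hsm : ContDiff ℝ (⊤:ℕ∞) (fun a : ℝ => (G a : ℂ) * VV T a) :=
    (Complex.ofRealCLM.contDiff.comp hG.smooth).mul (VV_contDiff T)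
  have hp := SchwartzMap.integral_norm_sq_fourier (hcs.toSchwartzMap hsm)
  have hp' : ∫ ξ : ℝ, ‖𝓕 (fun a : ℝ => (G a : ℂ) * VV T a) ξ‖^2 = ∫ a, G a ^ 2 * ‖VV T a‖ ^ 2 := by
    rw [SchwartzMap.fourier_coe] at hp
    refine hp.trans (integral_congr_ae (ae_of_all _ fun a => ?_))
    simp [mul_pow]
  have h1 : ∀ t, SS G T t ^ 2 = Real.log T ^ 2 * ‖𝓕 (fun a : ℝ => (G a : ℂ) * VV T a) (Real.log T / (2 * Real.pi) * t)‖^2 := by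
    intro t
    have := congrArg (fun z => ‖z‖^2) (SS_fourier hG T t)
    simp only [Complex.norm_real, norm_mul, mul_pow, Real.norm_eq_abs, sq_abs] at this
    rw [this]; congr 4; ring_nf
  simp_rw [h1]
  rw [integral_const_mul, Measure.integral_comp_mul_left (fun ξ => ‖𝓕 (fun a : ℝ => (G a : ℂ) * VV T a) ξ‖^2), hp',
    abs_of_pos (by positivity), smul_eq_mul]
  field_simp

lemma strip_pos {κ : ℝ → ℝ} (hκ : Continuous κ) {B : ℝ} (hB : 0 < B)
    (h : ∀ y, 0 ≤ ∫ u in (0:ℝ)..1, κ u * Real.cosh (u * B) * Real.cos (u * y)) {x : ℝ} (hx : |x| ≤ B) (y : ℝ) :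
    0 ≤ ∫ u in (0:ℝ)..1, κ u * Real.cosh (u * x) * Real.cos (u * y) := by
  set F : ℂ → ℂ := fun w => ∫ u in (0:ℝ)..1, (κ u : ℂ) * Complex.cosh (u * w) with hF
  have hre : ∀ a b : ℝ, (F (a + b * Complex.I)).re = ∫ u in (0:ℝ)..1, κ u * Real.cosh (u * a) * Real.cos (u * b) := by
    intro a b
    have hi : IntervalIntegrable (fun u : ℝ => (κ u : ℂ) * Complex.cosh (u * (a + b * Complex.I))) volume 0 1 := by
      apply Continuous.intervalIntegrable; fun_prop
    have := Complex.reCLM.intervalIntegral_comp_comm hi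
    simp only [Complex.reCLM_apply] at this
    rw [hF, ← this]
    refine intervalIntegral.integral_congr fun u _ => ?_
    have : (u : ℂ) * (a + b * Complex.I) = ((u * a : ℝ) : ℂ) + ((u * b : ℝ) : ℂ) * Complex.I := by push_cast; ring
    simp only [this, Complex.cosh_add, Complex.cosh_mul_I, Complex.sinh_mul_I, Complex.re_ofReal_mul]
    rw [← Complex.ofReal_cosh, ← Complex.ofReal_cos, ← Complex.ofReal_sinh, ← Complex.ofReal_sin]
    simp only [Complex.add_re, ← Complex.ofReal_mul, ← mul_assoc, Complex.ofReal_re, Complex.re_ofReal_mul, Complex.I_re]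
    ring
  have hd : Differentiable ℂ F := by
    intro w
    obtain ⟨M, hM⟩ := ((isCompact_Icc (a := (0:ℝ)) (b := 1)).prod (isCompact_closedBall w 1)).exists_bound_of_continuousOn
      (f := fun p : ℝ × ℂ => (κ p.1 : ℂ) * (Complex.sinh (p.1 * p.2) * p.1)) (by fun_prop)
    refine (intervalIntegral.hasDerivAt_integral_of_dominated_loc_of_deriv_le (μ := volume) (𝕜 := ℂ)
      (F := fun w (u : ℝ) => (κ u : ℂ) * Complex.cosh (u * w))
      (F' := fun w (u : ℝ) => (κ u : ℂ) * (Complex.sinh (u * w) * u)) (bound := fun _ => M)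
      (Metric.ball_mem_nhds w one_pos) (Eventually.of_forall fun w' => ?_) ?_ ?_ ?_ ?_ ?_).2.differentiableAt
    · exact (by fun_prop : Continuous fun u : ℝ => (κ u : ℂ) * Complex.cosh (u * w')).aestronglyMeasurable
    · apply Continuous.intervalIntegrable; fun_prop
    · exact (by fun_prop : Continuous fun u : ℝ => (κ u : ℂ) * (Complex.sinh (u * w) * u)).aestronglyMeasurable
    · refine ae_of_all _ fun u hu w' hw' => hM (u, w') ⟨?_, Metric.ball_subset_closedBall hw'⟩
      rw [uIoc_of_le zero_le_one] at hu
      exact ⟨hu.1.le, hu.2⟩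
    · exact intervalIntegrable_const
    · refine ae_of_all _ fun u _ w' _ => ?_
      have h1 : HasDerivAt (fun w : ℂ => (u : ℂ) * w) u w' := by simpa using (hasDerivAt_id w').const_mul (u : ℂ)
      exact h1.ccosh.const_mul _
  obtain ⟨M, hM⟩ := ((isCompact_Icc (a := (0:ℝ)) (b := 1)).prod (isCompact_Icc (a := -B) (b := B))).exists_bound_of_continuousOn
    (f := fun p : ℝ × ℝ => κ p.1 * Real.cosh (p.1 * p.2)) (by fun_prop)
  have hbd : ∀ a b : ℝ, |a| ≤ B → -M ≤ (F (a + b * Complex.I)).re := by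
    intro a b ha
    rw [hre]
    have := intervalIntegral.norm_integral_le_of_norm_le_const (a := (0:ℝ)) (b := 1) (C := M)
      (f := fun u => κ u * Real.cosh (u * a) * Real.cos (u * b)) (by
        intro u hu
        rw [uIoc_of_le zero_le_one] at hu
        have := hM (u, a) ⟨⟨hu.1.le, hu.2⟩, abs_le.1 ha⟩
        rw [norm_mul]
        calc _ ≤ M * 1 := mul_le_mul this (by simpa using Real.abs_cos_le_one _) (norm_nonneg _) ((norm_nonneg _).trans this)
          _ = M := mul_one M)
    rw [Real.norm_eq_abs] at this
    simp only [sub_zero, abs_one, mul_one] at this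
    linarith [(abs_le.1 this).1]
  have hz : ∀ z : ℂ, z = (z.re : ℂ) + (z.im : ℂ) * Complex.I := fun z => (Complex.re_add_im z).symm
  have hn : ∀ z : ℂ, ‖Complex.exp (-F z)‖ = Real.exp (-(F z).re) := fun z => by rw [Complex.norm_exp, Complex.neg_re]
  have key := PhragmenLindelof.vertical_strip (a := -B) (b := B) (C := 1) (f := fun z => Complex.exp (-F z))
    (z := (x : ℂ) + y * Complex.I) (hd.neg.cexp.diffContOnCl) ?_ ?_ ?_ (by simpa using (abs_le.1 hx).1) (by simpa using (abs_le.1 hx).2)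
  · rw [hn, hre, Real.exp_le_one_iff] at key
    linarith
  · refine ⟨0, div_pos Real.pi_pos (by linarith), M, ?_⟩
    refine Asymptotics.IsBigO.of_bound 1 ?_
    refine mem_inf_of_right (mem_principal.2 fun z hz' => ?_)
    simp only [mem_setOf_eq, hn, one_mul, zero_mul, Real.exp_zero, mul_one, Real.norm_eq_abs, Real.abs_exp, Real.exp_le_exp]
    have := hbd z.re z.im (abs_le.2 ⟨hz'.1.le, hz'.2.le⟩)
    rw [← hz] at this
    linarith
  · intro z hzr
    rw [hn, Real.exp_le_one_iff, hz z, hre, hzr]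
    have := h z.im
    simp only [mul_neg, Real.cosh_neg]; linarith
  · intro z hzr
    rw [hn, Real.exp_le_one_iff, hz z, hre, hzr]
    linarith [h z.im]

noncomputable def Q (u : ℝ) : ℝ := (203 - 135*u - 220*u^2 + 160*u^3 - 8*u^5)/203

lemma Q_nonneg {u : ℝ} (h0 : 0 ≤ u) (h1 : u ≤ 1) : 0 ≤ Q u := by
  have : Q u = (1-u)*(203+68*u-152*u^2+8*u^3+8*u^4)/203 := by unfold Q; ring
  rw [this]
  have : 0 ≤ 203+68*u-152*u^2+8*u^3+8*u^4 := by
    have : 0 ≤ 8*u^3+8*u^4 := by positivity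
    nlinarith
  exact div_nonneg (mul_nonneg (by linarith) this) (by norm_num)

lemma Q_cos (y : ℝ) : 0 ≤ ∫ u in (0:ℝ)..1, Q u * Real.cos (u * y) := by
  rcases eq_or_ne y 0 with rfl | hy
  · refine intervalIntegral.integral_nonneg zero_le_one fun u hu => ?_
    simpa using Q_nonneg hu.1 hu.2
  have hD : ∀ u : ℝ, HasDerivAt (fun u : ℝ => (203 - 135*u - 220*u^2 + 160*u^3 - 8*u^5) * Real.sin (u*y)/y
      + (-135 - 440*u + 480*u^2 - 40*u^4) * Real.cos (u*y)/y^2 - (-440 + 960*u-160*u^3) * Real.sin (u*y)/y^3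
      - (960 - 480*u^2) * Real.cos (u*y)/y^4 + (-960*u)*Real.sin (u*y)/y^5 + (-960)*Real.cos (u*y)/y^6)
      (203 * (Q u * Real.cos (u*y))) u := by
    intro u
    have i := hasDerivAt_id' u
    have hs := (i.mul_const y).sin
    have hc := (i.mul_const y).cos
    have p := fun n : ℕ => hasDerivAt_pow n u
    refine ((((((((((i.const_mul 135).const_sub 203).sub ((p 2).const_mul 220)).add ((p 3).const_mul 160)).sub ((p 5).const_mul 8)).mul hs).div_const y).add
      ((((((i.const_mul 440).const_sub (-135)).add ((p 2).const_mul 480)).sub ((p 4).const_mul 40)).mul hc).div_const (y^2))).sub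
      (((((i.const_mul 960).const_add (-440)).sub ((p 3).const_mul 160)).mul hs).div_const (y^3))).sub
      (((((p 2).const_mul 480).const_sub 960).mul hc).div_const (y^4)) |>.add
      (((i.const_mul (-960)).mul hs).div_const (y^5)) |>.add ((hc.const_mul (-960)).div_const (y^6))).congr_deriv ?_
    unfold Q
    simp only [Pi.add_apply, Pi.sub_apply, Pi.mul_apply]
    field_simp
    push_cast
    ring
  have := intervalIntegral.integral_eq_sub_of_hasDerivAt (a := 0) (b := 1) (fun u _ => hD u)
    (by unfold Q; apply Continuous.intervalIntegrable; fun_prop)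
  rw [intervalIntegral.integral_const_mul] at this
  have e : 203 * ∫ u in (0:ℝ)..1, Q u * Real.cos (u * y) =
      480 * (3/4*Real.sin (y/2)/y - Real.cos (y/2)/y^2 + 2*Real.sin (y/2)/y^3)^2 := by
    rw [this]
    have h1 : Real.sin y = 2 * Real.sin (y/2) * Real.cos (y/2) := by rw [← Real.sin_two_mul]; ring_nf
    have h2 : Real.cos y = 1 - 2 * Real.sin (y/2)^2 := by
      have := Real.cos_two_mul (y/2); have h5 := Real.sin_sq_add_cos_sq (y/2)
      rw [mul_div_cancel₀ y two_ne_zero] at this; linarith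
    simp only [one_mul, zero_mul, Real.sin_zero, Real.cos_zero, h1, h2]
    have h3 := Real.sin_sq_add_cos_sq (y/2)
    generalize Real.sin (y/2) = s at *
    generalize Real.cos (y/2) = c at *
    field_simp
    have h4 : c^2 = 1 - s^2 := by linarith
    ring_nf
    rw [h4]
    ring
  have : 0 ≤ 480 * (3/4*Real.sin (y/2)/y - Real.cos (y/2)/y^2 + 2*Real.sin (y/2)/y^3)^2 := by positivity
  linarith

noncomputable def kk (u : ℝ) : ℝ := Q (min |u| 1) / Real.cosh (u * 0.15925) ^ 2

lemma kk_cont : Continuous kk := by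
  unfold kk Q
  refine Continuous.div (by fun_prop) (by fun_prop) fun u => (pow_pos (Real.cosh_pos _) 2).ne'

lemma kk_even (u : ℝ) : kk (-u) = kk u := by simp [kk]

lemma kk_nonneg (u : ℝ) : 0 ≤ kk u :=
  div_nonneg (Q_nonneg (by positivity) (min_le_right _ _)) (by positivity)

lemma kk_le_one (u : ℝ) : kk u ≤ 1 := by
  have h0 : 0 ≤ min |u| 1 := by positivity
  have h1 := min_le_right |u| 1
  unfold kk
  generalize min |u| 1 = v at *
  rw [div_le_one (pow_pos (Real.cosh_pos _) 2)]
  have : Q v ≤ 1 := by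
    unfold Q
    rw [div_le_one (by norm_num)]
    nlinarith [pow_nonneg h0 5, pow_nonneg h0 2, mul_nonneg (pow_nonneg h0 2) (sub_nonneg.2 h1)]
  nlinarith [Real.one_le_cosh (u * 0.15925)]

lemma kk_eq {u : ℝ} (hu : u ∈ Icc (0:ℝ) 1) : kk u = Q u / Real.cosh (u * 0.15925) ^ 2 := by
  rw [kk, abs_of_nonneg hu.1, min_eq_left hu.2]

lemma kk_pos {x x' : ℝ} (hx : |x| ≤ 0.15925) (hx' : |x'| ≤ 0.15925) (y : ℝ) :
    0 ≤ ∫ u in (0:ℝ)..1, kk u * Real.cosh (u * x) * Real.cosh (u * x') * Real.cos (u * y) := by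
  have hk := kk_cont
  refine strip_pos (κ := fun u => kk u * Real.cosh (u * x)) (by fun_prop) (B := 0.15925) (by norm_num) (fun y => ?_) hx' y
  have h1 := strip_pos (κ := fun u => kk u * Real.cosh (u * 0.15925)) (by fun_prop) (B := 0.15925) (by norm_num) (fun y => ?_) hx y
  · refine h1.trans_eq (intervalIntegral.integral_congr fun u _ => ?_)
    ring
  · refine (Q_cos y).trans_eq (intervalIntegral.integral_congr fun u hu => ?_)
    rw [uIcc_of_le zero_le_one] at hu
    simp only [kk_eq hu]
    have := (Real.cosh_pos (u * 0.15925)).ne'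
    field_simp

lemma polyint (c : ℕ → ℝ) (n : ℕ) :
    ∫ u in (0:ℝ)..1, ∑ i ∈ Finset.range n, c i * u ^ i = ∑ i ∈ Finset.range n, c i / (i + 1) := by
  rw [intervalIntegral.integral_finsetSum fun i _ => (by apply Continuous.intervalIntegrable; fun_prop)]
  refine Finset.sum_congr rfl fun i _ => ?_
  rw [intervalIntegral.integral_const_mul, integral_pow]
  simp; ring

lemma kk_low : 0.49476 ≤ ∫ u in (0:ℝ)..1, kk u := by
  have e := polyint (fun i => ([1, -135/203, -220/203 - 0.15925^2, 160/203 + 0.15925^2*135/203, 0.15925^2*220/203,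
    -8/203 - 0.15925^2*160/203, 0, 0.15925^2*8/203] : List ℝ).getD i 0) 8
  have : ∫ u in (0:ℝ)..1, Q u * (1 - (u*0.15925)^2) ≤ ∫ u in (0:ℝ)..1, kk u := by
    refine intervalIntegral.integral_mono_on zero_le_one (by unfold Q; apply Continuous.intervalIntegrable; fun_prop)
      (kk_cont.intervalIntegrable _ _) fun u hu => ?_
    rw [kk_eq hu, div_eq_mul_inv]
    refine mul_le_mul_of_nonneg_left ?_ (Q_nonneg hu.1 hu.2)
    generalize u * 0.15925 = v
    have h1 : Real.cosh v ^ 2 ≤ Real.exp (v^2) := by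
      have := pow_le_pow_left₀ (Real.cosh_pos v).le (Real.cosh_le_exp_half_sq v) 2
      rwa [← Real.exp_nat_mul, show ((2:ℕ):ℝ) * (v^2/2) = v^2 by push_cast; ring] at this
    calc 1 - v^2 ≤ Real.exp (-v^2) := by linarith [Real.add_one_le_exp (-v^2)]
      _ = (Real.exp (v^2))⁻¹ := Real.exp_neg _
      _ ≤ _ := inv_anti₀ (pow_pos (Real.cosh_pos _) 2) h1
  refine le_trans ?_ this
  have e2 : ∫ u in (0:ℝ)..1, Q u * (1 - (u*0.15925)^2) = _ := (intervalIntegral.integral_congr fun u _ => by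
    simp only [Finset.sum_range_succ, Finset.sum_range_zero, List.getD_cons_zero, List.getD_cons_succ]
    unfold Q; ring).trans e
  rw [e2]
  norm_num [Finset.sum_range_succ]

lemma kk_up : ∫ u in (0:ℝ)..1, u * kk u ≤ 0.15828 := by
  have e := polyint (fun i => ([0, 1, -135/203, -220/203 - 0.15925^2, 160/203 + 0.15925^2*135/203, 0.15925^2*220/203 + 0.15925^4,
    -8/203 - 0.15925^2*160/203 - 0.15925^4*135/203, -0.15925^4*220/203, 0.15925^2*8/203 + 0.15925^4*160/203, 0, -0.15925^4*8/203] : List ℝ).getD i 0) 11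
  have : ∫ u in (0:ℝ)..1, u * kk u ≤ ∫ u in (0:ℝ)..1, u * (Q u * (1 - (u*0.15925)^2 + (u*0.15925)^4)) := by
    refine intervalIntegral.integral_mono_on zero_le_one ((continuous_id.mul kk_cont).intervalIntegrable _ _)
      (by unfold Q; apply Continuous.intervalIntegrable; fun_prop) fun u hu => ?_
    rw [kk_eq hu, div_eq_mul_inv]
    refine mul_le_mul_of_nonneg_left (mul_le_mul_of_nonneg_left ?_ (Q_nonneg hu.1 hu.2)) hu.1
    have hv : 0 ≤ u * 0.15925 := mul_nonneg hu.1 (by norm_num)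
    generalize u * 0.15925 = v at *
    have h1 := pow_le_pow_left₀ hv (Real.self_le_sinh_iff.2 hv) 2
    have h2 := Real.cosh_sq v
    rw [inv_le_iff_one_le_mul₀ (pow_pos (Real.cosh_pos _) 2), h2]
    nlinarith [sq_nonneg v, pow_nonneg hv 6, mul_nonneg (sub_nonneg.2 h1) (by nlinarith [sq_nonneg (v^2-1/2)] : 0 ≤ 1 - v^2 + v^4)]
  refine le_trans this ?_
  have e2 : ∫ u in (0:ℝ)..1, u * (Q u * (1 - (u*0.15925)^2 + (u*0.15925)^4)) = _ := (intervalIntegral.integral_congr fun u _ => by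
    simp only [Finset.sum_range_succ, Finset.sum_range_zero, List.getD_cons_zero, List.getD_cons_succ]
    unfold Q; ring).trans e
  rw [e2]
  norm_num [Finset.sum_range_succ]

lemma G_exists : ∃ G θ, GoodG G θ ∧ 1 ≤ G 0 ∧ (∀ u ∈ Icc (0:ℝ) 1, kk u ≤ G (0.999 * u) ^ 2) ∧
    G 0 ^ 2 + 2 * (∫ a in (0:ℝ)..1, a * G a ^ 2) ≤ 1.3332 * (2 * 0.999 * ∫ u in (0:ℝ)..1, kk u) := by
  obtain ⟨p, hp⟩ := exists_polynomial_near_of_continuousOn (-1) 1 (fun a => √(kk (a/0.999)) + 0.0001)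
    (by have := kk_cont; fun_prop) 0.0001 (by norm_num)
  let f : ContDiffBump (0:ℝ) := ⟨0.999, 0.9995, by norm_num, by norm_num⟩
  let G : ℝ → ℝ := fun a => f a * ((p.eval a + p.eval (-a))/2)
  have hb : ∀ a, |a| ≤ 1 → √(kk (a/0.999)) ≤ (p.eval a + p.eval (-a))/2 ∧ (p.eval a + p.eval (-a))/2 ≤ √(kk (a/0.999)) + 0.0002 := by
    intro a ha
    have h1 := abs_lt.1 (hp a (abs_le.1 ha))
    have h2 := abs_lt.1 (hp (-a) (abs_le.1 ((abs_neg a).trans_le ha)))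
    simp only [neg_div, kk_even] at h1 h2
    constructor <;> linarith [h1.1, h1.2, h2.1, h2.2]
  have hG1 : ∀ a, |a| ≤ 0.999 → G a = (p.eval a + p.eval (-a))/2 := fun a ha => by
    have : f a = 1 := f.one_of_mem_closedBall (by simpa using ha)
    simp only [G, this, one_mul]
  have hup : ∀ a, |a| ≤ 1 → G a ^ 2 ≤ kk (a/0.999) + 0.0008 := by
    intro a ha
    have h1 := hb a ha
    have h2 := Real.sqrt_nonneg (kk (a/0.999))
    have h3 := Real.sq_sqrt (kk_nonneg (a/0.999))
    have h4 : √(kk (a/0.999)) ≤ 1 := Real.sqrt_le_one.2 (kk_le_one _)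
    have h5 : 0 ≤ f a := f.nonneg
    have h6 : f a ≤ 1 := f.le_one
    have h7 : G a ≤ √(kk (a/0.999)) + 0.0002 := by
      refine le_trans ?_ h1.2
      exact mul_le_of_le_one_left (h2.trans h1.1) h6
    have h8 : 0 ≤ G a := mul_nonneg h5 (h2.trans h1.1)
    nlinarith
  have hk0 : kk 0 = 1 := by simp [kk, Q]
  have hgood : GoodG G 0.9995 := by
    refine ⟨?_, fun a => ?_, fun a ha => ?_, by norm_num, by norm_num⟩
    · refine f.contDiff.mul (ContDiff.div_const ?_ _)
      have hpc : ContDiff ℝ (⊤:ℕ∞) fun a => p.eval a := by simpa using p.contDiff_aeval (𝕜 := ℝ) (⊤:ℕ∞)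
      exact hpc.add (hpc.comp contDiff_neg)
    · simp only [G, f.neg, neg_neg, add_comm]
    · simp only [G]; rw [f.zero_of_le_dist (by simpa using ha), zero_mul]
  refine ⟨G, 0.9995, hgood, ?_, fun u hu => ?_, ?_⟩
  · rw [hG1 0 (by norm_num)]
    have := (hb 0 (by norm_num)).1
    simpa [hk0] using this
  · have ha : |0.999 * u| ≤ 0.999 := by rw [abs_of_nonneg (by linarith [hu.1])]; linarith [hu.2]
    rw [hG1 _ ha]
    have := (hb (0.999 * u) (ha.trans (by norm_num))).1
    rw [mul_div_cancel_left₀ u (by norm_num)] at this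
    rw [← Real.sq_sqrt (kk_nonneg u)]
    exact pow_le_pow_left₀ (Real.sqrt_nonneg _) this 2
  · have h0 := hup 0 (by norm_num)
    rw [zero_div, hk0] at h0
    have hk := kk_cont
    have hGc := hgood.smooth.continuous
    have i1 : ∫ a in (0:ℝ)..1, a * G a ^ 2 ≤ ∫ a in (0:ℝ)..1, (a * kk (a/0.999) + 0.0008 * a) := by
      refine intervalIntegral.integral_mono_on zero_le_one (by apply Continuous.intervalIntegrable; fun_prop)
        (by apply Continuous.intervalIntegrable; fun_prop) fun a ha => ?_
      have := hup a (by rw [abs_of_nonneg ha.1]; exact ha.2)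
      nlinarith [ha.1]
    have i2 : ∫ a in (0:ℝ)..1, a * kk (a/0.999) = 0.999 ^ 2 * ∫ u in (0:ℝ)..1, u * kk u := by
      have e1 : ∀ a : ℝ, a * kk (a/0.999) = 0.999 * ((fun u => u * kk u) (a/0.999)) := fun a => by
        simp only []; ring
      simp_rw [e1]
      rw [intervalIntegral.integral_const_mul, intervalIntegral.integral_comp_div (fun u => u * kk u) (by norm_num),
        ← intervalIntegral.integral_add_adjacent_intervals (b := 1) (by apply Continuous.intervalIntegrable; fun_prop)
          (by apply Continuous.intervalIntegrable; fun_prop), zero_div]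
      have : ∫ u in (1:ℝ)..(1/0.999), u * kk u = 0 := by
        refine intervalIntegral.integral_zero_ae (ae_of_all _ fun u hu => ?_)
        rw [uIoc_of_le (by norm_num)] at hu
        rw [kk, abs_of_pos (by linarith [hu.1]), min_eq_right hu.1.le]
        norm_num [Q]
      rw [this, smul_eq_mul]; ring
    rw [intervalIntegral.integral_add (by apply Continuous.intervalIntegrable; fun_prop) (by apply Continuous.intervalIntegrable; fun_prop),
      i2, intervalIntegral.integral_const_mul, integral_id] at i1
    have := kk_up
    have := kk_low
    linarith

lemma VV_sq (T a : ℝ) : ‖VV T a‖ ^ 2 = ∑ ρ ∈ band T, ∑ ρ' ∈ band T, (ordE ρ : ℝ) * ordE ρ' *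
    (Real.cosh (Real.log T * (ρ.re - 1/2) * a) * Real.cosh (Real.log T * (ρ'.re - 1/2) * a) *
      Real.cos (Real.log T * (ρ.im - ρ'.im) * a)) := by
  have hr : (VV T a).re = ∑ ρ ∈ band T, (ordE ρ * Real.cosh (Real.log T * (ρ.re - 1/2) * a)) * Real.cos (Real.log T * ρ.im * a) := by
    rw [VV, Complex.re_sum]
    exact Finset.sum_congr rfl fun ρ _ => by rw [Complex.re_ofReal_mul, Complex.exp_ofReal_mul_I_re]
  have hi : (VV T a).im = ∑ ρ ∈ band T, (ordE ρ * Real.cosh (Real.log T * (ρ.re - 1/2) * a)) * Real.sin (Real.log T * ρ.im * a) := by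
    rw [VV, Complex.im_sum]
    exact Finset.sum_congr rfl fun ρ _ => by rw [Complex.im_ofReal_mul, Complex.exp_ofReal_mul_I_im]
  rw [Complex.sq_norm, Complex.normSq_apply, hr, hi, Finset.sum_mul_sum, Finset.sum_mul_sum, ← Finset.sum_add_distrib]
  refine Finset.sum_congr rfl fun ρ _ => ?_
  rw [← Finset.sum_add_distrib]
  refine Finset.sum_congr rfl fun ρ' _ => ?_
  rw [show Real.log T * (ρ.im - ρ'.im) * a = Real.log T * ρ.im * a - Real.log T * ρ'.im * a by ring, Real.cos_sub]
  ring

lemma GV_low {G : ℝ → ℝ} {θ : ℝ} (hG : GoodG G θ) (T : ℝ) (hk : ∀ u ∈ Icc (0:ℝ) 1, kk u ≤ G (0.999 * u) ^ 2) :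
    2 * 0.999 * ∫ u in (0:ℝ)..1, kk u * ‖VV T (0.999 * u)‖ ^ 2 ≤ ∫ a, G a ^ 2 * ‖VV T a‖ ^ 2 := by
  have hGc := hG.smooth.continuous
  have hVc := (VV_contDiff T).continuous
  have hkc := kk_cont
  set f : ℝ → ℝ := fun a => G a ^ 2 * ‖VV T a‖ ^ 2 with hf
  have hfc : Continuous f := by fun_prop
  have hcs : HasCompactSupport f := by
    refine HasCompactSupport.intro (isCompact_Icc (a := -1) (b := 1)) fun a ha => ?_
    have : θ ≤ |a| := by
      by_contra h2
      rw [not_le, abs_lt] at h2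
      exact ha ⟨by linarith [hG.lt], by linarith [hG.lt]⟩
    simp [hf, hG.supp a this]
  have hev : ∀ a, f (-a) = f a := fun a => by
    simp only [hf, hG.even, VV_sq, mul_neg, Real.cosh_neg, Real.cos_neg]
  have h1 : ∫ a in (-0.999:ℝ)..0.999, f a ≤ ∫ a, f a := by
    rw [intervalIntegral.integral_of_le (by norm_num)]
    exact setIntegral_le_integral (hfc.integrable_of_hasCompactSupport hcs) (ae_of_all _ fun a => by positivity)
  have h2 : ∫ a in (-0.999:ℝ)..0, f a = ∫ a in (0:ℝ)..0.999, f a := by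
    have := intervalIntegral.integral_comp_neg (a := 0) (b := 0.999) f
    simp only [hev, neg_zero] at this
    exact this.symm
  have h3 : ∫ a in (0:ℝ)..0.999, f a = 0.999 * ∫ u in (0:ℝ)..1, f (0.999 * u) := by
    rw [intervalIntegral.integral_comp_mul_left f (by norm_num)]
    rw [smul_eq_mul, mul_inv_cancel_left₀ (by norm_num), mul_zero, mul_one]
  rw [← intervalIntegral.integral_add_adjacent_intervals (hfc.intervalIntegrable _ 0) (hfc.intervalIntegrable _ _), h2, h3] at h1
  have h4 : ∫ u in (0:ℝ)..1, kk u * ‖VV T (0.999 * u)‖ ^ 2 ≤ ∫ u in (0:ℝ)..1, f (0.999 * u) := by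
    refine intervalIntegral.integral_mono_on zero_le_one (by apply Continuous.intervalIntegrable; fun_prop)
      (by apply Continuous.intervalIntegrable; fun_prop) fun u hu => ?_
    exact mul_le_mul_of_nonneg_right (hk u hu) (by positivity)
  linarith

lemma pair_low {T : ℝ} (hb : ∀ ρ ∈ band T, |Real.log T * (ρ.re - 1/2)| ≤ 0.15925) :
    (∫ u in (0:ℝ)..1, kk u) * (2 * (∑ ρ ∈ band T, (ordE ρ : ℝ)) - Nline T) ≤
      ∫ u in (0:ℝ)..1, kk u * ‖VV T (0.999 * u)‖ ^ 2 := by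
  classical
  have hkc := kk_cont
  have hK : 0 ≤ ∫ u in (0:ℝ)..1, kk u := intervalIntegral.integral_nonneg zero_le_one fun u _ => kk_nonneg u
  set J : ℂ → ℂ → ℝ := fun ρ ρ' => ∫ u in (0:ℝ)..1, kk u * Real.cosh (u * (0.999 * (Real.log T * (ρ.re - 1/2)))) *
    Real.cosh (u * (0.999 * (Real.log T * (ρ'.re - 1/2)))) * Real.cos (u * (0.999 * (Real.log T * (ρ.im - ρ'.im)))) with hJ
  have e : ∫ u in (0:ℝ)..1, kk u * ‖VV T (0.999 * u)‖ ^ 2 = ∑ ρ ∈ band T, ∑ ρ' ∈ band T, (ordE ρ : ℝ) * ordE ρ' * J ρ ρ' := by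
    simp_rw [VV_sq, Finset.mul_sum]
    rw [intervalIntegral.integral_finsetSum fun ρ _ => (by apply Continuous.intervalIntegrable; fun_prop)]
    refine Finset.sum_congr rfl fun ρ _ => ?_
    rw [intervalIntegral.integral_finsetSum fun ρ' _ => (by apply Continuous.intervalIntegrable; fun_prop)]
    refine Finset.sum_congr rfl fun ρ' _ => ?_
    rw [hJ, ← intervalIntegral.integral_const_mul]
    refine intervalIntegral.integral_congr fun u _ => ?_
    ring_nf
  have hb' : ∀ ρ ∈ band T, |0.999 * (Real.log T * (ρ.re - 1/2))| ≤ 0.15925 := fun ρ hρ => by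
    rw [abs_mul, abs_of_pos (by norm_num : (0:ℝ) < 0.999)]
    have := hb ρ hρ
    linarith [abs_nonneg (Real.log T * (ρ.re - 1/2))]
  have hJ0 : ∀ ρ ∈ band T, ∀ ρ' ∈ band T, 0 ≤ J ρ ρ' := fun ρ h ρ' h' => kk_pos (hb' ρ h) (hb' ρ' h') _
  have hJ1 : ∀ ρ ρ' : ℂ, ρ.im = ρ'.im → ∫ u in (0:ℝ)..1, kk u ≤ J ρ ρ' := by
    intro ρ ρ' h
    refine intervalIntegral.integral_mono_on zero_le_one (kk_cont.intervalIntegrable _ _)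
      (by apply Continuous.intervalIntegrable; fun_prop) fun u _ => ?_
    rw [h, sub_self, mul_zero, mul_zero, mul_zero, Real.cos_zero, mul_one, mul_assoc]
    exact le_mul_of_one_le_right (kk_nonneg u) (one_le_mul_of_one_le_of_one_le (Real.one_le_cosh _) (Real.one_le_cosh _))
  have hm : ∀ ρ ∈ band T, (1:ℝ) ≤ ordE ρ := fun ρ h => by
    exact_mod_cast ordE_pos (mem_band.1 h).1
  rw [e, Nline_eq, Finset.sum_filter, Finset.mul_sum, ← Finset.sum_sub_distrib, Finset.mul_sum]
  refine Finset.sum_le_sum fun ρ hρ => ?_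
  have hmρ := hm ρ hρ
  have hall : ∀ s ⊆ band T, ∑ ρ' ∈ s, (ordE ρ : ℝ) * ordE ρ' * J ρ ρ' ≤ ∑ ρ' ∈ band T, (ordE ρ : ℝ) * ordE ρ' * J ρ ρ' :=
    fun s hs => Finset.sum_le_sum_of_subset_of_nonneg hs fun ρ' h' _ => mul_nonneg (by positivity) (hJ0 ρ hρ ρ' h')
  have hone : ∀ ρ' ∈ band T, ρ.im = ρ'.im → ordE ρ * (∫ u in (0:ℝ)..1, kk u) ≤ (ordE ρ : ℝ) * ordE ρ' * J ρ ρ' := by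
    intro ρ' h' him
    rw [mul_assoc]
    refine mul_le_mul_of_nonneg_left ((hJ1 ρ ρ' him).trans ?_) (by positivity)
    exact le_mul_of_one_le_left (hJ0 ρ hρ ρ' h') (hm ρ' h')
  split_ifs with h
  · refine le_trans ?_ (hall {ρ} (by simpa using hρ))
    rw [Finset.sum_singleton]
    exact le_trans (by linarith) (hone ρ hρ rfl)
  · have h2 := refl_mem hρ
    have hne : ρ ≠ 1 - starRingEnd ℂ ρ := fun hh => h (by
      have := congrArg Complex.re hh
      simp at this; linarith)
    refine le_trans ?_ (hall {ρ, 1 - starRingEnd ℂ ρ} (by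
      intro z hz; simp only [Finset.mem_insert, Finset.mem_singleton] at hz
      rcases hz with rfl | rfl <;> assumption))
    rw [Finset.sum_pair hne]
    have := hone ρ hρ rfl
    have := hone _ h2 (by simp)
    linarith

/-- If all nontrivial zeros with `T < γ ≤ 2T` lie in the box of width `0.3185 / log T`
centered at the critical line, then the number of zeros on the critical line with
`T < γ ≤ 2T` (with multiplicity) is at least `(0.66666908 + o(1)) (T/2π) log T`. -/
theorem critical_bound_b_point3185
    (hbox : ∀ᶠ T in atTop, ∀ ρ ∈ zeroBand T, |ρ.re - 1/2| < 0.3185 / (2 * Real.log T)) :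
    ∃ ε : ℝ → ℝ, Tendsto ε atTop (nhds 0) ∧
      ∀ᶠ T in atTop, (0.66666908 + ε T) * (T / (2 * Real.pi)) * Real.log T ≤ Nline T := by
  refine ⟨fun _ => 0, tendsto_const_nhds, ?_⟩
  obtain ⟨G, θ, hG, hG0, hk, hC⟩ := G_exists
  filter_upwards [SS_mean hG (box_ev hbox) (show (0:ℝ) < 0.00001 by norm_num), hbox, eventually_ge_atTop 3] with T hT hb hT3
  obtain ⟨hS, hN⟩ := hT
  have hL := one_le_log hT3
  have hπ := Real.pi_pos
  rw [planch hG hT3] at hS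
  have h1 := GV_low hG T hk
  have h2 := pair_low (T := T) (fun ρ hρ => by
    have hm := mem_band.1 hρ
    have := hb ρ ⟨(xiE_eq_zero_iff ρ).1 hm.1, hm.2⟩
    rw [abs_mul, abs_of_pos (by linarith : 0 < Real.log T)]
    rw [lt_div_iff₀ (by linarith)] at this
    linarith)
  have hK := kk_low
  set K := ∫ u in (0:ℝ)..1, kk u
  set N := ∑ ρ ∈ band T, (ordE ρ : ℝ)
  set W := 2 * N - Nline T with hW
  set L := Real.log T
  set P := 2 * Real.pi with hP
  have hTL : 0 < T * L := by nlinarith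
  have h3 : P * L * (2 * 0.999 * (K * W)) ≤ T * L ^ 2 * (1.3332 * (2 * 0.999 * K) + 0.00001) := by
    calc _ ≤ P * L * ∫ a, G a ^ 2 * ‖VV T a‖ ^ 2 := by
          refine mul_le_mul_of_nonneg_left ?_ (by positivity)
          linarith
      _ ≤ _ := hS
      _ ≤ _ := by refine mul_le_mul_of_nonneg_left ?_ (by positivity); linarith
  have h4 : P * W ≤ T * L * 1.33322 := by
    have : (L * (2 * 0.999 * K)) * (P * W) ≤ (L * (2 * 0.999 * K)) * (T * L * 1.33322) := by
      nlinarith [mul_nonneg (mul_nonneg hTL.le (by linarith : 0 ≤ L)) (by linarith : 0 ≤ K - 0.49476)]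
    exact le_of_mul_le_mul_left this (mul_pos (by linarith) (by linarith))
  have h5 : T * L * (1 - 0.00001) ≤ P * N := by
    have h6 := (abs_le.1 hN).1
    by_contra hcon
    push Not at hcon
    nlinarith
  rw [add_zero, mul_assoc, div_mul_eq_mul_div, mul_div_assoc', div_le_iff₀ (by positivity)]
  rw [hW] at h4
  nlinarith
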